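/- (Laurinčikas's universality theorem for ζ'/ζ.) Let K be a compact subset of the open strip D(1/2,1) = {s ∈ ℂ : 1/2 < Re(s) < 1} whose complement in ℂ is connected. Let F : K → ℂ be continuous on K and analytic on the interior of K. Then for every ε > 0, liminf_{T→∞} (1/(2T)) · μ{ τ ∈ [−T, T] : sup_{s ∈ K} |(ζ'/ζ)(s + iτ) − F(s)| < ε } > 0, where μ denotes Lebesgue measure on ℝ. -/

import Mathlib

open Complex Filter MeasureTheory

def InP (K : Set ℂ) [CompactSpace K] (f : ℂ → ℂ) : Prop :=
  ∃ g ∈ (polynomialFunctions K).topologicalClosure, ∀ z : K, g z = f z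

namespace InP
variable {K : Set ℂ} [CompactSpace K] {f g : ℂ → ℂ}

lemma congr (h : InP K f) (e : ∀ z ∈ K, f z = g z) : InP K g := by
  obtain ⟨a, ha, h⟩ := h
  exact ⟨a, ha, fun z => by rw [h, e z z.2]⟩

lemma add (hf : InP K f) (hg : InP K g) : InP K (fun z => f z + g z) := by
  obtain ⟨a, ha, h⟩ := hf
  obtain ⟨b, hb, h'⟩ := hg
  exact ⟨a + b, add_mem ha hb, fun z => by simp [h, h']⟩

lemma mul (hf : InP K f) (hg : InP K g) : InP K (fun z => f z * g z) := by
  obtain ⟨a, ha, h⟩ := hf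
  obtain ⟨b, hb, h'⟩ := hg
  exact ⟨a * b, mul_mem ha hb, fun z => by simp [h, h']⟩

lemma poly (p : Polynomial ℂ) : InP K (fun z => p.eval z) :=
  ⟨Polynomial.toContinuousMapOn p K, Subalgebra.le_topologicalClosure _ (by
    rw [← SetLike.mem_coe, polynomialFunctions_coe]; exact ⟨p, rfl⟩), fun z => by simp⟩

lemma const (c : ℂ) : InP K (fun _ => c) := by
  simpa using poly (K := K) (Polynomial.C c)

lemma id : InP K (fun z => z) := by
  simpa using poly (K := K) Polynomial.X

lemma sum {ι : Type*} (s : Finset ι) {F : ι → ℂ → ℂ} (h : ∀ i ∈ s, InP K (F i)) :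
    InP K (fun z => ∑ i ∈ s, F i z) := by
  classical
  induction s using Finset.induction_on with
  | empty => simpa using const (K := K) 0
  | insert a s ha ih =>
    simp only [Finset.sum_insert ha]
    exact (h a (by simp)).add (ih fun i hi => h i (by simp [hi]))

lemma pow (hf : InP K f) (n : ℕ) : InP K (fun z => f z ^ n) := by
  induction n with
  | zero => simpa using const (K := K) 1
  | succ n ih => simpa [pow_succ] using ih.mul hf

lemma approx (hf : InP K f) {ε : ℝ} (hε : 0 < ε) :
    ∃ p : Polynomial ℂ, ∀ z ∈ K, ‖f z - p.eval z‖ < ε := by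
  obtain ⟨a, ha, h⟩ := hf
  rw [← SetLike.mem_coe, Subalgebra.topologicalClosure_coe, Metric.mem_closure_iff] at ha
  obtain ⟨b, hb, hd⟩ := ha ε hε
  rw [polynomialFunctions_coe] at hb
  obtain ⟨p, rfl⟩ := hb
  refine ⟨p, fun z hz => ?_⟩
  have := (ContinuousMap.dist_lt_iff hε).1 hd ⟨z, hz⟩
  rw [dist_eq_norm, h ⟨z, hz⟩] at this
  simpa using this

lemma of_limit (hfc : ContinuousOn f K)
    (h : ∀ ε > 0, ∃ g, InP K g ∧ ∀ z ∈ K, ‖f z - g z‖ < ε) : InP K f := by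
  refine ⟨⟨K.domRestrict f, hfc.domRestrict⟩, ?_, fun z => rfl⟩
  rw [← SetLike.mem_coe]
  refine (Subalgebra.isClosed_topologicalClosure _).closure_subset ?_
  rw [Metric.mem_closure_iff]
  intro ε hε
  obtain ⟨g, ⟨a, ha, hag⟩, hg⟩ := h ε hε
  refine ⟨a, ha, (ContinuousMap.dist_lt_iff hε).2 fun z => ?_⟩
  rw [dist_eq_norm, hag]
  exact hg z z.2

lemma continuousOn (hf : InP K f) : ContinuousOn f K := by
  obtain ⟨a, ha, h⟩ := hf
  rw [continuousOn_iff_continuous_domRestrict]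
  convert a.continuous using 1
  ext z; exact (h z).symm

lemma comp (hf : InP K f) {ρ : ℝ} (hρ : ρ < 1) (hb : ∀ z ∈ K, ‖f z‖ ≤ ρ)
    {φ : ℂ → ℂ} (hφ : DifferentiableOn ℂ φ (Metric.ball 0 1)) : InP K (fun z => φ (f z)) := by
  rcases K.eq_empty_or_nonempty with rfl | ⟨z0, hz0⟩
  · exact (const 0).congr (by simp)
  have hρ0 : 0 ≤ ρ := (norm_nonneg _).trans (hb z0 hz0)
  obtain ⟨r, hr⟩ : ∃ r : NNReal, (r : ℝ) = (ρ + 1) / 2 := ⟨⟨_, by linarith⟩, rfl⟩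
  obtain ⟨r3, hr3⟩ : ∃ r : NNReal, (r : ℝ) = (ρ + 3) / 4 := ⟨⟨_, by linarith⟩, rfl⟩
  have hr1 : ρ < r := by linarith
  have h1 : (r : ℝ) < r3 := by linarith
  have h3 : (r3 : ℝ) < 1 := by linarith
  have hps := DifferentiableOn.hasFPowerSeriesOnBall (R := r3)
    (hφ.mono (Metric.closedBall_subset_ball (x := (0 : ℂ)) h3)) (by
      rw [← NNReal.coe_pos]; linarith)
  obtain ⟨a, ha, C, hC, hh⟩ := hps.uniform_geometric_approx (r' := r) (by
    exact_mod_cast h1)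
  refine of_limit ?_ ?_
  · refine hφ.continuousOn.comp hf.continuousOn fun z hz => ?_
    simpa using (hb z hz).trans_lt hρ
  intro ε hε
  have := (tendsto_pow_atTop_nhds_zero_of_lt_one ha.1.le ha.2).const_mul C
  rw [mul_zero] at this
  obtain ⟨n, hn⟩ := (this.eventually (gt_mem_nhds hε)).exists
  refine ⟨fun z => (cauchyPowerSeries φ 0 r3).partialSum n (f z), ?_, fun z hz => ?_⟩
  · simp only [FormalMultilinearSeries.partialSum, FormalMultilinearSeries.apply_eq_pow_smul_coeff]
    exact sum _ fun i _ => (hf.pow i).mul (const _)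
  · have := hh (f z) (by simpa using (hb z hz).trans_lt hr1) n
    rw [zero_add] at this
    exact this.trans_lt hn

lemma inv_sub (hc : IsConnected Kᶜ) {w : ℂ} (hw : w ∉ K) :
    InP K (fun z => (z - w)⁻¹) := by
  let S := (polynomialFunctions K).topologicalClosure
  have : IsClosed (S : Set C(K, ℂ)) := Subalgebra.isClosed_topologicalClosure _
  let X : C(K, ℂ) := Polynomial.toContinuousMapOn Polynomial.X K
  have hX : X ∈ S := Subalgebra.le_topologicalClosure _ (by
    rw [← SetLike.mem_coe, polynomialFunctions_coe]; exact ⟨_, rfl⟩)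
  have hsp : spectrum ℂ X = K := by
    rw [ContinuousMap.spectrum_eq_range]
    ext z; simp [X]
  have := Subalgebra.spectrum_eq_of_isPreconnected_compl (𝕜 := ℂ) S ⟨X, hX⟩ (by
    simp only [hsp]; exact hc.isPreconnected)
  have hw' : w ∉ spectrum ℂ (⟨X, hX⟩ : S) := by
    rw [this]; simp only [hsp]; exact hw
  rw [spectrum.notMem_iff] at hw'
  obtain ⟨v, hv⟩ := hw'.exists_right_inv
  refine ⟨-(v : C(K, ℂ)), neg_mem v.2, fun z => ?_⟩
  have h2 := congrArg (fun a : S => (a : C(K, ℂ)) z) hv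
  have h3 : (w - z) * (v : C(K, ℂ)) z = 1 := by
    simpa [X, Algebra.algebraMap_eq_smul_one] using h2
  have h4 : (z : ℂ) - w ≠ 0 := fun h => hw (by rw [← sub_eq_zero.1 h]; exact z.2)
  rw [ContinuousMap.neg_apply]
  refine eq_inv_of_mul_eq_one_left ?_
  linear_combination h3
end InP

noncomputable def sq1 (w : ℂ) : ℂ := exp (log (1 - w) / 2)

lemma sq1_slit {w : ℂ} (hw : ‖w‖ < 1) : 1 - w ∈ slitPlane := by
  left
  have := (abs_le.1 (Complex.abs_re_le_norm w)).2
  simp; linarith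

lemma sq1_diff : DifferentiableOn ℂ sq1 (Metric.ball 0 1) := by
  intro w hw
  have hw : ‖w‖ < 1 := by simpa using hw
  refine DifferentiableAt.differentiableWithinAt ?_
  unfold sq1
  have : DifferentiableAt ℂ (fun w : ℂ => log (1 - w)) w :=
    DifferentiableAt.clog (by fun_prop) (sq1_slit hw)
  fun_prop

lemma sq1_sq {w : ℂ} (hw : ‖w‖ < 1) : sq1 w ^ 2 = 1 - w := by
  rw [sq1, ← exp_nat_mul]
  rw [show ((2 : ℕ) : ℂ) * (log (1 - w) / 2) = log (1 - w) by push_cast; ring]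
  exact exp_log (slitPlane_ne_zero (sq1_slit hw))

def GoodS (K : Set ℂ) [CompactSpace K] (p : ℂ) (δ : ℝ) (x : ℂ) : Prop :=
  ‖x - p‖ < 2 * δ ∧ ∃ h : ℂ → ℂ, ContinuousOn h {z | 2 * δ < ‖z - p‖} ∧
    (∀ z, (z ∈ K ∨ 2 * δ < ‖z - p‖) → h z ^ 2 = (z - x) / (z - p)) ∧ InP K h

lemma GoodS.step {K : Set ℂ} [CompactSpace K] (hc : IsConnected Kᶜ) {p : ℂ} {δ : ℝ} {x x' : ℂ}
    (hx : GoodS K p δ x) (h1 : ‖x - p‖ < δ) (h2 : ‖x' - x‖ < δ) {ρ : ℝ} (hρ : ρ < 1)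
    (hxK : x ∉ K) (h3 : ∀ z ∈ K, ‖x' - x‖ ≤ ρ * ‖z - x‖) : GoodS K p δ x' := by
  obtain ⟨-, h, hcont, hsq, hP⟩ := hx
  have key : ∀ z, 2 * δ < ‖z - p‖ → z - x ≠ 0 ∧ ‖(x' - x) * (z - x)⁻¹‖ < 1 := by
    intro z hz
    have : δ < ‖z - x‖ := by
      have := norm_add_le (z - x) (x - p)
      rw [sub_add_sub_cancel] at this
      linarith
    have h0 : 0 < ‖z - x‖ := by linarith [norm_nonneg (x - p)]
    refine ⟨norm_pos_iff.1 h0, ?_⟩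
    rw [norm_mul, norm_inv, ← div_eq_mul_inv, div_lt_one h0]
    linarith
  have keyK : ∀ z ∈ K, z - x ≠ 0 ∧ ‖(x' - x) * (z - x)⁻¹‖ ≤ ρ := by
    intro z hz
    have h0 : z - x ≠ 0 := fun h => hxK (by rwa [← sub_eq_zero.1 h])
    refine ⟨h0, ?_⟩
    rw [norm_mul, norm_inv, ← div_eq_mul_inv, div_le_iff₀ (norm_pos_iff.2 h0)]
    exact h3 z hz
  refine ⟨?_, fun z => h z * sq1 ((x' - x) * (z - x)⁻¹), ?_, ?_, ?_⟩
  · have := norm_add_le (x' - x) (x - p)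
    rw [sub_add_sub_cancel] at this
    linarith
  · refine hcont.mul (sq1_diff.continuousOn.comp ?_ fun z hz => by simpa using (key z hz).2)
    exact continuousOn_const.mul (ContinuousOn.inv₀ (by fun_prop) fun z hz => (key z hz).1)
  · intro z hz
    have hh : z - x ≠ 0 ∧ ‖(x' - x) * (z - x)⁻¹‖ < 1 := by
      rcases hz with hz | hz
      · exact ⟨(keyK z hz).1, (keyK z hz).2.trans_lt hρ⟩
      · exact key z hz
    have h0 := hh.1
    simp only [mul_pow, hsq z hz, sq1_sq hh.2]
    rw [div_mul_eq_mul_div]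
    congr 1
    field_simp
    ring
  · refine hP.mul (InP.comp ((InP.const (x' - x)).mul (InP.inv_sub hc hxK)) hρ ?_ sq1_diff)
    exact fun z hz => (keyK z hz).2

lemma exists_goodS {K : Set ℂ} [CompactSpace K] (hc : IsConnected Kᶜ) {p : ℂ} {δ : ℝ}
    (hδ : 0 < δ) (hp : p ∉ K) : ∃ x, δ ≤ ‖x - p‖ ∧ GoodS K p δ x := by
  by_contra! hno
  have hK : IsCompact K := isCompact_iff_compactSpace.2 inferInstance
  have hlt : ∀ x, GoodS K p δ x → ‖x - p‖ < δ := fun x hx => by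
    by_contra! h; exact hno x h hx
  -- local step
  have hloc : ∀ x ∉ K, ∃ r > 0, ∀ y z, ‖y - x‖ < r → ‖z - x‖ < r → y ∉ K ∧ (GoodS K p δ y → GoodS K p δ z) := by
    intro x hx
    obtain ⟨r0, hr0, hb⟩ := Metric.isOpen_iff.1 hK.isClosed.isOpen_compl x hx
    refine ⟨min (r0 / 5) (δ / 2), by positivity, fun y z hy hz => ?_⟩
    have hy1 := hy.trans_le (min_le_left _ _)
    have hy2 := hy.trans_le (min_le_right _ _)
    have hz1 := hz.trans_le (min_le_left _ _)
    have hz2 := hz.trans_le (min_le_right _ _)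
    have hyK : y ∉ K := hb (by rw [mem_ball_iff_norm]; linarith)
    have hzy : ‖z - y‖ ≤ ‖z - x‖ + ‖y - x‖ := by
      have := norm_sub_le (z - x) (y - x)
      rwa [sub_sub_sub_cancel_right] at this
    refine ⟨hyK, fun hg => hg.step hc (hlt y hg) (by linarith) (ρ := 1 / 2) (by norm_num) hyK ?_⟩
    intro w hw
    have h1 : r0 ≤ ‖w - x‖ := by
      by_contra! h; exact hb (by rwa [mem_ball_iff_norm]) hw
    have := norm_add_le (w - y) (y - x)
    rw [sub_add_sub_cancel] at this
    linarith
  have hp0 : GoodS K p δ p := by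
    refine ⟨by simpa using by linarith, fun _ => 1, continuousOn_const, fun z hz => ?_, InP.const 1⟩
    have : z - p ≠ 0 := by
      rcases hz with hz | hz
      · exact fun h => hp (by rwa [← sub_eq_zero.1 h])
      · exact norm_pos_iff.1 (by linarith)
    simp [this]
  have hsub : Kᶜ ⊆ {x | GoodS K p δ x} := by
    have hpre := hc.isPreconnected
    rw [isPreconnected_iff_subset_of_disjoint] at hpre
    let U : Set ℂ := {x | x ∈ Kᶜ ∧ GoodS K p δ x}
    let V : Set ℂ := {x | x ∈ Kᶜ ∧ ¬ GoodS K p δ x}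
    have hU : IsOpen U := by
      rw [Metric.isOpen_iff]
      rintro x ⟨hx, hg⟩
      obtain ⟨r, hr, h⟩ := hloc x hx
      refine ⟨r, hr, fun y hy => ?_⟩
      rw [mem_ball_iff_norm] at hy
      exact ⟨(h y y hy hy).1, (h x y (by simpa) hy).2 hg⟩
    have hV : IsOpen V := by
      rw [Metric.isOpen_iff]
      rintro x ⟨hx, hg⟩
      obtain ⟨r, hr, h⟩ := hloc x hx
      refine ⟨r, hr, fun y hy => ?_⟩
      rw [mem_ball_iff_norm] at hy
      exact ⟨(h y y hy hy).1, fun h' => hg ((h y x hy (by simpa)).2 h')⟩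
    rcases hpre U V hU hV (fun x hx => by by_cases h : GoodS K p δ x <;> simp [U, V, h] <;> exact hx)
      (by ext x; simp [U, V]; tauto) with h | h
    · exact fun x hx => (h hx).2
    · exact absurd hp0 (h hp).2
  have hbd : Bornology.IsBounded (Kᶜ ∪ K) := by
    refine Bornology.IsBounded.union ?_ hK.isBounded
    refine (Metric.isBounded_ball (x := p) (r := δ)).subset fun x hx => ?_
    rw [mem_ball_iff_norm]; exact hlt x (hsub hx)
  rw [Set.compl_union_self] at hbd
  exact NormedSpace.unbounded_univ ℂ ℂ hbd


lemma kernel_far {d u v e : ℂ} {δ : ℝ} (hδ : 0 < δ) (hd : ‖d‖ ≤ δ) (hd0 : d ≠ 0)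
    (he : ‖e‖ ≤ 3 * δ) (hv : v * (2 * u - v) = d ^ 2) (hvu : ‖v‖ * ‖u‖ ≤ ‖d‖ ^ 2)
    (hz : 8 * δ ≤ ‖u - e‖) :
    ‖2 * v / d ^ 2 + e * (2 * v / d ^ 2) ^ 2 - (u - e)⁻¹‖ ≤ 100 * δ ^ 2 / ‖u - e‖ ^ 3 := by
  set ρ := ‖u - e‖ with hρ
  have hρ0 : 0 < ρ := by linarith
  have hu1 : 5 / 8 * ρ ≤ ‖u‖ := by
    have := norm_sub_le u e
    linarith
  have hu0 : 0 < ‖u‖ := by linarith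
  have hu : u ≠ 0 := norm_pos_iff.1 hu0
  have hue : u - e ≠ 0 := norm_pos_iff.1 hρ0
  have hd' : 0 < ‖d‖ := norm_pos_iff.2 hd0
  set w := v / d with hw
  have hvw : v = w * d := by rw [hw, div_mul_cancel₀ _ hd0]
  have hwu : ‖w‖ ≤ ‖d‖ / ‖u‖ := by
    rw [hw, norm_div, div_le_div_iff₀ hd' hu0]; nlinarith
  have hg : 2 * v / d ^ 2 = (1 + w ^ 2) / u := by
    rw [div_eq_div_iff (by positivity) hu, hvw]
    rw [hvw] at hv
    linear_combination hv
  have hid : 2 * v / d ^ 2 + e * (2 * v / d ^ 2) ^ 2 - (u - e)⁻¹ =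
      w ^ 2 / u + e * w ^ 2 * (2 + w ^ 2) / u ^ 2 - e ^ 2 / (u ^ 2 * (u - e)) := by
    rw [hg]; field_simp; ring
  have hu5 : 5 * δ ≤ ‖u‖ := by linarith
  have hw1 : ‖w‖ ≤ δ / ‖u‖ := hwu.trans (by gcongr)
  have hw2 : ‖w‖ ≤ 1 := hw1.trans (by rw [div_le_one hu0]; linarith)
  have hww : ‖w‖ ^ 2 ≤ δ ^ 2 / ‖u‖ ^ 2 := by rw [← div_pow]; gcongr
  rw [hid]
  have e1 : ‖w ^ 2 / u‖ ≤ δ ^ 2 / ‖u‖ ^ 3 := by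
    rw [norm_div, norm_pow]
    calc ‖w‖ ^ 2 / ‖u‖ ≤ (δ ^ 2 / ‖u‖ ^ 2) / ‖u‖ := by gcongr
      _ = _ := by rw [div_div]; ring
  have e2 : ‖e * w ^ 2 * (2 + w ^ 2) / u ^ 2‖ ≤ 2 * (δ ^ 2 / ‖u‖ ^ 3) := by
    rw [norm_div, norm_mul, norm_mul, norm_pow, norm_pow]
    have h3 : ‖2 + w ^ 2‖ ≤ 3 := by
      refine (norm_add_le _ _).trans ?_
      rw [norm_pow]
      have : ‖w‖ ^ 2 ≤ 1 := pow_le_one₀ (norm_nonneg _) hw2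
      simp; linarith
    calc ‖e‖ * ‖w‖ ^ 2 * ‖2 + w ^ 2‖ / ‖u‖ ^ 2 ≤ (3 * δ) * (δ ^ 2 / ‖u‖ ^ 2) * 3 / ‖u‖ ^ 2 := by gcongr
      _ = (9 * δ / ‖u‖) * (δ ^ 2 / ‖u‖ ^ 3) := by field_simp; ring
      _ ≤ 2 * (δ ^ 2 / ‖u‖ ^ 3) := by
        gcongr; rw [div_le_iff₀ hu0]; linarith
  have e3 : ‖e ^ 2 / (u ^ 2 * (u - e))‖ ≤ 9 * δ ^ 2 / (‖u‖ ^ 2 * ρ) := by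
    rw [norm_div, norm_mul, norm_pow, norm_pow]
    have : ‖e‖ ^ 2 ≤ (3 * δ) ^ 2 := by gcongr
    gcongr
    linarith
  have f1 : δ ^ 2 / ‖u‖ ^ 3 ≤ 5 * (δ ^ 2 / ρ ^ 3) := by
    calc δ ^ 2 / ‖u‖ ^ 3 ≤ δ ^ 2 / (5 / 8 * ρ) ^ 3 := by gcongr
      _ = 512 / 125 * (δ ^ 2 / ρ ^ 3) := by field_simp; norm_num
      _ ≤ _ := by gcongr; norm_num
  have f2 : 9 * δ ^ 2 / (‖u‖ ^ 2 * ρ) ≤ 30 * (δ ^ 2 / ρ ^ 3) := by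
    calc 9 * δ ^ 2 / (‖u‖ ^ 2 * ρ) ≤ 9 * δ ^ 2 / ((5 / 8 * ρ) ^ 2 * ρ) := by gcongr
      _ = 576 / 25 * (δ ^ 2 / ρ ^ 3) := by field_simp; norm_num
      _ ≤ _ := by gcongr; norm_num
  have f3 : 0 ≤ δ ^ 2 / ρ ^ 3 := by positivity
  calc _ ≤ ‖w ^ 2 / u‖ + ‖e * w ^ 2 * (2 + w ^ 2) / u ^ 2‖ + ‖e ^ 2 / (u ^ 2 * (u - e))‖ :=
        (norm_sub_le _ _).trans (by gcongr; exact norm_add_le _ _)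
    _ ≤ 100 * (δ ^ 2 / ρ ^ 3) := by linarith
    _ = _ := by ring

lemma isPreconnected_far (p : ℂ) {r : ℝ} (hr : 0 ≤ r) : IsPreconnected {z : ℂ | r < ‖z - p‖} := by
  have h1 : IsPreconnected ((Set.Ioi r) ×ˢ (Set.univ : Set ℝ)) :=
    isPreconnected_Ioi.prod isPreconnected_univ
  have h2 := h1.image (fun q : ℝ × ℝ => p + (q.1 : ℂ) * exp (q.2 * I)) (by fun_prop)
  convert h2 using 1
  ext z
  simp only [Set.mem_setOf_eq, Set.mem_image, Set.mem_prod, Set.mem_Ioi, Set.mem_univ, and_true]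
  constructor
  · intro h
    refine ⟨(‖z - p‖, arg (z - p)), h, ?_⟩
    simp
  · rintro ⟨q, hq, rfl⟩
    simp only [add_sub_cancel_left, norm_mul, norm_exp_ofReal_mul_I, mul_one, norm_real,
      Real.norm_eq_abs]
    exact hq.trans_le (le_abs_self _)

/-- the Mergelyan kernel -/
lemma exists_kernel {K : Set ℂ} [CompactSpace K] (hc : IsConnected Kᶜ) {p : ℂ} {δ : ℝ}
    (hδ : 0 < δ) (hp : p ∉ K) : ∃ (g : ℂ → ℂ) (c : ℂ), InP K g ∧ ‖c - p‖ ≤ δ ∧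
      ∀ z ∈ K, ∀ ζ, ‖ζ - p‖ ≤ 2 * δ → ‖g z + (ζ - c) * g z ^ 2‖ ≤ 10000 / δ ∧
        (8 * δ ≤ ‖z - ζ‖ → ‖g z + (ζ - c) * g z ^ 2 - (z - ζ)⁻¹‖ ≤ 100 * δ ^ 2 / ‖z - ζ‖ ^ 3) := by
  obtain ⟨x, hx1, hx2, h, hcont, hsq, hP⟩ := exists_goodS hc hδ hp
  set c := (x + p) / 2 with hcdef
  set d := (x - p) / 2 with hddef
  have hdn : ‖d‖ = ‖x - p‖ / 2 := by simp [hddef]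
  have hd1 : δ / 2 ≤ ‖d‖ := by rw [hdn]; linarith
  have hd2 : ‖d‖ < δ := by rw [hdn]; linarith
  have hd0 : d ≠ 0 := norm_pos_iff.1 (by linarith)
  have hcp : c - p = d := by rw [hcdef, hddef]; ring
  have hne : ∀ z, (z ∈ K ∨ 2 * δ < ‖z - p‖) → z - p ≠ 0 := by
    rintro z (hz | hz)
    · exact fun h => hp (by rwa [← sub_eq_zero.1 h])
    · exact norm_pos_iff.1 (by linarith)
  have hS : ∀ z, (z ∈ K ∨ 2 * δ < ‖z - p‖) → ((z - p) * h z) ^ 2 = (z - c) ^ 2 - d ^ 2 := by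
    intro z hz
    have := hne z hz
    rw [mul_pow, hsq z hz, hcdef, hddef]
    field_simp; ring
  have hudist : ∀ z, ‖z - p‖ - δ ≤ ‖z - c‖ := fun z => by
    have := norm_add_le (z - c) (c - p)
    rw [sub_add_sub_cancel, hcp] at this
    linarith
  -- choose the sign
  obtain ⟨σ, hσ, hv⟩ : ∃ σ : ℂ, σ ^ 2 = 1 ∧ ∀ z, 2 * δ < ‖z - p‖ →
      ‖(z - c) - σ * ((z - p) * h z)‖ < ‖d‖ := by
    have hprod : ∀ z, 2 * δ < ‖z - p‖ → ‖(z - c) - (z - p) * h z‖ * ‖(z - c) + (z - p) * h z‖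
        = ‖d‖ ^ 2 := by
      intro z hz
      rw [← norm_mul, ← norm_pow]; congr 1
      linear_combination - hS z (Or.inr hz)
    have hnot : ∀ z, 2 * δ < ‖z - p‖ → ‖(z - c) - (z - p) * h z‖ ≠ ‖d‖ := by
      intro z hz he
      have h1 := hprod z hz
      rw [he, sq] at h1
      have h2 := mul_left_cancel₀ (norm_ne_zero_iff.2 hd0) h1
      have h3 := norm_add_le ((z - c) - (z - p) * h z) ((z - c) + (z - p) * h z)
      rw [show (z - c) - (z - p) * h z + ((z - c) + (z - p) * h z) = 2 * (z - c) by ring,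
        norm_mul, he, h2] at h3
      have := hudist z
      simp at h3
      linarith
    have hcv : ContinuousOn (fun z => ‖(z - c) - (z - p) * h z‖) {z | 2 * δ < ‖z - p‖} := by
      fun_prop
    have himg := (isPreconnected_far p (by positivity : 0 ≤ 2 * δ)).image _ hcv
    by_cases hex : ∃ z, 2 * δ < ‖z - p‖ ∧ ‖(z - c) - (z - p) * h z‖ < ‖d‖
    · obtain ⟨z0, hz0, hz0'⟩ := hex
      refine ⟨1, by simp, fun z hz => ?_⟩
      rw [one_mul]
      by_contra! hcon
      obtain ⟨y, hy, hy'⟩ := himg.Icc_subset ⟨z0, hz0, rfl⟩ ⟨z, hz, rfl⟩ ⟨hz0'.le, hcon⟩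
      exact hnot y hy hy'
    · push Not at hex
      refine ⟨-1, by simp, fun z hz => ?_⟩
      have h1 := hprod z hz
      have h2 := lt_of_le_of_ne (hex z hz) (hnot z hz).symm
      rw [neg_one_mul, sub_neg_eq_add]
      by_contra! h3
      have : 0 < ‖d‖ := by linarith
      nlinarith
  set v : ℂ → ℂ := fun z => (z - c) - σ * ((z - p) * h z) with hvdef
  have hquad : ∀ z, (z ∈ K ∨ 2 * δ < ‖z - p‖) → v z * (2 * (z - c) - v z) = d ^ 2 := by
    intro z hz
    simp only [hvdef]
    linear_combination (- ((z - p) * h z) ^ 2) * hσ - hS z hz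
  have hcδ : ‖c - p‖ ≤ δ := by rw [hcp]; exact hd2.le
  refine ⟨fun z => 2 * v z / d ^ 2, c, ?_, hcδ, ?_⟩
  · have : InP K v := by
      refine InP.congr ((InP.id.add (InP.const (-c))).add ((InP.const (-σ)).mul
        ((InP.id.add (InP.const (-p))).mul hP))) fun z _ => ?_
      simp only [hvdef]; ring
    exact ((InP.const (2 / d ^ 2)).mul this).congr fun z _ => by ring
  intro z hz ζ hζ
  have hec : ‖ζ - c‖ ≤ 3 * δ := by
    have := norm_sub_le (ζ - p) (c - p)
    rw [sub_sub_sub_cancel_right] at this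
    linarith
  have hv7 : ‖v z‖ ≤ 7 * δ := by
    by_cases hf : 2 * δ < ‖z - p‖
    · have := hv z hf; simp only [hvdef]; linarith
    · have h1 : ‖z - c‖ ≤ 3 * δ := by
        have := norm_sub_le (z - p) (c - p)
        rw [sub_sub_sub_cancel_right] at this
        linarith
      have h2 : ‖(z - p) * h z‖ ≤ 4 * δ := by
        have h3 : ‖(z - p) * h z‖ ^ 2 ≤ (4 * δ) ^ 2 := by
          rw [← norm_pow, hS z (Or.inl hz)]
          refine (norm_sub_le _ _).trans ?_
          rw [norm_pow, norm_pow]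
          nlinarith [norm_nonneg (z - c), norm_nonneg d]
        exact (sq_le_sq₀ (norm_nonneg _) (by positivity)).1 h3
      have h4 : ‖σ‖ = 1 := by
        have := congrArg norm hσ
        rw [norm_pow, norm_one] at this
        exact (pow_eq_one_iff_of_nonneg (norm_nonneg _) two_ne_zero).1 this
      refine (norm_sub_le _ _).trans ?_
      rw [norm_mul, h4]; linarith
  have hg : ‖2 * v z / d ^ 2‖ ≤ 56 / δ := by
    rw [norm_div, norm_mul, norm_pow, div_le_div_iff₀ (by positivity) hδ]
    simp only [Complex.norm_ofNat]
    nlinarith [norm_nonneg d, norm_nonneg (v z)]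
  refine ⟨?_, fun hfar => ?_⟩
  · calc _ ≤ ‖2 * v z / d ^ 2‖ + ‖ζ - c‖ * ‖2 * v z / d ^ 2‖ ^ 2 := by
          refine (norm_add_le _ _).trans ?_
          rw [norm_mul, norm_pow]
      _ ≤ 56 / δ + 3 * δ * (56 / δ) ^ 2 := by gcongr
      _ = 9464 / δ := by field_simp; norm_num
      _ ≤ _ := by gcongr; norm_num
  · have hzp : 2 * δ < ‖z - p‖ := by
      have := norm_sub_le (z - p) (ζ - p)
      rw [sub_sub_sub_cancel_right] at this
      linarith
    have hu := hudist z
    have := kernel_far (u := z - c) (v := v z) (e := ζ - c) hδ hd2.le hd0 hec (hquad z (Or.inl hz)) ?_ ?_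
    · rwa [sub_sub_sub_cancel_right] at this
    · have h1 := congrArg norm (hquad z (Or.inl hz))
      rw [norm_mul, norm_pow] at h1
      rw [← h1]
      gcongr
      have h2 := norm_sub_norm_le (2 * (z - c)) (v z)
      rw [norm_mul] at h2
      simp only [Complex.norm_ofNat] at h2
      have h3 := hv z hzp
      simp only [hvdef] at h2 ⊢
      linarith
    · rwa [sub_sub_sub_cancel_right]


lemma polar_circ {G : ℂ → ℂ} {δ : ℝ}
    (hm : Measurable (fun w => if ‖w‖ < δ then w * G w else 0))
    (hi : Integrable (fun w => if ‖w‖ < δ then w * G w else 0)) {m : ℝ → ℂ}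
    (hG : ∀ᵐ ρ : ℝ, 0 < ρ → ρ < δ → (∮ w in C(0, ρ), G w) = m ρ) :
    ∫ w, (if ‖w‖ < δ then w * G w else 0) =
      ∫ ρ in Set.Ioi (0 : ℝ), (if ρ < δ then (ρ : ℂ) * (-I * m ρ) else 0) := by
  set h : ℂ → ℂ := fun w => if ‖w‖ < δ then w * G w else 0 with hh
  have h1 := Complex.integral_comp_polarCoord_symm h
  have hI : IntegrableOn (fun p : ℝ × ℝ => p.1 • h (Complex.polarCoord.symm p)) polarCoord.target := by
    constructor
    · refine Measurable.aestronglyMeasurable ?_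
      have hpc : Measurable (fun p : ℝ × ℝ => Complex.polarCoord.symm p) := by
        simp only [Complex.polarCoord_symm_apply]
        fun_prop
      exact measurable_fst.smul (hm.comp hpc)
    · rw [hasFiniteIntegral_iff_enorm]
      have h2 := Complex.lintegral_comp_polarCoord_symm (fun w => ‖h w‖ₑ)
      have h3 := hi.2
      rw [hasFiniteIntegral_iff_enorm, ← h2] at h3
      refine lt_of_le_of_lt ?_ h3
      refine setLIntegral_mono' (by rw [polarCoord_target]; exact measurableSet_Ioi.prod measurableSet_Ioo) fun p hp => ?_
      rw [polarCoord_target] at hp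
      rw [enorm_smul, smul_eq_mul, Real.enorm_of_nonneg (le_of_lt hp.1)]
  rw [← h1, polarCoord_target, Measure.volume_eq_prod, setIntegral_prod _ (by rwa [polarCoord_target, Measure.volume_eq_prod] at hI)]
  refine setIntegral_congr_ae measurableSet_Ioi ?_
  filter_upwards [hG] with ρ hρ hρ0
  have hρ0 : 0 < ρ := hρ0
  have key : ∀ θ : ℝ, Complex.polarCoord.symm (ρ, θ) = circleMap 0 ρ θ := by
    intro θ
    simp [circleMap, Complex.exp_mul_I]
  simp only [key, hh, norm_circleMap_zero, abs_of_pos hρ0]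
  split_ifs with hlt
  · rw [integral_smul, Complex.real_smul]
    congr 1
    rw [← hρ hρ0 hlt, ← integral_Ioc_eq_integral_Ioo, ← intervalIntegral.integral_of_le (by linarith [Real.pi_pos])]
    have hper : Function.Periodic (fun θ => circleMap 0 ρ θ * G (circleMap 0 ρ θ)) (2 * Real.pi) := by
      intro θ; simp only [periodic_circleMap 0 ρ θ]
    have h4 := hper.intervalIntegral_add_eq (-Real.pi) 0
    rw [show -Real.pi + 2 * Real.pi = Real.pi by ring, zero_add] at h4
    rw [h4, circleIntegral, ← intervalIntegral.integral_const_mul]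
    congr 1; ext θ
    rw [deriv_circleMap, smul_eq_mul]
    linear_combination (circleMap 0 ρ θ * G (circleMap 0 ρ θ)) * I_mul_I
  · simp

noncomputable def kB (δ : ℝ) (w : ℂ) : ℂ := if ‖w‖ < δ then w * (-(2 / (Real.pi * δ ^ 4) : ℝ)) else 0
noncomputable def kA (δ : ℝ) (w : ℂ) : ℝ := if ‖w‖ < δ then 2 / (Real.pi * δ ^ 4) * (δ ^ 2 - ‖w‖ ^ 2) else 0
noncomputable def kk (δ : ℝ) (w : ℂ) : ℝ := δ ^ 2 / (‖w‖ * (δ + ‖w‖) ^ 2)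

lemma kk_int {δ : ℝ} (hδ : 0 < δ) : Integrable (kk δ) ∧ ∫ w, kk δ w = 2 * Real.pi * δ := by
  have hd : ∀ x ∈ Set.Ioi (0:ℝ), HasDerivAt (fun x => - (δ ^ 2 / (δ + x))) (δ ^ 2 / (δ + x) ^ 2) x := by
    intro x hx
    have hx : 0 < x := hx
    have h1 : HasDerivAt (fun x => δ + x) 1 x := by simpa using (hasDerivAt_id x).const_add δ
    have := ((hasDerivAt_const x (δ ^ 2)).div h1 (by positivity)).neg
    exact this.congr_deriv (by ring)
  have hlim : Tendsto (fun x => - (δ ^ 2 / (δ + x))) atTop (nhds 0) := by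
    rw [← neg_zero]
    exact (tendsto_const_nhds.div_atTop (tendsto_atTop_add_const_left _ _ tendsto_id)).neg
  have hc : ContinuousWithinAt (fun x => - (δ ^ 2 / (δ + x))) (Set.Ici 0) 0 := by
    refine ContinuousAt.continuousWithinAt ?_
    refine ContinuousAt.neg (ContinuousAt.div (by fun_prop) (by fun_prop) (by simpa using hδ.ne'))
  have hI := integrableOn_Ioi_deriv_of_nonneg hc hd (fun x _ => by positivity) hlim
  have hv := integral_Ioi_of_hasDerivAt_of_nonneg hc hd (fun x _ => by positivity) hlim
  have he : ∀ y ∈ Set.Ioi (0:ℝ), y ^ (Module.finrank ℝ ℂ - 1) • (fun x : ℝ => δ ^ 2 / (x * (δ + x) ^ 2)) y = δ ^ 2 / (δ + y) ^ 2 := by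
    intro y hy
    have hy : 0 < y := hy
    simp only [Complex.finrank_real_complex, smul_eq_mul]
    field_simp
    simp
  constructor
  · refine (integrable_fun_norm_addHaar (volume : Measure ℂ) (f := fun x : ℝ => δ ^ 2 / (x * (δ + x) ^ 2))).2 ?_
    exact hI.congr_fun (fun y hy => (he y hy).symm) measurableSet_Ioi
  · have := integral_fun_norm_addHaar (volume : Measure ℂ) (fun x : ℝ => δ ^ 2 / (x * (δ + x) ^ 2))
    rw [setIntegral_congr_fun measurableSet_Ioi he, hv] at this
    simp only [kk]
    rw [this]
    simp [Measure.real, Complex.volume_ball]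
    field_simp

lemma kA_int {δ : ℝ} (hδ : 0 < δ) : ∫ w, kA δ w = 1 := by
  have := integral_fun_norm_addHaar (volume : Measure ℂ) (fun x : ℝ => if x < δ then 2 / (Real.pi * δ ^ 4) * (δ ^ 2 - x ^ 2) else 0)
  simp only [kA]
  rw [this]
  have h2 : ∫ y in Set.Ioi (0:ℝ), y ^ (Module.finrank ℝ ℂ - 1) • (if y < δ then 2 / (Real.pi * δ ^ 4) * (δ ^ 2 - y ^ 2) else 0)
      = ∫ y in (0:ℝ)..δ, 2 / (Real.pi * δ ^ 4) * (δ ^ 2 * y - y ^ 3) := by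
    rw [intervalIntegral.integral_of_le hδ.le, integral_Ioc_eq_integral_Ioo,
      ← Set.Ioi_inter_Iio, ← setIntegral_indicator measurableSet_Iio]
    refine setIntegral_congr_fun measurableSet_Ioi fun y hy => ?_
    simp only [Complex.finrank_real_complex, Set.indicator, Set.mem_Iio, smul_eq_mul]
    split_ifs
    · ring
    · simp
  rw [h2, intervalIntegral.integral_const_mul, intervalIntegral.integral_sub (by
    exact (by fun_prop : Continuous _).intervalIntegrable _ _) (by
    exact (by fun_prop : Continuous _).intervalIntegrable _ _), intervalIntegral.integral_const_mul,
    integral_id, integral_pow]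
  simp [Measure.real, Complex.volume_ball]
  field_simp
  norm_num

lemma measurable_ite_ball {δ : ℝ} {h : ℂ → ℂ} (hm : Measurable h) :
    Measurable (fun w => if ‖w‖ < δ then h w else 0) :=
  Measurable.ite (measurableSet_lt measurable_norm measurable_const) hm measurable_const

lemma kB_meas (δ : ℝ) : Measurable (kB δ) := measurable_ite_ball (by fun_prop)

lemma kB_norm {δ : ℝ} (hδ : 0 < δ) (w : ℂ) :
    ‖kB δ w‖ ≤ (Metric.ball (0:ℂ) δ).indicator (fun _ => 2 / (Real.pi * δ ^ 3)) w := by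
  simp only [kB, Set.indicator, mem_ball_zero_iff]
  split_ifs with h
  · rw [norm_mul, norm_neg, norm_real, Real.norm_of_nonneg (by positivity)]
    calc ‖w‖ * (2 / (Real.pi * δ ^ 4)) ≤ δ * (2 / (Real.pi * δ ^ 4)) := by gcongr
      _ = _ := by field_simp
  · simp

lemma ballind_int {δ : ℝ} (hδ : 0 < δ) : Integrable ((Metric.ball (0:ℂ) δ).indicator (fun _ => 2 / (Real.pi * δ ^ 3))) ∧
   ∫ w, ((Metric.ball (0:ℂ) δ).indicator (fun _ => 2 / (Real.pi * δ ^ 3))) w = 2 / δ := by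
  constructor
  · rw [integrable_indicator_iff measurableSet_ball]
    exact integrableOn_const (measure_ball_lt_top.ne)
  · rw [integral_indicator measurableSet_ball]
    simp [Measure.real, Complex.volume_ball, ENNReal.toReal_ofReal hδ.le]
    field_simp

lemma kB_int {δ : ℝ} (hδ : 0 < δ) : Integrable (kB δ) :=
  (ballind_int hδ).1.mono' (kB_meas δ).aestronglyMeasurable (Eventually.of_forall (kB_norm hδ))

lemma kB_norm' {δ : ℝ} (hδ : 0 < δ) : ∫ w, ‖kB δ w‖ ≤ 2 / δ := by
  rw [← (ballind_int hδ).2]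
  exact integral_mono (kB_int hδ).norm (ballind_int hδ).1 (kB_norm hδ)

lemma kB_zero {δ : ℝ} : ∫ w, kB δ w = 0 := by
  have h := integral_neg_eq_self (kB δ) volume
  have h2 : ∀ w, kB δ (-w) = - kB δ w := fun w => by
    simp only [kB, norm_neg]; split_ifs <;> simp
  simp only [h2, integral_neg] at h
  exact self_eq_neg.1 h.symm

lemma kAB {δ : ℝ} (hδ : 0 < δ) (z : ℂ) :
    (kA δ z : ℂ) = (1 / Real.pi : ℝ) * ∫ w, kB δ w * (z - w)⁻¹ := by
  set c : ℝ := 2 / (Real.pi * δ ^ 4)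
  have e : ∀ w, kB δ w * (z - w)⁻¹ = if ‖w‖ < δ then w * (c * (w - z)⁻¹) else 0 := by
    intro w
    simp only [kB]
    split_ifs
    · rw [← neg_sub w z, inv_neg]; simp only [c]; push_cast; ring
    · simp
  have hm : Measurable (fun w => kB δ w * (z - w)⁻¹) := (kB_meas δ).mul (by fun_prop)
  have hi : Integrable (fun w => kB δ w * (z - w)⁻¹) := by
    have h1 := (((kk_int hδ).1.comp_sub_left z).const_mul
      (2 / (Real.pi * δ ^ 3) * ((δ + (‖z‖ + δ)) ^ 2 / δ ^ 2)))
    refine h1.mono' hm.aestronglyMeasurable (Eventually.of_forall fun w => ?_)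
    rw [norm_mul, norm_inv]
    have hb := kB_norm hδ w
    simp only [Set.indicator, mem_ball_zero_iff] at hb
    split_ifs at hb with hw
    · calc ‖kB δ w‖ * ‖z - w‖⁻¹ ≤ 2 / (Real.pi * δ ^ 3) * ((δ + ‖z - w‖) ^ 2 / δ ^ 2 * kk δ (z - w)) := by
            gcongr
            simp only [kk]
            apply le_of_eq
            field_simp
        _ ≤ 2 / (Real.pi * δ ^ 3) * ((δ + (‖z‖ + δ)) ^ 2 / δ ^ 2 * kk δ (z - w)) := by
            have : ‖z - w‖ ≤ ‖z‖ + δ := (norm_sub_le _ _).trans (by linarith)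
            have : 0 ≤ kk δ (z - w) := by unfold kk; positivity
            gcongr
        _ = _ := by ring
    · rw [le_antisymm hb (norm_nonneg _), zero_mul]; unfold kk; positivity
  simp only [e] at hm hi ⊢
  have := polar_circ (δ := δ) (G := fun w => c * (w - z)⁻¹) hm hi (m := fun ρ => if ‖z‖ < ρ then c * (2 * Real.pi * I) else 0) ?_
  · rw [this]
    have h3 : ∫ ρ in Set.Ioi (0 : ℝ), (if ρ < δ then (ρ : ℂ) * (-I * (if ‖z‖ < ρ then c * (2 * Real.pi * I) else 0)) else 0)
      = ∫ ρ in Set.Ioo ‖z‖ δ, ((ρ * (c * 2 * Real.pi) : ℝ) : ℂ) := by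
      rw [← integral_indicator measurableSet_Ioi, ← integral_indicator measurableSet_Ioo]
      congr 1; ext ρ
      simp only [Set.indicator, Set.mem_Ioi, Set.mem_Ioo]
      have := norm_nonneg z
      by_cases h1 : ‖z‖ < ρ
      · have h0 : 0 < ρ := by linarith
        simp only [h0, h1, if_true, true_and]
        split_ifs
        · push_cast; linear_combination (- ρ * c * 2 * Real.pi : ℂ) * I_mul_I
        · rfl
      · simp [h1]
    rw [h3, integral_complex_ofReal, ← integral_Ioc_eq_integral_Ioo]
    rw [← ofReal_mul]
    congr 1
    simp only [kA]
    split_ifs with hz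
    · rw [← intervalIntegral.integral_of_le hz.le, intervalIntegral.integral_mul_const, integral_id]
      simp only [c]; field_simp
    · rw [Set.Ioc_eq_empty (by linarith)]; simp
  · have : ∀ᵐ ρ : ℝ, ρ ≠ ‖z‖ := by
      simp [ae_iff]
    filter_upwards [this] with ρ hne h0 hlt
    rw [circleIntegral.integral_const_mul]
    split_ifs with hz
    · rw [circleIntegral.integral_sub_inv_of_mem_ball (by simpa using hz)]
    · have hz' : ρ < ‖z‖ := lt_of_le_of_ne (by linarith) hne
      have : (∮ w in C(0, ρ), (w - z)⁻¹) = 0 := by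
        refine circleIntegral_eq_zero_of_differentiable_on_off_countable h0.le Set.countable_empty ?_ ?_
        · refine ContinuousOn.inv₀ (by fun_prop) fun w hw => ?_
          rw [mem_closedBall_zero_iff] at hw
          intro h; rw [sub_eq_zero.1 h] at hw; linarith
        · intro w hw
          have hw := hw.1
          rw [mem_ball_zero_iff] at hw
          refine DifferentiableAt.inv (by fun_prop) ?_
          intro h; rw [sub_eq_zero.1 h] at hw; linarith
      rw [this, mul_zero]


noncomputable def mpsi (f : ℂ → ℂ) (δ : ℝ) (ζ : ℂ) : ℂ := ∫ w, f (ζ - w) * kB δ w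

section
variable {f : ℂ → ℂ} {δ R M ω : ℝ} (hδ : 0 < δ) (hfc : Continuous f)
  (hR : ∀ x, R < ‖x‖ → f x = 0) (hM : ∀ x, ‖f x‖ ≤ M)
  (hω : ∀ x y, ‖x - y‖ ≤ δ → ‖f x - f y‖ ≤ ω)
include hδ hfc

lemma mpsi_zero {ζ : ℂ} (hd : DifferentiableOn ℂ f (Metric.ball ζ δ)) (hM : ∀ x, ‖f x‖ ≤ M) :
    mpsi f δ ζ = 0 := by
  have e : ∀ w, f (ζ - w) * kB δ w = if ‖w‖ < δ then w * (f (ζ - w) * (-(2 / (Real.pi * δ ^ 4) : ℝ))) else 0 := by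
    intro w; simp only [kB]; split_ifs
    · ring
    · simp
  have hi : Integrable (fun w => f (ζ - w) * kB δ w) :=
    (kB_int hδ).bdd_mul (c := M) (by fun_prop) (Eventually.of_forall fun w => hM _)
  simp only [mpsi, e] at hi ⊢
  rw [polar_circ (measurable_ite_ball (by fun_prop)) hi (m := fun _ => 0)]
  · simp
  · refine Eventually.of_forall fun ρ h0 h1 => ?_
    refine circleIntegral_eq_zero_of_differentiable_on_off_countable h0.le Set.countable_empty ?_ ?_
    · fun_prop
    · intro w hw
      have hw := hw.1
      rw [mem_ball_zero_iff] at hw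
      have : DifferentiableAt ℂ f (ζ - w) := hd.differentiableAt (Metric.isOpen_ball.mem_nhds (by
        simp [dist_eq_norm]; linarith))
      fun_prop

include hM
lemma mpsi_int (ζ : ℂ) : Integrable (fun w => f (ζ - w) * kB δ w) :=
    (kB_int hδ).bdd_mul (c := M) (by fun_prop) (Eventually.of_forall fun w => hM _)

lemma mpsi_cont : Continuous (mpsi f δ) := by
  refine continuous_of_dominated (bound := fun w => M * ‖kB δ w‖) ?_ ?_ ?_ ?_
  · exact fun ζ => (mpsi_int hδ hfc hM ζ).1
  · refine fun ζ => Eventually.of_forall fun w => ?_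
    rw [norm_mul]; gcongr; exact hM _
  · exact (kB_int hδ).norm.const_mul M
  · exact Eventually.of_forall fun w => by fun_prop

include hω in
lemma mpsi_bound (ζ : ℂ) : ‖mpsi f δ ζ‖ ≤ 2 * ω / δ := by
  have h1 : mpsi f δ ζ = ∫ w, (f (ζ - w) - f ζ) * kB δ w := by
    simp only [sub_mul]
    rw [integral_sub (mpsi_int hδ hfc hM ζ) ((kB_int hδ).const_mul _), integral_const_mul, kB_zero]
    simp [mpsi]
  have hω0 : 0 ≤ ω := (norm_nonneg _).trans (hω 0 0 (by simpa using hδ.le))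
  rw [h1]
  calc _ ≤ ∫ w, ω * ‖kB δ w‖ := by
        refine norm_integral_le_of_norm_le ((kB_int hδ).norm.const_mul ω) (Eventually.of_forall fun w => ?_)
        rw [norm_mul]
        by_cases hw : ‖w‖ < δ
        · gcongr; exact hω _ _ (by simpa using hw.le)
        · simp [kB, hw]
    _ = ω * ∫ w, ‖kB δ w‖ := integral_const_mul _ _
    _ ≤ ω * (2 / δ) := by gcongr; exact kB_norm' hδ
    _ = _ := by ring

include hR in
omit hM hfc in
lemma mpsi_supp {ζ : ℂ} (h : R + δ < ‖ζ‖) : mpsi f δ ζ = 0 := by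
  unfold mpsi
  rw [← integral_zero ℂ ℂ]
  congr 1; ext w
  by_cases hw : ‖w‖ < δ
  · rw [hR, zero_mul]
    have := norm_sub_norm_le ζ w
    linarith
  · simp [kB, hw]

include hR
lemma mphi_eq (z : ℂ) : ∫ x, f (z - x) * kA δ x =
    (1 / Real.pi : ℝ) * ∫ ζ, mpsi f δ ζ * (z - ζ)⁻¹ := by
  have hM0 : 0 ≤ M := (norm_nonneg _).trans (hM 0)
  have h1 : ∀ x, (kA δ x : ℂ) = (1 / Real.pi : ℝ) * ∫ u, kB δ (x - u) * u⁻¹ := by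
    intro x
    rw [kAB hδ x, ← integral_sub_left_eq_self _ volume x]
    simp
  simp only [h1]
  have h2 : ∀ x, f (z - x) * ((1 / Real.pi : ℝ) * ∫ u, kB δ (x - u) * u⁻¹) =
      (1 / Real.pi : ℝ) * ∫ u, f (z - x) * (kB δ (x - u) * u⁻¹) := by
    intro x; rw [integral_const_mul]; ring
  simp only [h2]
  rw [integral_const_mul]
  congr 1
  rw [integral_integral_swap]
  · rw [← integral_sub_left_eq_self _ volume z]
    congr 1; ext u
    rw [mpsi, ← integral_mul_const]
    rw [← integral_add_right_eq_self _ (z - u)]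
    congr 1; ext x
    rw [add_sub_cancel_right, show z - (x + (z - u)) = u - x by ring]; ring
  · set R1 := R + ‖z‖
    set D := 2 / (Real.pi * δ ^ 3)
    have hI : Integrable (fun p : ℂ × ℂ => ((Metric.closedBall (0:ℂ) R1).indicator (fun _ => (1:ℝ)) p.1) *
        (M * D * ((δ + (R1 + δ)) ^ 2 / δ ^ 2) * kk δ p.2)) (volume.prod volume) := by
      refine Integrable.mul_prod ?_ ((kk_int hδ).1.const_mul _)
      rw [integrable_indicator_iff measurableSet_closedBall]
      exact integrableOn_const (measure_closedBall_lt_top.ne)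
    refine hI.mono' ?_ (Eventually.of_forall fun ⟨x, u⟩ => ?_)
    · refine Measurable.aestronglyMeasurable ?_
      have := kB_meas δ
      have := hfc.measurable
      change Measurable (fun p : ℂ × ℂ => f (z - p.1) * (kB δ (p.1 - p.2) * p.2⁻¹))
      fun_prop
    · simp only [Function.uncurry]
      have hkk : 0 ≤ kk δ u := by unfold kk; positivity
      have hpos : 0 ≤ (Metric.closedBall (0:ℂ) R1).indicator (fun _ => (1:ℝ)) x *
        (M * D * ((δ + (R1 + δ)) ^ 2 / δ ^ 2) * kk δ u) := by
        refine mul_nonneg (Set.indicator_nonneg (fun _ _ => zero_le_one) _) (by positivity)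
      by_cases hx : f (z - x) = 0
      · simpa [hx] using hpos
      by_cases hw : ‖x - u‖ < δ
      · have hx1 : ‖x‖ ≤ R1 := by
          by_contra! hcon
          refine hx (hR _ ?_)
          have := norm_sub_norm_le x z
          rw [norm_sub_rev] at this
          linarith
        have hu : ‖u‖ ≤ R1 + δ := by
          have := norm_sub_norm_le u x
          rw [norm_sub_rev] at this
          linarith
        rw [Set.indicator_of_mem (by simpa using hx1), one_mul, norm_mul, norm_mul, norm_inv]
        have hb := kB_norm hδ (x - u)
        rw [Set.indicator_of_mem (by simpa using hw)] at hb
        calc ‖f (z - x)‖ * (‖kB δ (x - u)‖ * ‖u‖⁻¹) ≤ M * (D * ((δ + ‖u‖) ^ 2 / δ ^ 2 * kk δ u)) := by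
              gcongr
              · exact hM _
              · simp only [kk]
                apply le_of_eq
                field_simp
          _ ≤ M * (D * ((δ + (R1 + δ)) ^ 2 / δ ^ 2 * kk δ u)) := by gcongr
          _ = _ := by ring
      · simpa [kB, hw] using hpos

include hω in
omit hM hR in
lemma mphi_near (z : ℂ) : ‖f z - ∫ x, f (z - x) * kA δ x‖ ≤ ω := by
  have hω0 : 0 ≤ ω := (norm_nonneg _).trans (hω 0 0 (by simpa using hδ.le))
  have hA : Integrable (kA δ) := by
    by_contra h
    have := kA_int hδ
    rw [integral_undef h] at this
    simp at this
  have hA0 : ∀ w, 0 ≤ kA δ w := by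
    intro w; unfold kA; split_ifs with h
    · have : ‖w‖ ^ 2 ≤ δ ^ 2 := by gcongr
      have : 0 ≤ δ ^ 2 - ‖w‖ ^ 2 := by linarith
      positivity
    · exact le_rfl
  have hg : ∀ x, ‖(f z - f (z - x)) * kA δ x‖ ≤ ω * kA δ x := by
    intro x
    rw [norm_mul, norm_real, Real.norm_of_nonneg (hA0 x)]
    by_cases hw : ‖x‖ < δ
    · have := hA0 x
      gcongr
      exact hω _ _ (by simpa using hw.le)
    · simp [kA, hw]
  have hi1 : Integrable (fun x => (f z - f (z - x)) * kA δ x) := by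
    refine (hA.const_mul ω).mono' ?_ (Eventually.of_forall hg)
    exact AEStronglyMeasurable.mul (by fun_prop) hA.ofReal.1
  have h1 : f z - ∫ x, f (z - x) * kA δ x = ∫ x, (f z - f (z - x)) * kA δ x := by
    have h2 : (∫ x, f z * (kA δ x : ℂ)) = f z := by
      rw [integral_const_mul, integral_complex_ofReal, kA_int hδ]; simp
    have h3 : (fun x => f (z - x) * (kA δ x : ℂ)) = fun x => f z * kA δ x - (f z - f (z - x)) * kA δ x := by
      ext x; ring
    have h4 : Integrable (fun x => f z * (kA δ x : ℂ)) := hA.ofReal.const_mul (f z)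
    rw [h3, integral_sub h4 hi1, h2]; ring
  rw [h1]
  calc _ ≤ ∫ x, ω * kA δ x := norm_integral_le_of_norm_le (hA.const_mul ω) (Eventually.of_forall hg)
    _ = ω := by rw [integral_const_mul, kA_int hδ, mul_one]
end

lemma merg_step {K : Set ℂ} [CompactSpace K] (hc : IsConnected Kᶜ) {f : ℂ → ℂ} {δ R M ω : ℝ}
    (hδ : 0 < δ) (hfc : Continuous f)
    (hR : ∀ x, R < ‖x‖ → f x = 0) (hM : ∀ x, ‖f x‖ ≤ M)
    (hω : ∀ x y, ‖x - y‖ ≤ δ → ‖f x - f y‖ ≤ ω) (hf : DifferentiableOn ℂ f (interior K)) :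
    ∃ g, InP K g ∧ ∀ z ∈ K, ‖f z - g z‖ ≤ 40000001 * ω := by
  classical
  have hω0 : 0 ≤ ω := (norm_nonneg _).trans (hω 0 0 (by simpa using hδ.le))
  set ψ := mpsi f δ with hψ
  have hψc : Continuous ψ := mpsi_cont hδ hfc hM
  have hψs : HasCompactSupport ψ := by
    refine HasCompactSupport.of_support_subset_isCompact (isCompact_closedBall (0:ℂ) (R + δ)) ?_
    intro ζ hζ
    rw [mem_closedBall_zero_iff]
    by_contra! h
    exact hζ (mpsi_supp hδ hR h)
  obtain ⟨t, htK, ht⟩ : ∃ t : Finset ℂ, (∀ p ∈ t, p ∉ K) ∧ ∀ ζ, ψ ζ ≠ 0 → ∃ p ∈ t, ‖ζ - p‖ < 2 * δ := by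
    have hcl : IsCompact (closure {ζ | ψ ζ ≠ 0}) := hψs
    obtain ⟨t, ht⟩ := hcl.elim_finite_subcover (fun p : (Kᶜ : Set ℂ) => Metric.ball (p : ℂ) (2 * δ))
      (fun p => Metric.isOpen_ball) (by
        intro ζ hζ
        obtain ⟨ζ', h1, h2⟩ := Metric.mem_closure_iff.1 hζ δ hδ
        have : ¬ Metric.ball ζ' δ ⊆ K := fun hsub =>
          h1 (mpsi_zero hδ hfc (hf.mono (interior_maximal hsub Metric.isOpen_ball)) hM)
        obtain ⟨p, hp, hpK⟩ := Set.not_subset.1 this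
        refine Set.mem_iUnion.2 ⟨⟨p, hpK⟩, ?_⟩
        rw [Metric.mem_ball] at hp ⊢
        have := dist_triangle ζ ζ' p
        rw [dist_comm] at hp
        simp only
        linarith)
    refine ⟨t.image Subtype.val, ?_, fun ζ hζ => ?_⟩
    · intro p hp
      obtain ⟨q, -, rfl⟩ := Finset.mem_image.1 hp
      exact q.2
    · obtain ⟨p, hp, h⟩ := Set.mem_iUnion₂.1 (ht (subset_closure hζ))
      exact ⟨p, Finset.mem_image_of_mem _ hp, by rwa [mem_ball_iff_norm] at h⟩
  have hker : ∀ p : ℂ, ∃ (g : ℂ → ℂ) (c : ℂ), p ∈ t → InP K g ∧ ‖c - p‖ ≤ δ ∧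
      ∀ z ∈ K, ∀ ζ, ‖ζ - p‖ ≤ 2 * δ → ‖g z + (ζ - c) * g z ^ 2‖ ≤ 10000 / δ ∧
        (8 * δ ≤ ‖z - ζ‖ → ‖g z + (ζ - c) * g z ^ 2 - (z - ζ)⁻¹‖ ≤ 100 * δ ^ 2 / ‖z - ζ‖ ^ 3) := by
    intro p
    by_cases hp : p ∈ t
    · obtain ⟨g, c, h⟩ := exists_kernel hc hδ (htK p hp)
      exact ⟨g, c, fun _ => h⟩
    · exact ⟨0, 0, fun h => absurd h hp⟩
  choose g c hgc using hker
  let ind : ℂ → ℂ → ℝ := fun p => (Metric.ball p (2 * δ)).indicator (fun _ => 1)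
  have ind0 : ∀ p ζ, 0 ≤ ind p ζ := fun p ζ => Set.indicator_nonneg (fun _ _ => zero_le_one) _
  let χ : ℂ → ℂ → ℝ := fun p ζ => ind p ζ / ∑ q ∈ t, ind q ζ
  have χ0 : ∀ p ζ, 0 ≤ χ p ζ := fun p ζ => div_nonneg (ind0 _ _) (Finset.sum_nonneg fun q _ => ind0 _ _)
  have χm : ∀ p, Measurable (χ p) := by
    have : ∀ p, Measurable (ind p) := fun p => measurable_const.indicator measurableSet_ball
    intro p
    exact (this p).div (Finset.measurable_sum _ fun q _ => this q)
  have χ1 : ∀ p ∈ t, ∀ ζ, χ p ζ ≤ 1 := fun p hp ζ =>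
    div_le_one_of_le₀ (Finset.single_le_sum (f := fun q => ind q ζ) (fun q _ => ind0 q ζ) hp)
      (Finset.sum_nonneg fun q _ => ind0 _ _)
  have χs : ∀ ζ, ψ ζ ≠ 0 → ∑ p ∈ t, χ p ζ = 1 := by
    intro ζ hζ
    simp only [χ]
    rw [← Finset.sum_div, div_self]
    obtain ⟨p, hp, h⟩ := ht ζ hζ
    have h1 : ind p ζ = 1 := Set.indicator_of_mem (by rwa [mem_ball_iff_norm]) _
    have h2 := (Finset.single_le_sum (f := fun q => ind q ζ) (fun q _ => ind0 q ζ) hp)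
    simp only [h1] at h2
    linarith
  have ib : ∀ (h : ℂ → ℂ), Continuous h → ∀ p ∈ t, Integrable (fun ζ => (χ p ζ : ℂ) * (ψ ζ * h ζ)) := by
    intro h hh p hp
    refine Integrable.bdd_mul (c := 1) ((hψc.mul hh).integrable_of_hasCompactSupport hψs.mul_right) ?_ ?_
    · exact (Complex.measurable_ofReal.comp (χm p)).aestronglyMeasurable
    · refine Eventually.of_forall fun ζ => ?_
      rw [norm_real, Real.norm_of_nonneg (χ0 p ζ)]
      exact χ1 p hp ζ
  refine ⟨fun z => (1 / Real.pi : ℝ) * ∑ p ∈ t, ((∫ ζ, (χ p ζ : ℂ) * (ψ ζ * 1)) * g p z +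
    (∫ ζ, (χ p ζ : ℂ) * (ψ ζ * (ζ - c p))) * g p z ^ 2), ?_, ?_⟩
  · refine (InP.const _).mul (InP.sum _ fun p hp => ?_)
    exact ((InP.const _).mul (hgc p hp).1).add ((InP.const _).mul ((hgc p hp).1.pow 2))
  intro z hz
  -- pointwise bound
  have hpt : ∀ p ∈ t, ∀ ζ, ζ ≠ z → ‖ζ - p‖ ≤ 2 * δ →
      ‖g p z + (ζ - c p) * g p z ^ 2 - (z - ζ)⁻¹‖ ≤ 10000000 * kk δ (z - ζ) := by
    intro p hp ζ hne hζ
    obtain ⟨-, -, h⟩ := hgc p hp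
    obtain ⟨h1, h2⟩ := h z hz ζ hζ
    have hpos : 0 < ‖z - ζ‖ := norm_pos_iff.2 (sub_ne_zero.2 hne.symm)
    set ρ := ‖z - ζ‖ with hρ
    by_cases hfar : 8 * δ ≤ ρ
    · refine (h2 hfar).trans ?_
      simp only [kk, ← hρ]
      rw [← mul_div_assoc, div_le_div_iff₀ (by positivity) (by positivity)]
      have : (δ + ρ) ^ 2 ≤ (9 / 8 * ρ) ^ 2 := by gcongr; linarith
      calc 100 * δ ^ 2 * (ρ * (δ + ρ) ^ 2) ≤ 100 * δ ^ 2 * (ρ * (9 / 8 * ρ) ^ 2) := by gcongr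
        _ = (100 * (9/8)^2) * (δ ^ 2 * ρ ^ 3) := by ring
        _ ≤ 10000000 * (δ ^ 2 * ρ ^ 3) := by gcongr; norm_num
        _ = _ := by ring
    · push Not at hfar
      have h3 : ‖(z - ζ)⁻¹‖ = 1 / ρ := by rw [norm_inv, one_div]
      calc _ ≤ 10000 / δ + 1 / ρ := (norm_sub_le _ _).trans (by rw [h3]; gcongr)
        _ ≤ 80000 / ρ + 1 / ρ := by
          gcongr ?_ + _
          rw [div_le_div_iff₀ hδ hpos]; linarith
        _ ≤ _ := by
          simp only [kk, ← hρ]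
          rw [← mul_div_assoc, ← add_div, div_le_div_iff₀ (by positivity) (by positivity)]
          have : (δ + ρ) ^ 2 ≤ (9 * δ) ^ 2 := by gcongr; linarith
          calc (80000 + 1) * (ρ * (δ + ρ) ^ 2) ≤ (80000 + 1) * (ρ * (9 * δ) ^ 2) := by gcongr
            _ = ((80000 + 1) * 81) * (δ ^ 2 * ρ) := by ring
            _ ≤ 10000000 * (δ ^ 2 * ρ) := by gcongr; norm_num
            _ = _ := by ring
  have hΦ := mphi_eq hδ hfc hR hM z
  have hnear := mphi_near hδ hfc hω z
  rw [hΦ] at hnear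
  -- integrals
  have hF : ∑ p ∈ t, ((∫ ζ, (χ p ζ : ℂ) * (ψ ζ * 1)) * g p z +
      (∫ ζ, (χ p ζ : ℂ) * (ψ ζ * (ζ - c p))) * g p z ^ 2) =
      ∫ ζ, ∑ p ∈ t, (χ p ζ : ℂ) * (ψ ζ * (g p z + (ζ - c p) * g p z ^ 2)) := by
    rw [integral_finsetSum _ fun p hp => ib _ (by fun_prop) p hp]
    refine Finset.sum_congr rfl fun p hp => ?_
    rw [← integral_mul_const, ← integral_mul_const, ← integral_add]
    · congr 1; ext ζ; ring
    · exact (ib _ continuous_const p hp).mul_const _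
    · exact (ib _ (by fun_prop) p hp).mul_const _
  have hIF : Integrable (fun ζ => ∑ p ∈ t, (χ p ζ : ℂ) * (ψ ζ * (g p z + (ζ - c p) * g p z ^ 2))) :=
    integrable_finsetSum _ fun p hp => ib _ (by fun_prop) p hp
  have hbd : ∀ᵐ ζ, ‖ψ ζ * (z - ζ)⁻¹ - ∑ p ∈ t, (χ p ζ : ℂ) * (ψ ζ * (g p z + (ζ - c p) * g p z ^ 2))‖
      ≤ (2 * ω / δ) * 10000000 * kk δ (z - ζ) := by
    have hae : ∀ᵐ ζ : ℂ, ζ ≠ z := by simp [ae_iff]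
    filter_upwards [hae] with ζ hne
    have hkk : 0 ≤ kk δ (z - ζ) := by unfold kk; positivity
    by_cases hζ : ψ ζ = 0
    · simp only [hζ]; simp; positivity
    have h1 : ψ ζ * (z - ζ)⁻¹ - ∑ p ∈ t, (χ p ζ : ℂ) * (ψ ζ * (g p z + (ζ - c p) * g p z ^ 2)) =
        - ψ ζ * ∑ p ∈ t, (χ p ζ : ℂ) * (g p z + (ζ - c p) * g p z ^ 2 - (z - ζ)⁻¹) := by
      have h2 : ψ ζ * (z - ζ)⁻¹ = ∑ p ∈ t, (χ p ζ : ℂ) * (ψ ζ * (z - ζ)⁻¹) := by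
        rw [← Finset.sum_mul, ← ofReal_sum, χs ζ hζ]; simp
      rw [h2, ← Finset.sum_sub_distrib, Finset.mul_sum]
      exact Finset.sum_congr rfl fun p _ => by ring
    rw [h1, norm_mul, norm_neg]
    have h3 : ‖∑ p ∈ t, (χ p ζ : ℂ) * (g p z + (ζ - c p) * g p z ^ 2 - (z - ζ)⁻¹)‖ ≤ 10000000 * kk δ (z - ζ) := by
      calc _ ≤ ∑ p ∈ t, χ p ζ * (10000000 * kk δ (z - ζ)) := by
            refine norm_sum_le_of_le _ fun p hp => ?_
            rw [norm_mul, norm_real, Real.norm_of_nonneg (χ0 p ζ)]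
            by_cases hb : ‖ζ - p‖ < 2 * δ
            · have := χ0 p ζ
              gcongr
              exact hpt p hp ζ hne hb.le
            · have : χ p ζ = 0 := by
                have : ind p ζ = 0 := Set.indicator_of_notMem (by rwa [mem_ball_iff_norm]) _
                simp [χ, this]
              simp [this]
        _ = _ := by rw [← Finset.sum_mul, χs ζ hζ, one_mul]
    calc _ ≤ (2 * ω / δ) * (10000000 * kk δ (z - ζ)) := by
          gcongr
          exact mpsi_bound hδ hfc hM hω ζ
      _ = _ := by ring
  have hIk := ((kk_int hδ).1.comp_sub_left z).const_mul ((2 * ω / δ) * 10000000)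
  have hID : Integrable (fun ζ => ψ ζ * (z - ζ)⁻¹ - ∑ p ∈ t, (χ p ζ : ℂ) * (ψ ζ * (g p z + (ζ - c p) * g p z ^ 2))) := by
    refine hIk.mono' ?_ hbd
    refine AEStronglyMeasurable.sub ?_ hIF.1
    have := hψc.measurable
    exact Measurable.aestronglyMeasurable (by fun_prop)
  have hIψ : Integrable (fun ζ => ψ ζ * (z - ζ)⁻¹) := by
    refine (hID.add hIF).congr (Eventually.of_forall fun ζ => ?_)
    simp only [Pi.add_apply, sub_add_cancel]
  have hdiff : ‖(∫ ζ, ψ ζ * (z - ζ)⁻¹) - ∑ p ∈ t, ((∫ ζ, (χ p ζ : ℂ) * (ψ ζ * 1)) * g p z +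
      (∫ ζ, (χ p ζ : ℂ) * (ψ ζ * (ζ - c p))) * g p z ^ 2)‖ ≤ Real.pi * (40000000 * ω) := by
    rw [hF, ← integral_sub hIψ hIF]
    refine (norm_integral_le_of_norm_le hIk hbd).trans (le_of_eq ?_)
    rw [integral_const_mul, integral_sub_left_eq_self (kk δ) volume z, (kk_int hδ).2]
    field_simp; ring
  calc _ ≤ ‖f z - (1 / Real.pi : ℝ) * ∫ ζ, ψ ζ * (z - ζ)⁻¹‖ + ‖((1 / Real.pi : ℝ) : ℂ) * ((∫ ζ, ψ ζ * (z - ζ)⁻¹) - ∑ p ∈ t, ((∫ ζ, (χ p ζ : ℂ) * (ψ ζ * 1)) * g p z +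
      (∫ ζ, (χ p ζ : ℂ) * (ψ ζ * (ζ - c p))) * g p z ^ 2))‖ := by
        refine le_trans (le_of_eq ?_) (norm_add_le _ _)
        congr 1; ring
    _ ≤ ω + (1 / Real.pi) * (Real.pi * (40000000 * ω)) := by
        rw [norm_mul, norm_real, Real.norm_of_nonneg (by positivity)]
        gcongr
    _ = _ := by field_simp; ring

theorem mergelyan {K : Set ℂ} (hK : IsCompact K) (hc : IsConnected Kᶜ) {F : ℂ → ℂ}
    (hF : ContinuousOn F K) (hd : DifferentiableOn ℂ F (interior K)) {ε : ℝ} (hε : 0 < ε) :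
    ∃ p : Polynomial ℂ, ∀ z ∈ K, ‖F z - p.eval z‖ < ε := by
  haveI : CompactSpace K := isCompact_iff_compactSpace.1 hK
  obtain ⟨f, hfc, hfs, hfK⟩ : ∃ f : ℂ → ℂ, Continuous f ∧ HasCompactSupport f ∧ ∀ z ∈ K, f z = F z := by
    obtain ⟨G, hG⟩ := ContinuousMap.exists_restrict_eq hK.isClosed (⟨K.domRestrict F, hF.domRestrict⟩ : C(K, ℂ))
    obtain ⟨u, hu1, -, hu, -⟩ := exists_continuous_one_zero_of_isCompact hK isClosed_empty (Set.disjoint_empty K)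
    refine ⟨fun z => (u z : ℂ) * G z, by fun_prop, ?_, fun z hz => ?_⟩
    · refine HasCompactSupport.mul_right ?_
      exact hu.comp_left (g := fun x : ℝ => (x : ℂ)) (by simp)
    · have h1 := congrArg (fun h : C(K, ℂ) => h ⟨z, hz⟩) hG
      have h2 : u z = 1 := hu1 hz
      have h3 : G z = F z := h1
      simp [h2, h3]
  have hP : InP K f := by
    obtain ⟨M, hM⟩ := hfs.exists_bound_of_continuous hfc
    obtain ⟨R, hR⟩ := hfs.isBounded.exists_norm_le
    refine InP.of_limit hfc.continuousOn fun ε hε => ?_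
    obtain ⟨δ, hδ, h⟩ := Metric.uniformContinuous_iff.1 (hfs.uniformContinuous_of_continuous hfc) (ε / 50000000) (by positivity)
    have h1 : ∀ x, R < ‖x‖ → f x = 0 := by
      intro x hx
      by_contra hne
      have := hR x (subset_tsupport _ hne)
      linarith
    have h2 : ∀ x y, ‖x - y‖ ≤ δ / 2 → ‖f x - f y‖ ≤ ε / 50000000 := by
      intro x y hxy
      have := h (a := x) (b := y) (by rw [dist_eq_norm]; linarith)
      rw [dist_eq_norm] at this
      exact this.le
    obtain ⟨g, hg, hgb⟩ := merg_step hc (by positivity) hfc h1 hM h2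
      (hd.congr fun z hz => hfK z (interior_subset hz))
    exact ⟨g, hg, fun z hz => (hgb z hz).trans_lt (by linarith)⟩
  obtain ⟨p, hp⟩ := hP.approx hε
  exact ⟨p, fun z hz => by rw [← hfK z hz]; exact hp z hz⟩


lemma planch_conv {φ ψ : ℝ → ℝ} (hφ : Integrable φ) (hψ : Integrable ψ) (hc : Continuous ψ)
    (hφ0 : ∀ x, 0 ≤ φ x) (hψ0 : ∀ x, 0 ≤ ψ x) :
    Integrable (fun x : ℝ × ℝ => φ x.1 * ψ (x.2 - x.1)) (volume.prod volume) ∧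
    ∫ x : ℝ × ℝ, φ x.1 * ψ (x.2 - x.1) ∂(volume.prod volume) = (∫ x, φ x) * ∫ x, ψ x := by
  have hI : Integrable (fun x : ℝ × ℝ => φ x.1 * ψ (x.2 - x.1)) (volume.prod volume) := by
    rw [integrable_prod_iff]
    · constructor
      · refine Eventually.of_forall fun u => ?_
        exact (hψ.comp_sub_right u).const_mul (φ u)
      · have : (fun x : ℝ => ∫ y : ℝ, ‖φ x * ψ (y - x)‖) = fun x => φ x * ∫ y, ψ y := by
          funext x
          have : ∀ y, ‖φ x * ψ (y - x)‖ = φ x * ψ (y - x) := fun y => by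
            rw [Real.norm_of_nonneg (mul_nonneg (hφ0 _) (hψ0 _))]
          simp_rw [this]
          rw [integral_const_mul, integral_sub_right_eq_self (fun y => ψ y) x]
        simp only [this]
        exact hφ.mul_const _
    · exact hφ.aestronglyMeasurable.comp_fst.mul
        (hc.comp (continuous_snd.sub continuous_fst)).aestronglyMeasurable
  refine ⟨hI, ?_⟩
  rw [integral_prod _ hI, ← integral_mul_const]
  congr 1
  funext x
  simp only []
  rw [integral_const_mul, integral_sub_right_eq_self (fun y => ψ y) x]

lemma planch_gauss {g : ℝ → ℂ} (hg : Integrable g) (hg2 : Integrable fun u => ‖g u‖ ^ 2)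
    {b : ℝ} (hb : 0 < b) :
    Integrable (fun τ : ℝ => Real.exp (-b * τ ^ 2) * ‖∫ u : ℝ, g u * cexp (-(I * τ * u))‖ ^ 2) ∧
    ∫ τ : ℝ, Real.exp (-b * τ ^ 2) * ‖∫ u : ℝ, g u * cexp (-(I * τ * u))‖ ^ 2
      ≤ 2 * Real.pi * ∫ u, ‖g u‖ ^ 2 := by
  set H : ℝ → ℝ × ℝ → ℂ := fun τ x => ((Real.exp (-b * τ ^ 2) : ℝ) : ℂ) *
    (g x.1 * (starRingEnd ℂ) (g x.2)) * cexp (I * (x.2 - x.1 : ℝ) * τ) with hH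
  have hw : Integrable (fun τ : ℝ => ((Real.exp (-b * τ ^ 2) : ℝ) : ℂ)) :=
    (integrable_exp_neg_mul_sq hb).ofReal
  have hgc : Integrable (fun u => (starRingEnd ℂ) (g u)) :=
    (Complex.conjLIE.toContinuousLinearEquiv : ℂ →L[ℝ] ℂ).integrable_comp hg
  have hHi : Integrable (Function.uncurry H) (volume.prod (volume.prod volume)) := by
    have h1 := hw.mul_prod (hg.mul_prod hgc)
    have := h1.mul_bdd (c := 1) (g := fun x : ℝ × ℝ × ℝ => cexp (I * (x.2.2 - x.2.1 : ℝ) * x.1))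
      (Continuous.aestronglyMeasurable (by fun_prop)) (Eventually.of_forall fun x => by
        rw [show I * ((x.2.2 - x.2.1 : ℝ) : ℂ) * x.1 = (((x.2.2 - x.2.1) * x.1 : ℝ) : ℂ) * I by push_cast; ring,
          Complex.norm_exp_ofReal_mul_I])
    exact this
  have hA : ∀ τ : ℝ, ∫ x, H τ x ∂(volume.prod volume) =
      ((Real.exp (-b * τ ^ 2) * ‖∫ u : ℝ, g u * cexp (-(I * τ * u))‖ ^ 2 : ℝ) : ℂ) := by
    intro τ
    have e1 : ∀ x : ℝ × ℝ, H τ x = ((Real.exp (-b * τ ^ 2) : ℝ) : ℂ) *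
      ((g x.1 * cexp (-(I * τ * x.1))) * ((starRingEnd ℂ) (g x.2 * cexp (-(I * τ * x.2))))) := by
      intro x
      simp only [hH, map_mul, ← Complex.exp_conj, map_neg, Complex.conj_I, Complex.conj_ofReal]
      rw [show I * ((x.2 - x.1 : ℝ) : ℂ) * τ = -(I * τ * x.1) + -(-I * τ * x.2) by push_cast; ring,
        Complex.exp_add]
      ring
    simp_rw [e1]
    rw [integral_const_mul, integral_prod_mul (fun u : ℝ => g u * cexp (-(I * τ * u)))
      (fun u : ℝ => (starRingEnd ℂ) (g u * cexp (-(I * τ * u)))), integral_conj, Complex.mul_conj,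
      Complex.normSq_eq_norm_sq]
    push_cast
    rfl
  set Gr : ℝ → ℝ := fun x => Real.sqrt (Real.pi / b) * Real.exp (-(1 / (4 * b)) * x ^ 2) with hGr
  have hGri : Integrable Gr := (integrable_exp_neg_mul_sq (by positivity)).const_mul _
  have hGr0 : ∀ x, 0 ≤ Gr x := fun x => by positivity
  have hGrI : ∫ x, Gr x = 2 * Real.pi := by
    rw [hGr, integral_const_mul, integral_gaussian, ← Real.sqrt_mul (by positivity),
      show Real.pi / b * (Real.pi / (1 / (4 * b))) = (2 * Real.pi) ^ 2 by field_simp; ring,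
      Real.sqrt_sq (by positivity)]
  have hB : ∀ x : ℝ × ℝ, ∫ τ, H τ x = g x.1 * (starRingEnd ℂ) (g x.2) * (Gr (x.2 - x.1) : ℂ) := by
    intro x
    have e1 : ∀ τ : ℝ, H τ x = (g x.1 * (starRingEnd ℂ) (g x.2)) *
      (cexp (I * ((x.2 - x.1 : ℝ) : ℂ) * τ) * cexp (-(b : ℂ) * τ ^ 2)) := by
      intro τ; simp only [hH]; push_cast; ring
    simp_rw [e1]
    rw [integral_const_mul, fourierIntegral_gaussian (by simpa using hb)]
    congr 1
    simp only [hGr]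
    push_cast
    rw [show (1 / 2 : ℂ) = ((1 / 2 : ℝ) : ℂ) by push_cast; rfl, Real.sqrt_eq_rpow,
      Complex.ofReal_cpow (by positivity)]
    push_cast
    congr 2
    field_simp
  have hsw := integral_integral_swap hHi
  have hint := hHi.integral_prod_left
  simp only [Function.uncurry] at hint
  have hLi : Integrable (fun τ : ℝ => Real.exp (-b * τ ^ 2) * ‖∫ u : ℝ, g u * cexp (-(I * τ * u))‖ ^ 2) := by
    have : Integrable (fun τ : ℝ => ((Real.exp (-b * τ ^ 2) * ‖∫ u : ℝ, g u * cexp (-(I * τ * u))‖ ^ 2 : ℝ) : ℂ)) := by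
      simpa only [hA] using hint
    exact this.re
  refine ⟨hLi, ?_⟩
  simp only [hA, hB] at hsw
  rw [integral_complex_ofReal] at hsw
  obtain ⟨c1, c2⟩ := planch_conv hg2 hGri (by fun_prop) (fun x => by positivity) hGr0
  have c1' := c1.swap
  have c2' : ∫ x : ℝ × ℝ, ‖g x.2‖ ^ 2 * Gr (x.2 - x.1) ∂(volume.prod volume) = (∫ u, ‖g u‖ ^ 2) * ∫ x, Gr x := by
    rw [← c2, ← integral_prod_swap]
    congr 1; funext x
    simp only [Prod.fst_swap, Prod.snd_swap, hGr]
    rw [show (x.1 - x.2) ^ 2 = (x.2 - x.1) ^ 2 by ring]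
  have c1'' : Integrable (fun x : ℝ × ℝ => ‖g x.2‖ ^ 2 * Gr (x.2 - x.1)) (volume.prod volume) := by
    refine c1'.congr (Eventually.of_forall fun x => ?_)
    simp only [Function.comp, Prod.fst_swap, Prod.snd_swap, hGr]
    rw [show (x.1 - x.2) ^ 2 = (x.2 - x.1) ^ 2 by ring]
  have h0 : (0:ℝ) ≤ ∫ τ : ℝ, Real.exp (-b * τ ^ 2) * ‖∫ u : ℝ, g u * cexp (-(I * τ * u))‖ ^ 2 :=
    integral_nonneg fun τ => by positivity
  rw [← Real.norm_of_nonneg h0, ← Complex.norm_real, hsw]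
  calc _ ≤ ∫ x : ℝ × ℝ, ((1/2) * (‖g x.1‖ ^ 2 * Gr (x.2 - x.1)) + (1/2) * (‖g x.2‖ ^ 2 * Gr (x.2 - x.1))) ∂(volume.prod volume) := by
        refine norm_integral_le_of_norm_le ((c1.const_mul _).add (c1''.const_mul _)) (Eventually.of_forall fun x => ?_)
        rw [norm_mul, norm_mul, RCLike.norm_conj, Complex.norm_real, Real.norm_of_nonneg (hGr0 _)]
        nlinarith [mul_nonneg (hGr0 (x.2 - x.1)) (sq_nonneg (‖g x.1‖ - ‖g x.2‖))]
    _ = 2 * Real.pi * ∫ u, ‖g u‖ ^ 2 := by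
        rw [integral_add (c1.const_mul _) (c1''.const_mul _), integral_const_mul, integral_const_mul, c2, c2', hGrI]
        ring

lemma planch {g : ℝ → ℂ} (hg : Integrable g) (hg2 : Integrable fun u => ‖g u‖ ^ 2)
    {T : ℝ} (hT : 0 < T) :
    ∫ τ in (-T)..T, ‖∫ u : ℝ, g u * cexp (-(I * τ * u))‖ ^ 2
      ≤ 20 * ∫ u, ‖g u‖ ^ 2 := by
  obtain ⟨h1, h2⟩ := planch_gauss hg hg2 (b := 1 / T ^ 2) (by positivity)
  have h3 : 0 ≤ ∫ u, ‖g u‖ ^ 2 := integral_nonneg fun τ => by positivity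
  rw [intervalIntegral.integral_of_le (by linarith)]
  calc _ ≤ ∫ τ in Set.Ioc (-T) T, Real.exp 1 * (Real.exp (-(1 / T ^ 2) * τ ^ 2) * ‖∫ u : ℝ, g u * cexp (-(I * τ * u))‖ ^ 2) := by
        refine integral_mono_of_nonneg (Eventually.of_forall fun x => by positivity) (h1.const_mul _).integrableOn ?_
        filter_upwards [ae_restrict_mem measurableSet_Ioc] with τ hτ
        rw [← mul_assoc, ← Real.exp_add]
        have : 1 ≤ Real.exp (1 + -(1 / T ^ 2) * τ ^ 2) := by
          apply Real.one_le_exp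
          have : τ ^ 2 ≤ T ^ 2 := by nlinarith [hτ.1, hτ.2]
          have : 1 / T ^ 2 * τ ^ 2 ≤ 1 := by
            rw [div_mul_eq_mul_div, one_mul]; exact (div_le_one (by positivity)).2 this
          linarith
        nlinarith [sq_nonneg ‖∫ u : ℝ, g u * cexp (-(I * τ * u))‖]
    _ ≤ ∫ τ, Real.exp 1 * (Real.exp (-(1 / T ^ 2) * τ ^ 2) * ‖∫ u : ℝ, g u * cexp (-(I * τ * u))‖ ^ 2) :=
        setIntegral_le_integral (h1.const_mul _) (Eventually.of_forall fun x => by positivity)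
    _ ≤ Real.exp 1 * (2 * Real.pi * ∫ u, ‖g u‖ ^ 2) := by
        rw [integral_const_mul]; gcongr
    _ ≤ _ := by
        have := Real.exp_one_lt_d9
        have := Real.pi_lt_d2
        have hp := Real.pi_pos
        have : Real.exp 1 * (2 * Real.pi) ≤ 20 := by nlinarith
        nlinarith


lemma dirpoly_ms {X : ℕ} (hX : 1 ≤ X) (a : ℕ → ℂ) {T : ℝ} (hT : 0 < T) (hTX : T ≤ X) :
    ∫ τ in (-T)..T, ‖∑ n ∈ Finset.Icc 1 X, a n * cexp (-(I * τ * Real.log n))‖ ^ 2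
      ≤ 160 * X * ∑ n ∈ Finset.Icc 1 X, ‖a n‖ ^ 2 := by
  have hXr : (1:ℝ) ≤ X := by exact_mod_cast hX
  set h : ℝ := 1 / (2 * X) with hh
  have hh0 : 0 < h := by positivity
  set S : ℕ → Set ℝ := fun n => Set.Ioc (Real.log n) (Real.log n + h) with hS
  have hSm : ∀ n, MeasurableSet (S n) := fun n => measurableSet_Ioc
  have hsep : ∀ n m : ℕ, 1 ≤ n → n < m → m ≤ X → Real.log n + h ≤ Real.log m := by
    intro n m hn hnm hm
    have hn' : (1:ℝ) ≤ n := by exact_mod_cast hn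
    have hnm' : (n:ℝ) + 1 ≤ m := by exact_mod_cast hnm
    have hm' : (m:ℝ) ≤ X := by exact_mod_cast hm
    have hm0 : (0:ℝ) < m := by linarith
    have h1 : 1 - (m / n : ℝ)⁻¹ ≤ Real.log (m / n) := Real.one_sub_inv_le_log_of_pos (by positivity)
    rw [Real.log_div (by positivity) (by positivity), inv_div] at h1
    have : h ≤ 1 - (n:ℝ)/m := by
      rw [hh, le_sub_iff_add_le, div_add_div _ _ (by positivity) (by positivity), div_le_one (by positivity)]
      nlinarith
    linarith
  have hdisj : ∀ n m : ℕ, n ∈ Finset.Icc 1 X → m ∈ Finset.Icc 1 X → ∀ u, u ∈ S n → u ∈ S m → n = m := by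
    intro n m hn hm u h1 h2
    rw [Finset.mem_Icc] at hn hm
    rcases lt_trichotomy n m with h | h | h
    · have := hsep n m hn.1 h hm.2
      linarith [h1.2, h2.1]
    · exact h
    · have := hsep m n hm.1 h hn.2
      linarith [h2.2, h1.1]
  set g : ℝ → ℂ := fun u => ∑ n ∈ Finset.Icc 1 X, (S n).indicator (fun _ => a n) u with hg
  have hgi : Integrable g := by
    refine integrable_finsetSum _ fun n _ => ?_
    refine (integrable_indicator_iff (hSm n)).2 ?_
    exact integrableOn_const (by simp [hS])
  have hg2 : ∀ u, ‖g u‖ ^ 2 = ∑ n ∈ Finset.Icc 1 X, (S n).indicator (fun _ => ‖a n‖ ^ 2) u := by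
    intro u
    by_cases hu : ∃ n ∈ Finset.Icc 1 X, u ∈ S n
    · obtain ⟨n, hn, hu⟩ := hu
      rw [hg]
      simp only []
      rw [Finset.sum_eq_single_of_mem n hn, Finset.sum_eq_single_of_mem n hn]
      · simp [hu]
      · intro m hm hmn
        exact Set.indicator_of_notMem (fun hu' => hmn (hdisj _ _ hm hn u hu' hu)) _
      · intro m hm hmn
        exact Set.indicator_of_notMem (fun hu' => hmn (hdisj _ _ hm hn u hu' hu)) _
    · push Not at hu
      rw [hg]
      simp only []
      rw [Finset.sum_eq_zero, Finset.sum_eq_zero]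
      · simp
      · intro m hm; exact Set.indicator_of_notMem (hu m hm) _
      · intro m hm; exact Set.indicator_of_notMem (hu m hm) _
  have hi2 : ∀ n, Integrable ((S n).indicator (fun _ => ‖a n‖ ^ 2)) := fun n =>
    (integrable_indicator_iff (hSm n)).2 (integrableOn_const (by simp [hS]))
  have hg2i : Integrable (fun u => ‖g u‖ ^ 2) := by
    simp_rw [hg2]
    exact integrable_finsetSum _ fun n _ => hi2 n
  have hg2I : ∫ u, ‖g u‖ ^ 2 = h * ∑ n ∈ Finset.Icc 1 X, ‖a n‖ ^ 2 := by
    simp_rw [hg2]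
    rw [integral_finsetSum _ fun n _ => hi2 n, Finset.mul_sum]
    refine Finset.sum_congr rfl fun n _ => ?_
    rw [integral_indicator (hSm n)]
    simp [hS, hh0.le]
  have hp := planch hgi hg2i hT
  set E : ℝ → ℂ := fun τ => ∫ u in (0:ℝ)..h, cexp (-(I * τ * u)) with hE
  have hFT : ∀ τ : ℝ, ∫ u : ℝ, g u * cexp (-(I * τ * u)) =
      (∑ n ∈ Finset.Icc 1 X, a n * cexp (-(I * τ * Real.log n))) * E τ := by
    intro τ
    have e1 : ∀ u : ℝ, g u * cexp (-(I * τ * u)) =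
      ∑ n ∈ Finset.Icc 1 X, (S n).indicator (fun u : ℝ => a n * cexp (-(I * τ * u))) u := by
      intro u
      rw [hg]; simp only []
      rw [Finset.sum_mul]
      refine Finset.sum_congr rfl fun n _ => ?_
      by_cases hu : u ∈ S n <;> simp [hu]
    simp_rw [e1]
    rw [integral_finsetSum, Finset.sum_mul]
    · refine Finset.sum_congr rfl fun n _ => ?_
      rw [integral_indicator (hSm n), hS]
      simp only []
      rw [← intervalIntegral.integral_of_le (by linarith), intervalIntegral.integral_const_mul, mul_assoc]
      congr 1
      have := intervalIntegral.integral_comp_add_right (a := 0) (b := h) (fun u : ℝ => cexp (-(I * τ * u))) (Real.log n)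
      rw [zero_add, add_comm h] at this
      rw [← this, hE]
      simp only []
      rw [← intervalIntegral.integral_const_mul]
      congr 1
      funext u
      rw [← Complex.exp_add]
      congr 1
      push_cast; ring
    · intro n _
      refine (integrable_indicator_iff (hSm n)).2 ?_
      exact (Continuous.integrableOn_Ioc (by fun_prop))
  have hEb : ∀ τ ∈ Set.Icc (-T) T, h / 2 ≤ ‖E τ‖ := by
    intro τ hτ
    have h1 : (E τ).re = ∫ u in (0:ℝ)..h, Real.cos (τ * u) := by
      have := intervalIntegral.intervalIntegral_re (𝕜 := ℂ) (f := fun u : ℝ => cexp (-(I * τ * u))) (μ := volume) (a := 0) (b := h)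
        (Continuous.intervalIntegrable (by fun_prop) _ _)
      simp only [RCLike.re_to_complex] at this
      rw [hE]
      simp only []
      rw [← this]
      congr 1; funext u
      rw [Complex.exp_re]; simp
    have h2 : h / 2 ≤ (E τ).re := by
      rw [h1]
      have : ∫ u in (0:ℝ)..h, (1/2:ℝ) = h / 2 := by simp; ring
      rw [← this]
      refine intervalIntegral.integral_mono_on hh0.le (by simp) (Continuous.intervalIntegrable (by fun_prop) _ _) ?_
      intro u hu
      have hc := Real.one_sub_sq_div_two_le_cos (x := τ * u)
      have hb : |τ * u| ≤ 1 := by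
        rw [abs_mul, abs_of_nonneg hu.1]
        calc |τ| * u ≤ X * h := by
              gcongr
              · exact hu.1
              · exact (abs_le.2 hτ).trans hTX
              · exact hu.2
          _ ≤ 1 := by rw [hh]; field_simp; norm_num
      have : (τ * u) ^ 2 ≤ 1 := by rw [← sq_abs]; nlinarith [abs_nonneg (τ * u)]
      linarith
    exact h2.trans (Complex.re_le_norm _)
  have hEc : Continuous E := by
    apply intervalIntegral.continuous_parametric_intervalIntegral_of_continuous'
    fun_prop
  simp_rw [hFT] at hp
  rw [hg2I] at hp
  have hle : (h / 2) ^ 2 * ∫ τ in (-T)..T, ‖∑ n ∈ Finset.Icc 1 X, a n * cexp (-(I * τ * Real.log n))‖ ^ 2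
     ≤ ∫ τ in (-T)..T, ‖(∑ n ∈ Finset.Icc 1 X, a n * cexp (-(I * τ * Real.log n))) * E τ‖ ^ 2 := by
    rw [← intervalIntegral.integral_const_mul]
    refine intervalIntegral.integral_mono_on (by linarith) (Continuous.intervalIntegrable (by fun_prop) _ _)
      (Continuous.intervalIntegrable (by fun_prop) _ _) ?_
    intro τ hτ
    rw [norm_mul, mul_pow, mul_comm]
    gcongr
    exact hEb τ hτ
  have := hle.trans hp
  have h4 : (h / 2) ^ 2 * (∫ τ in (-T)..T, ‖∑ n ∈ Finset.Icc 1 X, a n * cexp (-(I * τ * Real.log n))‖ ^ 2)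
    ≤ (h / 2) ^ 2 * (160 * X * ∑ n ∈ Finset.Icc 1 X, ‖a n‖ ^ 2) := by
    refine this.trans (le_of_eq ?_)
    rw [hh]; field_simp; ring
  exact le_of_mul_le_mul_left h4 (by positivity)


noncomputable def cop (P n : ℕ) : ℂ := if P.Coprime n then 1 else 0

lemma cop_norm_le (P n : ℕ) : ‖cop P n‖ ≤ 1 := by
  unfold cop; split_ifs <;> simp

lemma cop_count (P k q : ℕ) :
    ((Finset.Ico k (k + P * q)).filter (fun x => P.Coprime x)).card = P.totient * q := by
  induction q with
  | zero => simp
  | succ q ih =>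
    have : Finset.Ico k (k + P * (q + 1)) = Finset.Ico k (k + P * q) ∪ Finset.Ico (k + P * q) (k + P * q + P) := by
      rw [Finset.Ico_union_Ico_eq_Ico (by omega) (by omega)]; congr 1; ring
    rw [this, Finset.filter_union, Finset.card_union_of_disjoint, ih, Nat.filter_coprime_Ico_eq_totient]
    · ring
    · apply Finset.disjoint_filter_filter
      exact Finset.Ico_disjoint_Ico_consecutive _ _ _

lemma cop_bound {P : ℕ} (hP : 0 < P) (k n : ℕ) :
    |(((Finset.Ico k (k + n)).filter (fun x => P.Coprime x)).card : ℝ) - (P.totient / P : ℝ) * n| ≤ P := by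
  set q := n / P with hq
  have h1 : P * q ≤ n := Nat.mul_div_le n P
  have h2 : n ≤ P * (q + 1) := (Nat.lt_mul_div_succ n hP).le
  have e1 : P.totient * q ≤ ((Finset.Ico k (k + n)).filter (fun x => P.Coprime x)).card := by
    rw [← cop_count P k q]
    exact Finset.card_le_card (Finset.filter_subset_filter _ (Finset.Ico_subset_Ico_right (by omega)))
  have e2 : ((Finset.Ico k (k + n)).filter (fun x => P.Coprime x)).card ≤ P.totient * (q + 1) := by
    rw [← cop_count P k (q + 1)]
    exact Finset.card_le_card (Finset.filter_subset_filter _ (Finset.Ico_subset_Ico_right (by omega)))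
  have hPr : (0:ℝ) < P := by exact_mod_cast hP
  have h1' : (P:ℝ) * q ≤ n := by exact_mod_cast h1
  have h2' : (n:ℝ) ≤ P * (q + 1) := by exact_mod_cast h2
  have e1' : (P.totient:ℝ) * q ≤ (((Finset.Ico k (k + n)).filter (fun x => P.Coprime x)).card : ℝ) := by exact_mod_cast e1
  have e2' : (((Finset.Ico k (k + n)).filter (fun x => P.Coprime x)).card : ℝ) ≤ (P.totient:ℝ) * (q + 1) := by exact_mod_cast e2
  have ht : (P.totient:ℝ) ≤ P := by exact_mod_cast Nat.totient_le P
  have ht0 : (0:ℝ) ≤ P.totient / P := by positivity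
  have f1 : (P.totient / P : ℝ) * n ≤ P.totient * (q + 1) := by
    calc _ ≤ (P.totient / P : ℝ) * (P * (q + 1)) := by gcongr
      _ = _ := by field_simp
  have f2 : (P.totient:ℝ) * q ≤ (P.totient / P : ℝ) * n := by
    calc _ = (P.totient / P : ℝ) * (P * q) := by field_simp
      _ ≤ _ := by gcongr
  rw [abs_le]
  constructor <;> linarith

noncomputable def eX (P X : ℕ) (t : ℝ) : ℂ :=
  if (X:ℝ) < t then (∑ k ∈ Finset.Ioc X ⌊t⌋₊, cop P k) - ((P.totient / P : ℝ) : ℂ) * ((t - X : ℝ) : ℂ) else 0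

lemma eX_norm_le {P : ℕ} (hP : 0 < P) (X : ℕ) (t : ℝ) : ‖eX P X t‖ ≤ P + 1 := by
  unfold eX
  split_ifs with h
  · have hfl : X ≤ ⌊t⌋₊ := Nat.le_floor h.le
    have e1 : (∑ k ∈ Finset.Ioc X ⌊t⌋₊, cop P k) =
        ((((Finset.Ico (X + 1) (X + 1 + (⌊t⌋₊ - X))).filter (fun x => P.Coprime x)).card : ℝ) : ℂ) := by
      unfold cop
      have : Finset.Ico (X + 1) (X + 1 + (⌊t⌋₊ - X)) = Finset.Ioc X ⌊t⌋₊ := by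
        ext x; simp; omega
      rw [this]
      simp [Finset.sum_ite]
    have hb := cop_bound hP (X + 1) (⌊t⌋₊ - X)
    rw [e1, ← Complex.ofReal_mul, ← Complex.ofReal_sub, Complex.norm_real, Real.norm_eq_abs]
    have hft : (⌊t⌋₊ : ℝ) ≤ t := Nat.floor_le (by have : (0:ℝ) ≤ X := Nat.cast_nonneg _; linarith)
    have hft2 : t < ⌊t⌋₊ + 1 := Nat.lt_floor_add_one t
    rw [Nat.cast_sub hfl] at hb
    have hk1 : (P.totient / P : ℝ) ≤ 1 := by
      rw [div_le_one (by exact_mod_cast hP)]; exact_mod_cast Nat.totient_le P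
    have hk0 : (0:ℝ) ≤ (P.totient / P : ℝ) := by positivity
    rw [abs_le] at hb ⊢
    constructor <;> nlinarith [hb.1, hb.2]
  · simp; positivity

lemma eX_meas (P X : ℕ) : Measurable (eX P X) := by
  unfold eX
  refine Measurable.ite measurableSet_Ioi ?_ measurable_const
  refine Measurable.sub ?_ (by fun_prop)
  have : Measurable (fun n : ℕ => ∑ k ∈ Finset.Ioc X n, cop P k) := measurable_from_nat
  exact this.comp Nat.measurable_floor

lemma eX_int {P X : ℕ} (hP : 0 < P) (hX : 0 < X) {s : ℂ} (hs : 0 < s.re) :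
    IntegrableOn (fun t : ℝ => (t:ℂ) ^ (-s - 1) * eX P X t) (Set.Ioi X) := by
  have h1 := integrableOn_Ioi_cpow_of_lt (a := -s - 1) (c := X) (by simp; linarith) (by exact_mod_cast hX)
  exact h1.mul_bdd (c := P + 1) (eX_meas P X).aestronglyMeasurable (Eventually.of_forall fun t => eX_norm_le hP X t)

lemma eX_mellin {P X : ℕ} (s : ℂ) :
    mellin (eX P X) (-s) = ∫ t in Set.Ioi (X:ℝ), (t:ℂ) ^ (-s - 1) * eX P X t := by
  unfold mellin
  rw [← integral_indicator measurableSet_Ioi, ← integral_indicator measurableSet_Ioi]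
  congr 1
  funext t
  by_cases h : (X:ℝ) < t
  · have : (0:ℝ) < t := lt_of_le_of_lt (Nat.cast_nonneg X) h
    simp [h, this]
  · have : eX P X t = 0 := by simp [eX, h]
    simp [Set.indicator, this]

lemma eX_diff {P X : ℕ} (hP : 0 < P) (hX : 0 < X) {s : ℂ} (hs : 0 < s.re) :
    DifferentiableAt ℂ (fun s => mellin (eX P X) (-s)) s := by
  have : DifferentiableAt ℂ (mellin (eX P X)) (-s) := by
    refine mellin_differentiableAt_of_isBigO_rpow (a := 0) (b := (-s).re - 1) ?_ ?_ (by simpa using hs) ?_ (by linarith)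
    · refine LocallyIntegrable.locallyIntegrableOn ?_ _
      refine LocallyIntegrable.mono (g := eX P X) (f := fun _ => ((P:ℝ) + 1)) (locallyIntegrable_const _) (eX_meas P X).aestronglyMeasurable
        (Eventually.of_forall fun t => ?_)
      exact (eX_norm_le hP X t).trans (le_abs_self _)
    · refine Asymptotics.IsBigO.of_bound (P + 1) (Eventually.of_forall fun t => ?_)
      simpa using eX_norm_le hP X t
    · refine Asymptotics.IsBigO.of_bound 0 ?_
      have : Set.Iio (X:ℝ) ∈ nhdsWithin 0 (Set.Ioi 0) := nhdsWithin_le_nhds (Iio_mem_nhds (by exact_mod_cast hX))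
      filter_upwards [this] with t ht
      have : ¬ (X:ℝ) < t := not_lt.2 (le_of_lt ht)
      simp [eX, this]
  exact this.comp s (differentiable_neg s)

lemma formula_one {P X : ℕ} (hP : 0 < P) (hX : 0 < X) {s : ℂ} (hs : 1 < s.re) :
    LSeries (cop P) s = ∑ n ∈ Finset.Icc 1 X, cop P n * (n:ℂ) ^ (-s) +
      ((P.totient / P : ℝ) : ℂ) * (X:ℂ) ^ (1 - s) / (s - 1) + s * mellin (eX P X) (-s) := by
  have hs0 : s ≠ 0 := by rintro rfl; norm_num at hs
  have hs1 : s - 1 ≠ 0 := by intro h; rw [sub_eq_zero] at h; subst h; norm_num at hs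
  have hXr : (0:ℝ) < X := by exact_mod_cast hX
  set κ : ℂ := ((P.totient / P : ℝ) : ℂ) with hκ
  set d : ℕ → ℂ := fun k => if X < k then cop P k else 0 with hd
  set b : ℕ → ℂ := fun k => if X < k then 0 else cop P k with hb
  have hdb : b + d = cop P := by
    funext k; simp only [Pi.add_apply, hd, hb]; split_ifs <;> simp
  have hbs : LSeriesSummable b s := by
    refine LSeriesSummable_of_bounded_of_one_lt_re (m := 1) (fun n _ => ?_) hs
    simp only [hb]; split_ifs
    · simp
    · exact cop_norm_le _ _
  have hdn : ∀ n, ‖d n‖ ≤ 1 := by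
    intro n
    simp only [hd]; split_ifs
    · exact cop_norm_le _ _
    · simp
  have hds : LSeriesSummable d s := LSeriesSummable_of_bounded_of_one_lt_re (m := 1) (fun n _ => hdn n) hs
  rw [← hdb, LSeries_add hbs hds]
  have h1 : LSeries b s = ∑ n ∈ Finset.Icc 1 X, (b + d) n * (n:ℂ) ^ (-s) := by
    rw [LSeries, tsum_eq_sum (s := Finset.Icc 1 X)]
    · refine Finset.sum_congr rfl fun n hn => ?_
      rw [Finset.mem_Icc] at hn
      rw [LSeries.term_of_ne_zero (by omega), hdb, Complex.cpow_neg, div_eq_mul_inv]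
      simp only [hb]
      rw [if_neg (by omega)]
    · intro n hn
      rw [Finset.mem_Icc] at hn
      rcases Nat.eq_zero_or_pos n with rfl | h
      · simp
      · rw [LSeries.term_of_ne_zero (by omega)]
        simp only [hb]; rw [if_pos (by omega)]; simp
  rw [h1, add_assoc]
  congr 1
  have hO : (fun n ↦ ∑ k ∈ Finset.Icc 1 n, d k) =O[atTop] fun n : ℕ ↦ (n : ℝ) ^ (1:ℝ) := by
    refine Asymptotics.IsBigO.of_bound 1 (Eventually.of_forall fun n => ?_)
    calc _ ≤ ∑ k ∈ Finset.Icc 1 n, ‖d k‖ := norm_sum_le _ _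
      _ ≤ ∑ k ∈ Finset.Icc 1 n, (1:ℝ) := Finset.sum_le_sum fun k _ => hdn k
      _ = _ := by simp
  rw [LSeries_eq_mul_integral d zero_le_one hs hds hO, eX_mellin]
  have h2 : ∫ t in Set.Ioi (1 : ℝ), (∑ k ∈ Finset.Icc 1 ⌊t⌋₊, d k) * (t:ℂ) ^ (-(s + 1)) =
     ∫ t in Set.Ioi (X : ℝ), ((κ * (t:ℂ) ^ (-s) - κ * X * (t:ℂ) ^ (-s - 1)) + (t:ℂ) ^ (-s - 1) * eX P X t) := by
    rw [← integral_indicator measurableSet_Ioi, ← integral_indicator measurableSet_Ioi]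
    congr 1
    funext t
    by_cases h : (X:ℝ) < t
    · have hX1 : (1:ℝ) ≤ X := by exact_mod_cast hX
      have h' : (1:ℝ) < t := lt_of_le_of_lt hX1 h
      have ht0 : (t:ℂ) ≠ 0 := by norm_cast; linarith
      rw [Set.indicator_of_mem (show t ∈ Set.Ioi (1:ℝ) from h'), Set.indicator_of_mem (show t ∈ Set.Ioi (X:ℝ) from h)]
      have e1 : (∑ k ∈ Finset.Icc 1 ⌊t⌋₊, d k) = ∑ k ∈ Finset.Ioc X ⌊t⌋₊, cop P k := by
        rw [← Finset.sum_filter]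
        congr 1
        ext x; simp; omega
      have e2 : (t:ℂ) ^ (-s) = t * (t:ℂ) ^ (-s - 1) := by
        rw [Complex.cpow_sub _ _ ht0, Complex.cpow_one]; field_simp
      rw [e1, eX, if_pos h, e2, neg_add']
      push_cast
      simp only [hκ]; push_cast; ring
    · rw [Set.indicator_of_notMem (show t ∉ Set.Ioi (X:ℝ) from h)]
      simp only [Set.indicator]
      split_ifs with h'
      · rw [Finset.sum_eq_zero, zero_mul]
        intro k hk
        rw [Finset.mem_Icc] at hk
        simp only [hd]
        rw [if_neg]
        rw [not_lt]
        have : (k:ℝ) ≤ X := by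
          calc (k:ℝ) ≤ ⌊t⌋₊ := by exact_mod_cast hk.2
            _ ≤ t := Nat.floor_le (by linarith [Set.mem_Ioi.1 h'])
            _ ≤ X := not_lt.1 h
        exact_mod_cast this
      · rfl
  have i1 := integrableOn_Ioi_cpow_of_lt (a := -s) (c := X) (by simp; linarith) hXr
  have i2 := integrableOn_Ioi_cpow_of_lt (a := -s - 1) (c := X) (by simp; linarith) hXr
  have hXc : ((X:ℝ):ℂ) ≠ 0 := by norm_cast; omega
  have i3 : IntegrableOn (fun t : ℝ => κ * (t:ℂ) ^ (-s) - κ * X * (t:ℂ) ^ (-s - 1)) (Set.Ioi (X:ℝ)) :=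
    (i1.const_mul κ).sub (i2.const_mul (κ * X))
  rw [h2, integral_add i3 (eX_int hP hX (by linarith)), mul_add]
  congr 1
  rw [integral_sub (i1.const_mul _) (i2.const_mul _), integral_const_mul, integral_const_mul,
    integral_Ioi_cpow_of_lt (by simp; linarith) hXr, integral_Ioi_cpow_of_lt (by simp; linarith) hXr]
  rw [show (1 - s) = -s + 1 by ring, show -s - 1 + 1 = -s by ring, Complex.cpow_add _ _ (by exact_mod_cast hXc), Complex.cpow_one]
  push_cast
  have : -s + 1 ≠ 0 := by intro h; apply hs1; linear_combination -h
  rw [Complex.cpow_add _ _ (by exact_mod_cast hXc), Complex.cpow_one]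
  field_simp
  ring

noncomputable def fP (P : ℕ) (s : ℂ) : ℂ := (∏ p ∈ P.primeFactors, (1 - (p : ℂ) ^ (-s))) * riemannZeta s

lemma fP_eq_LSeries {P : ℕ} (hP : 0 < P) {s : ℂ} (hs : 1 < s.re) : fP P s = LSeries (cop P) s := by
  haveI : NeZero P := ⟨hP.ne'⟩
  have hs1 : s ≠ 1 := by rintro rfl; norm_num at hs
  rw [fP, ← DirichletCharacter.LFunctionTrivChar_eq_mul_riemannZeta hs1, DirichletCharacter.LFunctionTrivChar,
    DirichletCharacter.LFunction_eq_LSeries _ hs]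
  congr 1
  funext n
  unfold cop
  split_ifs with h
  · exact MulChar.one_apply ((ZMod.isUnit_iff_coprime n P).2 h.symm)
  · exact MulChar.map_nonunit _ (fun h' => h ((ZMod.isUnit_iff_coprime n P).1 h').symm)

lemma fP_diff {P : ℕ} {s : ℂ} (hs : s ≠ 1) : DifferentiableAt ℂ (fP P) s := by
  unfold fP
  refine DifferentiableAt.mul ?_ (differentiableAt_riemannZeta hs)
  refine DifferentiableAt.fun_finsetProd fun p hp => ?_
  have : (p:ℂ) ≠ 0 := by exact_mod_cast (Nat.prime_of_mem_primeFactors hp).ne_zero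
  refine (differentiableAt_const _).sub ?_
  exact DifferentiableAt.const_cpow differentiableAt_id.neg (Or.inl this)

lemma formula {P X : ℕ} (hP : 0 < P) (hX : 0 < X) {s : ℂ} (hs : 0 < s.re) (hi : s.im ≠ 0) :
    fP P s = ∑ n ∈ Finset.Icc 1 X, cop P n * (n:ℂ) ^ (-s) +
      ((P.totient / P : ℝ) : ℂ) * (X:ℂ) ^ (1 - s) / (s - 1) + s * mellin (eX P X) (-s) := by
  set U : Set ℂ := {z | 0 < z.re ∧ 0 < s.im * z.im} with hU
  have hUo : IsOpen U := (isOpen_lt continuous_const continuous_re).inter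
    (isOpen_lt continuous_const (continuous_const.mul continuous_im))
  have hUc : Convex ℝ U := by
    intro x hx y hy a b ha hb hab
    simp only [hU, Set.mem_ofPred_eq] at hx hy ⊢
    simp only [add_re, add_im, real_smul, mul_re, mul_im, ofReal_re, ofReal_im]
    rcases eq_or_lt_of_le ha with h | h
    · subst h
      have : b = 1 := by linarith
      subst this; simpa using hy
    · constructor
      · nlinarith [mul_pos h hx.1, mul_nonneg hb hy.1.le]
      · nlinarith [mul_pos h hx.2, mul_nonneg hb hy.2.le]
  have hne : ∀ z ∈ U, z ≠ 1 := by
    rintro z hz rfl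
    simp [hU] at hz
  have hXc : (X:ℂ) ≠ 0 := by exact_mod_cast hX.ne'
  have hL : AnalyticOnNhd ℂ (fP P) U :=
    DifferentiableOn.analyticOnNhd (fun z hz => (fP_diff (hne z hz)).differentiableWithinAt) hUo
  have hR : AnalyticOnNhd ℂ (fun s => ∑ n ∈ Finset.Icc 1 X, cop P n * (n:ℂ) ^ (-s) +
      ((P.totient / P : ℝ) : ℂ) * (X:ℂ) ^ (1 - s) / (s - 1) + s * mellin (eX P X) (-s)) U := by
    refine DifferentiableOn.analyticOnNhd (fun z hz => DifferentiableAt.differentiableWithinAt ?_) hUo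
    refine DifferentiableAt.add (DifferentiableAt.add ?_ ?_) ?_
    · refine DifferentiableAt.fun_sum fun n hn => ?_
      rw [Finset.mem_Icc] at hn
      have : (n:ℂ) ≠ 0 := by norm_cast; omega
      exact (DifferentiableAt.const_cpow differentiableAt_id.neg (Or.inl this)).const_mul _
    · refine DifferentiableAt.div ((DifferentiableAt.const_cpow (differentiableAt_id.const_sub _) (Or.inl hXc)).const_mul _) (differentiableAt_id.sub_const _) ?_
      exact sub_ne_zero.2 (hne z hz)
    · exact differentiableAt_id.mul (eX_diff hP hX hz.1)
  have h0 : (2 + I * s.im : ℂ) ∈ U := by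
    simp only [hU, Set.mem_ofPred_eq]
    simp
    exact hi
  refine hL.eqOn_of_preconnected_of_eventuallyEq hR hUc.isPreconnected h0 ?_ ⟨hs, mul_self_pos.2 hi⟩
  have : {z : ℂ | 1 < z.re} ∈ nhds (2 + I * s.im : ℂ) :=
    (isOpen_lt continuous_const continuous_re).mem_nhds (by simp)
  filter_upwards [this] with z hz
  rw [fP_eq_LSeries hP hz, formula_one hP hX hz]


lemma ms_mellin {P X : ℕ} (hX : 1 ≤ X) (σ τ : ℝ) :
    mellin (eX P X) (-(σ + I * τ)) = ∫ u : ℝ, ((Real.exp (-σ * u) : ℝ) * eX P X (Real.exp u)) * cexp (-(I * τ * u)) := by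
  rw [mellin_eq_fourier, Real.fourier_real_eq_integral_exp_smul, ← integral_neg_eq_self]
  congr 1
  funext u
  simp only [smul_eq_mul, neg_re, neg_im, add_re, add_im, ofReal_re, ofReal_im, mul_re, mul_im, I_re, I_im, neg_neg, real_smul]
  have hp : (Real.pi : ℂ) ≠ 0 := by exact_mod_cast Real.pi_ne_zero
  rw [mul_comm]
  congr 2
  · ring_nf
  · push_cast; field_simp; ring

lemma ms_E {P X : ℕ} (hP : 0 < P) (hX : 1 ≤ X) {σ T : ℝ} (hσ : 1 / 2 < σ) (hσ1 : σ < 1) (hT : 0 < T) (hTX : T ≤ X) :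
    ∫ τ in (-T)..T, ‖((σ:ℂ) + I * τ) * mellin (eX P X) (-(σ + I * τ))‖ ^ 2 ≤ 40 * ((P:ℝ) + 1) ^ 2 * (X:ℝ) ^ (2 - 2 * σ) := by
  have hXr : (1:ℝ) ≤ X := by exact_mod_cast hX
  set g : ℝ → ℂ := fun u => ((Real.exp (-σ * u) : ℝ) * eX P X (Real.exp u)) with hg
  have hgm : AEStronglyMeasurable g := by
    refine Measurable.aestronglyMeasurable ?_
    exact Measurable.mul (by fun_prop) ((eX_meas P X).comp Real.measurable_exp)
  have hdom : ∀ u, ‖g u‖ ≤ (Set.Ioi (Real.log X)).indicator (fun u => (P + 1) * Real.exp (-σ * u)) u := by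
    intro u
    by_cases h : Real.log X < u
    · rw [Set.indicator_of_mem (show u ∈ Set.Ioi _ from h), hg]
      simp only [norm_mul, Complex.norm_real, Real.norm_eq_abs, Real.abs_exp]
      rw [mul_comm]
      gcongr
      exact eX_norm_le hP X _
    · rw [Set.indicator_of_notMem (show u ∉ Set.Ioi _ from h), hg]
      have : ¬ (X:ℝ) < Real.exp u := by
        rw [← Real.log_lt_iff_lt_exp (by linarith)]; exact h
      simp [eX, this]
  have hdom2 : ∀ u, ‖g u‖ ^ 2 ≤ (Set.Ioi (Real.log X)).indicator (fun u => (P + 1) ^ 2 * Real.exp (-(2 * σ) * u)) u := by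
    intro u
    refine (pow_le_pow_left₀ (norm_nonneg _) (hdom u) 2).trans ?_
    simp only [Set.indicator]
    split_ifs
    · rw [mul_pow, ← Real.exp_nat_mul]
      apply le_of_eq; congr 2; push_cast; ring
    · simp
  have hi1 : Integrable ((Set.Ioi (Real.log X)).indicator (fun u => ((P:ℝ) + 1) * Real.exp (-σ * u))) :=
    (integrable_indicator_iff measurableSet_Ioi).2 ((integrableOn_exp_mul_Ioi (by linarith) _).const_mul _)
  have hi2 : Integrable ((Set.Ioi (Real.log X)).indicator (fun u => ((P:ℝ) + 1) ^ 2 * Real.exp (-(2 * σ) * u))) :=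
    (integrable_indicator_iff measurableSet_Ioi).2 ((integrableOn_exp_mul_Ioi (by linarith) _).const_mul _)
  have hgi : Integrable g := hi1.mono' hgm (Eventually.of_forall hdom)
  have hgi2 : Integrable (fun u => ‖g u‖ ^ 2) := by
    refine hi2.mono' (hgm.norm.pow 2) (Eventually.of_forall fun u => ?_)
    rw [Real.norm_of_nonneg (by positivity)]; exact hdom2 u
  have hgI : ∫ u, ‖g u‖ ^ 2 ≤ (P + 1) ^ 2 * (X:ℝ) ^ (-(2 * σ)) := by
    refine (integral_mono hgi2 hi2 hdom2).trans ?_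
    rw [integral_indicator measurableSet_Ioi, integral_const_mul, integral_exp_mul_Ioi (by linarith)]
    rw [neg_div_neg_eq, mul_comm (-(2*σ)) (Real.log X), ← Real.rpow_def_of_pos (by linarith)]
    gcongr
    apply div_le_self (by positivity) (by linarith)
  have hp := planch hgi hgi2 hT
  have hc : Continuous (fun τ : ℝ => mellin (eX P X) (-(σ + I * τ))) := by
    rw [continuous_iff_continuousAt]
    intro τ
    have := (eX_diff (P := P) (X := X) hP hX (s := σ + I * τ) (by simp; linarith)).continuousAt
    exact ContinuousAt.comp (f := fun τ : ℝ => ((σ:ℂ) + I * τ)) this (by fun_prop)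
  have h3 : ∫ τ in (-T)..T, ‖((σ:ℂ) + I * τ) * mellin (eX P X) (-(σ + I * τ))‖ ^ 2 ≤
     ∫ τ in (-T)..T, (2 * (X:ℝ) ^ 2) * ‖mellin (eX P X) (-(σ + I * τ))‖ ^ 2 := by
    refine intervalIntegral.integral_mono_on (by linarith) (Continuous.intervalIntegrable (by fun_prop) _ _)
      (Continuous.intervalIntegrable (by fun_prop) _ _) ?_
    intro τ hτ
    rw [norm_mul, mul_pow]
    gcongr
    rw [← Complex.normSq_eq_norm_sq, Complex.normSq_apply]
    simp
    nlinarith [hτ.1, hτ.2]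
  refine h3.trans ?_
  rw [intervalIntegral.integral_const_mul]
  simp_rw [ms_mellin hX σ]
  calc _ ≤ 2 * (X:ℝ) ^ 2 * (20 * ((P + 1) ^ 2 * (X:ℝ) ^ (-(2 * σ)))) := by
        gcongr
        exact hp.trans (by gcongr)
    _ = _ := by
        rw [show (2 - 2 * σ) = 2 + -(2 * σ) by ring, Real.rpow_add (by linarith), Real.rpow_two]
        ring

lemma ms_K {X : ℕ} (hX : 1 ≤ X) {κ : ℂ} (hκ : ‖κ‖ ≤ 1) {σ σ1 T : ℝ} (hσ0 : 0 < σ) (hσ1 : σ ≤ σ1) (h1 : σ1 < 1) (hT : 0 < T) :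
    ∫ τ in (-T)..T, ‖κ * (X:ℂ) ^ (1 - ((σ:ℂ) + I * τ)) / ((σ:ℂ) + I * τ - 1)‖ ^ 2 ≤
      4 / (1 - σ1) ^ 2 * (X:ℝ) ^ (2 - 2 * σ) := by
  have hXr : (1:ℝ) ≤ X := by exact_mod_cast hX
  have hXc : (X:ℂ) ≠ 0 := by norm_cast; omega
  have hne : ∀ τ : ℝ, (σ:ℂ) + I * τ - 1 ≠ 0 := by
    intro τ h
    have := congrArg Complex.re h
    simp at this; linarith
  have h2 : ∫ τ in (-T)..T, ‖κ * (X:ℂ) ^ (1 - ((σ:ℂ) + I * τ)) / ((σ:ℂ) + I * τ - 1)‖ ^ 2 ≤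
      ∫ τ in (-T)..T, (1 / (1 - σ1) ^ 2 * (X:ℝ) ^ (2 - 2 * σ)) * (1 + τ ^ 2)⁻¹ := by
    have hc1 : Continuous (fun τ : ℝ => ‖κ * (X:ℂ) ^ (1 - ((σ:ℂ) + I * τ)) / ((σ:ℂ) + I * τ - 1)‖ ^ 2) := by
      refine (Continuous.norm (Continuous.div ?_ (by fun_prop) hne)).pow 2
      exact continuous_const.mul (Continuous.const_cpow (by fun_prop) (Or.inl hXc))
    have hc2 : Continuous (fun τ : ℝ => (1 + τ ^ 2)⁻¹) := Continuous.inv₀ (by fun_prop) (fun τ => by positivity)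
    refine intervalIntegral.integral_mono_on (by linarith) (hc1.intervalIntegrable _ _)
      ((hc2.const_mul _).intervalIntegrable _ _) ?_
    intro τ hτ
    rw [norm_div, norm_mul, div_pow, mul_pow]
    have e1 : ‖(X:ℂ) ^ (1 - ((σ:ℂ) + I * τ))‖ ^ 2 = (X:ℝ) ^ (2 - 2 * σ) := by
      rw [Complex.norm_natCast_cpow_of_pos (by omega), ← Real.rpow_mul_natCast (by linarith)]
      congr 1; simp; ring
    have e2 : ‖(σ:ℂ) + I * τ - 1‖ ^ 2 = (1 - σ) ^ 2 + τ ^ 2 := by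
      rw [← Complex.normSq_eq_norm_sq, Complex.normSq_apply]; simp; ring
    rw [e1, e2]
    have h5 : (1 - σ1) ^ 2 * (1 + τ ^ 2) ≤ (1 - σ) ^ 2 + τ ^ 2 := by
      have : (1 - σ1) ^ 2 ≤ 1 := by nlinarith
      have : (1 - σ1) ^ 2 ≤ (1 - σ) ^ 2 := by nlinarith
      nlinarith [sq_nonneg τ]
    have h6 : 0 < (1 - σ1) ^ 2 := by have : 0 < 1 - σ1 := by linarith
                                     positivity
    calc ‖κ‖ ^ 2 * (X:ℝ) ^ (2 - 2 * σ) / ((1 - σ) ^ 2 + τ ^ 2) ≤ 1 * (X:ℝ) ^ (2 - 2 * σ) / ((1 - σ1) ^ 2 * (1 + τ ^ 2)) := by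
          gcongr
          nlinarith [norm_nonneg κ]
      _ = _ := by field_simp
  refine h2.trans ?_
  rw [intervalIntegral.integral_const_mul, integral_inv_one_add_sq]
  have : Real.arctan T - Real.arctan (-T) ≤ 4 := by
    have a1 := Real.arctan_lt_pi_div_two T
    have a2 := Real.neg_pi_div_two_lt_arctan (-T)
    have := Real.pi_le_four
    linarith
  calc _ ≤ (1 / (1 - σ1) ^ 2 * (X:ℝ) ^ (2 - 2 * σ)) * 4 := by gcongr
    _ = _ := by ring

lemma cop_gt {N n : ℕ} (hn : 1 < n) (h : cop (primorial N) n ≠ 0) : N < n := by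
  unfold cop at h
  have hc : (primorial N).Coprime n := by by_contra hc; simp [hc] at h
  by_contra hle
  have hp := Nat.minFac_prime (show n ≠ 1 by omega)
  have h1 : n.minFac ∣ primorial N := hp.dvd_primorial_iff.2 ((Nat.minFac_le (by omega)).trans (by omega))
  exact hp.one_lt.ne' (Nat.eq_one_of_dvd_coprimes hc h1 (Nat.minFac_dvd n))

lemma ms_one {N X : ℕ} (hX : 1 ≤ X) {σ0 σ σ1 T : ℝ} (h0 : 1 / 2 < σ0) (hσ0 : σ0 ≤ σ) (hσ1 : σ ≤ σ1) (h1 : σ1 < 1)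
    (hT : 0 < T) (hTX : T ≤ X) :
    ∫ τ in (-T)..T, ‖fP (primorial N) ((σ:ℂ) + I * τ) - 1‖ ^ 2 ≤
      3 * (160 * X * ∑' k : ℕ, ((k + N : ℕ) : ℝ) ^ (-(2 * σ0)) + (4 / (1 - σ1) ^ 2 + 40 * ((primorial N:ℝ) + 1) ^ 2) * (X:ℝ) ^ (2 - 2 * σ0)) := by
  set P := primorial N with hPd
  have hP : 0 < P := primorial_pos N
  have hXr : (1:ℝ) ≤ X := by exact_mod_cast hX
  have hXc : (X:ℂ) ≠ 0 := by norm_cast; omega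
  have hne : ∀ τ : ℝ, (σ:ℂ) + I * τ - 1 ≠ 0 := by
    intro τ h
    have := congrArg Complex.re h
    simp at this; linarith
  set a : ℕ → ℂ := fun n => if n = 1 then 0 else cop P n * ((n:ℝ) ^ (-σ) : ℝ) with ha
  set κ : ℂ := ((P.totient / P : ℝ) : ℂ) with hκ
  have hκ1 : ‖κ‖ ≤ 1 := by
    rw [hκ, Complex.norm_real, Real.norm_of_nonneg (by positivity), div_le_one (by exact_mod_cast hP)]
    exact_mod_cast Nat.totient_le P
  set D : ℝ → ℂ := fun τ => ∑ n ∈ Finset.Icc 1 X, a n * cexp (-(I * τ * Real.log n)) with hD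
  set Kf : ℝ → ℂ := fun τ => κ * (X:ℂ) ^ (1 - ((σ:ℂ) + I * τ)) / ((σ:ℂ) + I * τ - 1) with hKf
  set E : ℝ → ℂ := fun τ => ((σ:ℂ) + I * τ) * mellin (eX P X) (-(σ + I * τ)) with hE
  have hsplit : ∀ τ : ℝ, τ ≠ 0 → fP P ((σ:ℂ) + I * τ) - 1 = D τ + Kf τ + E τ := by
    intro τ hτ
    rw [formula (X := X) hP hX (by simp; linarith) (by simpa using hτ)]
    have : ∑ n ∈ Finset.Icc 1 X, cop P n * (n:ℂ) ^ (-((σ:ℂ) + I * τ)) = D τ + 1 := by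
      rw [hD]
      simp only []
      rw [← Finset.add_sum_erase _ _ (show 1 ∈ Finset.Icc 1 X by simp [hX]), ← Finset.add_sum_erase (Finset.Icc 1 X) (fun n => a n * _) (show 1 ∈ Finset.Icc 1 X by simp [hX])]
      have e1 : cop P 1 = 1 := by simp [cop]
      rw [e1]
      simp only [ha, if_true]
      simp only [Nat.cast_one, Complex.one_cpow, one_mul, zero_mul, zero_add]
      rw [add_comm]
      congr 1
      refine Finset.sum_congr rfl fun n hn => ?_
      rw [Finset.mem_erase, Finset.mem_Icc] at hn
      rw [if_neg hn.1, mul_assoc]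
      congr 1
      have hn0 : (n:ℂ) ≠ 0 := by norm_cast; omega
      rw [neg_add, Complex.cpow_add _ _ hn0, Complex.ofReal_cpow (Nat.cast_nonneg n)]
      congr 1
      · push_cast; rfl
      · rw [Complex.cpow_def_of_ne_zero hn0, Complex.natCast_log]; congr 1; ring
    rw [this]
    simp only [hKf, hE]
    ring
  have hDc : Continuous D := by simp only [hD]; fun_prop
  have hKc : Continuous Kf := by
    refine (Continuous.div ?_ (by fun_prop) hne)
    exact continuous_const.mul (Continuous.const_cpow (by fun_prop) (Or.inl hXc))
  have hEc : Continuous E := by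
    refine Continuous.mul (by fun_prop) ?_
    rw [continuous_iff_continuousAt]
    intro τ
    have := (eX_diff (P := P) (X := X) hP hX (s := σ + I * τ) (by simp; linarith)).continuousAt
    exact ContinuousAt.comp (f := fun τ : ℝ => ((σ:ℂ) + I * τ)) this (by fun_prop)
  have hI : ∫ τ in (-T)..T, ‖fP P ((σ:ℂ) + I * τ) - 1‖ ^ 2 ≤ ∫ τ in (-T)..T, 3 * (‖D τ‖ ^ 2 + (‖Kf τ‖ ^ 2 + ‖E τ‖ ^ 2)) := by
    have : ∫ τ in (-T)..T, ‖fP P ((σ:ℂ) + I * τ) - 1‖ ^ 2 = ∫ τ in (-T)..T, ‖D τ + Kf τ + E τ‖ ^ 2 := by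
      refine intervalIntegral.integral_congr_ae ?_
      have h0 : ∀ᵐ τ : ℝ, τ ≠ 0 := by simp [ae_iff]
      filter_upwards [h0] with τ hτ _
      rw [hsplit τ hτ]
    rw [this]
    refine intervalIntegral.integral_mono_on (by linarith) (Continuous.intervalIntegrable (by fun_prop) _ _)
      (Continuous.intervalIntegrable (by fun_prop) _ _) ?_
    intro τ _
    have h1 := norm_add₃_le (a := D τ) (b := Kf τ) (c := E τ)
    calc _ ≤ (‖D τ‖ + ‖Kf τ‖ + ‖E τ‖) ^ 2 := by gcongr
      _ ≤ _ := by nlinarith [sq_nonneg (‖D τ‖ - ‖Kf τ‖), sq_nonneg (‖D τ‖ - ‖E τ‖), sq_nonneg (‖Kf τ‖ - ‖E τ‖)]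
  refine hI.trans ?_
  rw [intervalIntegral.integral_const_mul, intervalIntegral.integral_add (Continuous.intervalIntegrable (by fun_prop) _ _) (Continuous.intervalIntegrable (by fun_prop) _ _),
    intervalIntegral.integral_add (Continuous.intervalIntegrable (by fun_prop) _ _) (Continuous.intervalIntegrable (by fun_prop) _ _)]
  have b1 := dirpoly_ms hX a hT hTX
  have b2 := ms_K hX hκ1 (by linarith) hσ1 h1 hT
  have b3 := ms_E hP hX (show 1 / 2 < σ by linarith) (by linarith) hT hTX
  have hpow : (X:ℝ) ^ (2 - 2 * σ) ≤ (X:ℝ) ^ (2 - 2 * σ0) := Real.rpow_le_rpow_of_exponent_le hXr (by linarith)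
  have hsum : ∑ n ∈ Finset.Icc 1 X, ‖a n‖ ^ 2 ≤ ∑' k : ℕ, ((k + N : ℕ) : ℝ) ^ (-(2 * σ0)) := by
    have hs : Summable (fun k : ℕ => ((k + N : ℕ) : ℝ) ^ (-(2 * σ0))) := by
      have := (Real.summable_nat_rpow (p := -(2 * σ0))).2 (by linarith)
      exact (summable_nat_add_iff N).2 this
    calc ∑ n ∈ Finset.Icc 1 X, ‖a n‖ ^ 2 ≤ ∑ n ∈ (Finset.Icc 1 X).filter (fun n => N ≤ n), (n:ℝ) ^ (-(2 * σ0)) := by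
          rw [Finset.sum_filter]
          refine Finset.sum_le_sum fun n hn => ?_
          rw [Finset.mem_Icc] at hn
          simp only [ha]
          by_cases hn1 : n = 1
          · rw [if_pos hn1]; split_ifs <;> simp
            positivity
          · rw [if_neg hn1]
            by_cases hc : cop P n = 0
            · rw [hc]; split_ifs <;> simp
              positivity
            · have := cop_gt (N := N) (n := n) (by omega) hc
              rw [if_pos this.le, norm_mul, mul_pow, Complex.norm_real, Real.norm_of_nonneg (by positivity)]
              have hn1 : (1:ℝ) ≤ n := by exact_mod_cast hn.1
              have e1 : ((n:ℝ) ^ (-σ)) ^ 2 = (n:ℝ) ^ (-(2 * σ)) := by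
                rw [← Real.rpow_mul_natCast (by linarith)]; congr 1; push_cast; ring
              rw [e1]
              have e2 : (n:ℝ) ^ (-(2 * σ)) ≤ (n:ℝ) ^ (-(2 * σ0)) := Real.rpow_le_rpow_of_exponent_le hn1 (by linarith)
              have e3 : ‖cop P n‖ ^ 2 ≤ 1 := by
                have := cop_norm_le P n
                nlinarith [norm_nonneg (cop P n)]
              have : 0 ≤ (n:ℝ) ^ (-(2 * σ)) := by positivity
              nlinarith
      _ ≤ ∑ n ∈ Finset.Ico N (X + 1), (n:ℝ) ^ (-(2 * σ0)) := by
          refine Finset.sum_le_sum_of_subset_of_nonneg ?_ (fun n _ _ => by positivity)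
          intro n hn
          simp at hn ⊢; omega
      _ = ∑ k ∈ Finset.range (X + 1 - N), ((k + N : ℕ) : ℝ) ^ (-(2 * σ0)) := by
          rw [Finset.sum_Ico_eq_sum_range]
          refine Finset.sum_congr rfl fun k _ => by rw [add_comm]
      _ ≤ _ := hs.sum_le_tsum _ (fun k _ => by positivity)
  have b1' := b1.trans (mul_le_mul_of_nonneg_left hsum (by positivity))
  have hk : 0 ≤ 4 / (1 - σ1) ^ 2 := by positivity
  have b2' := b2.trans (mul_le_mul_of_nonneg_left hpow hk)
  have b3' := b3.trans (mul_le_mul_of_nonneg_left hpow (by positivity))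
  simp only [hD, hKf, hE]
  linarith

lemma mean_square {σ0 σ1 H η : ℝ} (h0 : 1 / 2 < σ0) (h1 : σ1 < 1) (hη : 0 < η) :
    ∃ N0 : ℕ, ∀ N ≥ N0, ∃ T0 : ℝ, ∀ T ≥ T0, ∀ s : ℂ, σ0 ≤ s.re → s.re ≤ σ1 → |s.im| ≤ H →
      ∫ τ in (-T)..T, ‖fP (primorial N) (s + I * τ) - 1‖ ^ 2 ≤ η * T := by
  have hs := (Real.summable_nat_rpow (p := -(2 * σ0))).2 (by linarith)
  have ht := tendsto_sum_nat_add (fun n : ℕ => (n:ℝ) ^ (-(2 * σ0)))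
  have ht' : ∀ᶠ N in atTop, ∑' k : ℕ, ((k + N : ℕ) : ℝ) ^ (-(2 * σ0)) < η / 4000 := ht.eventually_lt_const (by positivity)
  obtain ⟨N0, hN0⟩ := eventually_atTop.1 ht'
  refine ⟨N0, fun N hN => ?_⟩
  have hN := hN0 N hN
  set C : ℝ := 4 / (1 - σ1) ^ 2 + 40 * ((primorial N:ℝ) + 1) ^ 2 with hC
  have hC0 : 0 < C := by positivity
  have hlim : Tendsto (fun T : ℝ => T ^ (-(2 * σ0 - 1))) atTop (nhds 0) := tendsto_rpow_neg_atTop (by linarith)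
  have hlim' : ∀ᶠ T : ℝ in atTop, T ^ (-(2 * σ0 - 1)) < η / (24 * C) := hlim.eventually_lt_const (by positivity)
  obtain ⟨T1, hT1⟩ := eventually_atTop.1 hlim'
  refine ⟨max (max T1 1) H, fun T hT s hs0 hs1 hsH => ?_⟩
  have hTT1 : T1 ≤ T := le_trans (le_trans (le_max_left _ _) (le_max_left _ _)) hT
  have hT1' : 1 ≤ T := le_trans (le_trans (le_max_right _ _) (le_max_left _ _)) hT
  have hTH : H ≤ T := le_trans (le_max_right _ _) hT
  have hcont : Continuous (fun τ : ℝ => ‖fP (primorial N) ((s.re:ℂ) + I * τ) - 1‖ ^ 2) := by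
    refine (Continuous.norm (Continuous.sub ?_ continuous_const)).pow 2
    rw [continuous_iff_continuousAt]
    intro τ
    have : ((s.re:ℂ) + I * τ) ≠ 1 := by
      intro h
      have := congrArg Complex.re h
      simp at this; linarith
    exact ContinuousAt.comp (f := fun τ : ℝ => ((s.re:ℂ) + I * τ)) (fP_diff this).continuousAt (by fun_prop)
  have e1 : ∫ τ in (-T)..T, ‖fP (primorial N) (s + I * τ) - 1‖ ^ 2 =
      ∫ τ in (-T + s.im)..(T + s.im), ‖fP (primorial N) ((s.re:ℂ) + I * τ) - 1‖ ^ 2 := by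
    rw [← intervalIntegral.integral_comp_add_right (fun τ : ℝ => ‖fP (primorial N) ((s.re:ℂ) + I * τ) - 1‖ ^ 2)]
    congr 1; funext τ
    congr 4
    apply Complex.ext <;> simp; ring
  have hab := abs_le.1 hsH
  have e2 : ∫ τ in (-T + s.im)..(T + s.im), ‖fP (primorial N) ((s.re:ℂ) + I * τ) - 1‖ ^ 2 ≤
      ∫ τ in (-(2 * T))..(2 * T), ‖fP (primorial N) ((s.re:ℂ) + I * τ) - 1‖ ^ 2 := by
    refine intervalIntegral.integral_mono_interval (by linarith) (by linarith) (by linarith) ?_ (hcont.intervalIntegrable _ _)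
    exact Eventually.of_forall fun τ => by positivity
  rw [e1]
  refine e2.trans ?_
  have hX1 : 1 ≤ ⌈2 * T⌉₊ := Nat.one_le_ceil_iff.2 (by linarith)
  refine (ms_one (N := N) (X := ⌈2 * T⌉₊) hX1 h0 hs0 hs1 h1 (by linarith) (Nat.le_ceil _)).trans ?_
  set X := ⌈2 * T⌉₊ with hX
  have hX2 : (X:ℝ) ≤ 4 * T := by
    have := Nat.ceil_lt_add_one (show 0 ≤ 2 * T by linarith)
    rw [← hX] at this
    linarith
  have hX3 : T ≤ X := by
    have := Nat.le_ceil (2 * T)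
    rw [← hX] at this; linarith
  have hXp : (X:ℝ) ^ (2 - 2 * σ0) ≤ 4 * T * (η / (24 * C)) := by
    rw [show 2 - 2 * σ0 = 1 + -(2 * σ0 - 1) by ring, Real.rpow_add (by linarith), Real.rpow_one]
    have : (X:ℝ) ^ (-(2 * σ0 - 1)) ≤ T ^ (-(2 * σ0 - 1)) := by
      apply Real.rpow_le_rpow_of_nonpos (by linarith) hX3 (by linarith)
    have h4 := this.trans (hT1 T hTT1).le
    gcongr
  have hts : 0 ≤ ∑' k : ℕ, ((k + N : ℕ) : ℝ) ^ (-(2 * σ0)) := tsum_nonneg fun k => by positivity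
  calc _ ≤ 3 * (160 * (4 * T) * (η / 4000) + C * (4 * T * (η / (24 * C)))) := by
        gcongr
    _ = 3 * (640 / 4000 + 1 / 6) * (η * T) := by field_simp; norm_num
    _ ≤ _ := by nlinarith [mul_pos hη (show 0 < T by linarith)]


lemma sum_logp {c : ℝ} (hc : 1 < c) : Summable fun p : Nat.Primes => Real.log p * (p:ℝ) ^ (-c) := by
  have h1 : Summable fun n : ℕ => (2 / (c-1)) * (n:ℝ) ^ (-((c+1)/2)) :=
    (Real.summable_nat_rpow.2 (by linarith)).mul_left _
  refine Summable.of_nonneg_of_le (fun p => by positivity) (fun p => ?_)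
    (h1.comp_injective Nat.Primes.coe_nat_injective)
  have hp : (0:ℝ) < (p:ℕ) := by exact_mod_cast p.2.pos
  have := Real.log_le_rpow_div hp.le (ε := (c-1)/2) (by linarith)
  calc Real.log p * (p:ℝ) ^ (-c) ≤ ((p:ℝ)^((c-1)/2) / ((c-1)/2)) * (p:ℝ) ^ (-c) := by gcongr
    _ = (2 / (c-1)) * ((p:ℝ)^((c-1)/2) * (p:ℝ) ^ (-c)) := by
        rw [div_div_eq_mul_div]; ring
    _ = _ := by rw [← Real.rpow_add hp]; congr 2; ring

lemma norm_pu (p : Nat.Primes) (u : ℂ) : ‖((p:ℕ):ℂ) ^ (-u)‖ = (p:ℝ) ^ (-u.re) := by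
  rw [Complex.norm_natCast_cpow_of_pos p.2.pos]; simp

lemma one_sub_pu (p : Nat.Primes) {u : ℂ} (hu : 1/2 ≤ u.re) : 1/4 ≤ ‖1 - ((p:ℕ):ℂ) ^ (-u)‖ := by
  have h1 : ‖((p:ℕ):ℂ) ^ (-u)‖ ≤ 3/4 := by
    rw [norm_pu]
    have h2 : (2:ℝ) ≤ (p:ℕ) := by exact_mod_cast p.2.two_le
    calc ((p:ℕ):ℝ) ^ (-u.re) ≤ ((p:ℕ):ℝ) ^ (-(1/2:ℝ)) :=
          Real.rpow_le_rpow_of_exponent_le (by linarith) (by linarith)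
      _ ≤ (2:ℝ) ^ (-(1/2:ℝ)) := Real.rpow_le_rpow_of_nonpos (by norm_num) h2 (by norm_num)
      _ ≤ 3/4 := by
        rw [Real.rpow_neg (by norm_num), ← Real.sqrt_eq_rpow]
        rw [inv_le_comm₀ (by positivity) (by norm_num)]
        exact Real.le_sqrt_of_sq_le (by norm_num)
  have := norm_sub_norm_le (1:ℂ) (((p:ℕ):ℂ) ^ (-u))
  simp only [norm_one] at this
  linarith

lemma hasDeriv_pu (p : Nat.Primes) (u : ℂ) :
    HasDerivAt (fun u : ℂ => ((p:ℕ):ℂ) ^ (-u)) (-(Real.log p * ((p:ℕ):ℂ) ^ (-u))) u := by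
  have hp : ((p:ℕ):ℂ) ≠ 0 := by exact_mod_cast p.2.ne_zero
  have := (hasDerivAt_neg u).const_cpow (c := ((p:ℕ):ℂ)) (Or.inl hp)
  rw [Complex.natCast_log]
  convert this using 1; ring

lemma zeta_logderiv {u : ℂ} (hu : 1 < u.re) : - deriv riemannZeta u / riemannZeta u =
    ∑' p : Nat.Primes, Real.log p * ((p:ℕ):ℂ) ^ (-u) / (1 - ((p:ℕ):ℂ) ^ (-u)) := by
  set c := (1 + u.re) / 2 with hc
  have hD : HasDerivAt (fun z : ℂ => ∑' p : Nat.Primes, -Complex.log (1 - ((p:ℕ):ℂ) ^ (-z)))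
      (∑' p : Nat.Primes, -(Real.log p * ((p:ℕ):ℂ) ^ (-u) / (1 - ((p:ℕ):ℂ) ^ (-u)))) u := by
    refine hasDerivAt_tsum_of_isPreconnected (t := {z : ℂ | c < z.re}) (y₀ := u)
      (g := fun (p : Nat.Primes) (z : ℂ) => -Complex.log (1 - ((p:ℕ):ℂ) ^ (-z)))
      (g' := fun (p : Nat.Primes) (z : ℂ) =>
        -(Real.log p * ((p:ℕ):ℂ) ^ (-z) / (1 - ((p:ℕ):ℂ) ^ (-z))))
      ((sum_logp (c := c) (by linarith)).mul_left 4)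
      (isOpen_lt continuous_const continuous_re) (convex_halfSpace_re_gt c).isPreconnected
      ?_ ?_ (by simp; linarith) ?_ (by simp; linarith)
    · intro p z hz
      simp only [Set.mem_ofPred_eq] at hz
      have h1 := ((hasDeriv_pu p z).const_sub 1)
      have hlt : ‖((p:ℕ):ℂ) ^ (-z)‖ < 1 := by
        rw [norm_pu]
        exact Real.rpow_lt_one_of_one_lt_of_neg (by exact_mod_cast p.2.one_lt) (by linarith)
      have h2 := (h1.clog (by
        have := Complex.mem_slitPlane_of_norm_lt_one (z := -((p:ℕ):ℂ) ^ (-z)) (by simpa)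
        simpa [sub_eq_add_neg] using this)).neg
      have h3 : HasDerivAt (fun z : ℂ => -Complex.log (1 - ((p:ℕ):ℂ) ^ (-z))) _ z := h2
      rw [neg_neg] at h3
      exact h3
    · intro p z hz
      simp only [Set.mem_ofPred_eq] at hz
      rw [norm_neg, norm_div, norm_mul, norm_pu]
      have h4 := one_sub_pu p (u := z) (by linarith)
      have h5 : ((p:ℕ):ℝ) ^ (-z.re) ≤ ((p:ℕ):ℝ) ^ (-c) :=
        Real.rpow_le_rpow_of_exponent_le (by exact_mod_cast p.2.one_le) (by linarith)
      rw [div_le_iff₀ (by linarith), Complex.norm_real,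
        Real.norm_of_nonneg (Real.log_natCast_nonneg _)]
      have h6 := Real.log_natCast_nonneg p
      calc Real.log p * ((p:ℕ):ℝ) ^ (-z.re) ≤ Real.log p * ((p:ℕ):ℝ) ^ (-c) := by gcongr
        _ = 4 * (Real.log p * ((p:ℕ):ℝ) ^ (-c)) * (1/4) := by ring
        _ ≤ _ := by gcongr
    · have := DirichletCharacter.summable_neg_log_one_sub_mul_prime_cpow
        (1 : DirichletCharacter ℂ 1) hu
      refine this.congr fun p => ?_
      rw [MulChar.one_apply (isUnit_of_subsingleton _), one_mul]
  have hE := hD.cexp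
  have hev : (fun z : ℂ => cexp (∑' p : Nat.Primes, -Complex.log (1 - ((p:ℕ):ℂ) ^ (-z))))
      =ᶠ[nhds u] riemannZeta := by
    filter_upwards [(isOpen_lt continuous_const continuous_re).mem_nhds hu] with z hz
    exact riemannZeta_eulerProduct_exp_log hz
  rw [← hev.deriv_eq, hE.deriv, ← hev.eq_of_nhds]
  have := Complex.exp_ne_zero (∑' p : Nat.Primes, -Complex.log (1 - ((p:ℕ):ℂ) ^ (-u)))
  field_simp
  rw [tsum_neg, neg_neg]

noncomputable def EE (u : ℂ) : ℂ :=
  ∑' p : Nat.Primes, Real.log p * (((p:ℕ):ℂ) ^ (-u)) ^ 2 / (1 - ((p:ℕ):ℂ) ^ (-u))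

lemma EE_bound (p : Nat.Primes) {u : ℂ} {c : ℝ} (hc : 1/2 < c) (hu : c ≤ u.re) :
    ‖Real.log p * (((p:ℕ):ℂ) ^ (-u)) ^ 2 / (1 - ((p:ℕ):ℂ) ^ (-u))‖ ≤
      4 * (Real.log p * (p:ℝ) ^ (-(2 * c))) := by
  rw [norm_div, norm_mul, norm_pow, norm_pu]
  have h4 := one_sub_pu p (u := u) (by linarith)
  have hp : (0:ℝ) < (p:ℕ) := by exact_mod_cast p.2.pos
  have h5 : (((p:ℕ):ℝ) ^ (-u.re)) ^ 2 ≤ ((p:ℕ):ℝ) ^ (-(2*c)) := by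
    rw [← Real.rpow_natCast, ← Real.rpow_mul hp.le]
    exact Real.rpow_le_rpow_of_exponent_le (by exact_mod_cast p.2.one_le) (by push_cast; linarith)
  have h6 := Real.log_natCast_nonneg p
  rw [div_le_iff₀ (by linarith), Complex.norm_real, Real.norm_of_nonneg h6]
  calc Real.log p * (((p:ℕ):ℝ) ^ (-u.re)) ^ 2 ≤ Real.log p * ((p:ℕ):ℝ) ^ (-(2*c)) := by gcongr
    _ = 4 * (Real.log p * ((p:ℕ):ℝ) ^ (-(2*c))) * (1/4) := by ring
    _ ≤ _ := by gcongr

lemma EE_diff {u : ℂ} (hu : 1/2 < u.re) : DifferentiableAt ℂ EE u := by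
  set c := (1/2 + u.re) / 2 with hc
  have ho : IsOpen {z : ℂ | c < z.re} := isOpen_lt continuous_const continuous_re
  refine (differentiableOn_tsum_of_summable_norm
    ((sum_logp (c := 2*c) (by linarith)).mul_left 4) (fun p z hz => ?_)
    ho (fun p z hz => EE_bound p (c := c) (by linarith) (le_of_lt hz))).differentiableAt
    (ho.mem_nhds (by simp; linarith))
  simp only [Set.mem_ofPred_eq] at hz
  have h1 := (hasDeriv_pu p z).differentiableAt
  have h4 := one_sub_pu p (u := z) (by linarith)
  refine (((h1.pow 2).const_mul _).div (h1.const_sub 1) ?_).differentiableWithinAt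
  intro h0; rw [h0] at h4; norm_num at h4

lemma summ_logpu {u : ℂ} (hu : 1 < u.re) :
    Summable fun p : Nat.Primes => (Real.log p : ℂ) * ((p:ℕ):ℂ) ^ (-u) := by
  refine Summable.of_norm ((sum_logp hu).congr fun p => ?_)
  rw [norm_mul, norm_pu, Complex.norm_real, Real.norm_of_nonneg (Real.log_natCast_nonneg _)]

lemma logp_sum {u : ℂ} (hu : 1 < u.re) : ∑' p : Nat.Primes, (Real.log p : ℂ) * ((p:ℕ):ℂ) ^ (-u)
    = - deriv riemannZeta u / riemannZeta u - EE u := by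
  rw [zeta_logderiv hu, eq_sub_iff_add_eq, EE, ← Summable.tsum_add (summ_logpu hu)]
  · refine tsum_congr fun p => ?_
    have h4 := one_sub_pu p (u := u) (by linarith)
    have : 1 - ((p:ℕ):ℂ) ^ (-u) ≠ 0 := by
      intro h0; rw [h0] at h4; norm_num at h4
    field_simp; ring
  · exact Summable.of_norm_bounded ((sum_logp (c := 2*u.re) (by linarith)).mul_left 4)
      (fun p => EE_bound p (by linarith) le_rfl)

noncomputable def ZZ : ℂ → ℂ := Function.update (fun u => (u - 1) * riemannZeta u) 1 1

lemma ZZ_ne {u : ℂ} (h : u ≠ 1) : ZZ u = (u-1) * riemannZeta u := Function.update_of_ne h _ _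

lemma ZZ_ev {u : ℂ} (h : u ≠ 1) : ZZ =ᶠ[nhds u] fun u => (u-1) * riemannZeta u := by
  filter_upwards [isOpen_ne.mem_nhds h] with z hz using ZZ_ne hz

lemma ZZ_diff : Differentiable ℂ ZZ := by
  have h0 : ∀ u ≠ 1, DifferentiableAt ℂ ZZ u := fun u h =>
    (((differentiableAt_id.sub_const 1).mul (differentiableAt_riemannZeta h))).congr_of_eventuallyEq
      (ZZ_ev h)
  intro u
  by_cases h : u = 1
  · subst h
    refine (Complex.analyticAt_of_differentiable_on_punctured_nhds_of_continuousAt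
      ?_ ?_).differentiableAt
    · filter_upwards [self_mem_nhdsWithin] with z hz using h0 z hz
    · exact continuousAt_update_same.2 riemannZeta_residue_one
  · exact h0 u h

lemma ZZ_nz {u : ℂ} (hu : 1 ≤ u.re) : ZZ u ≠ 0 := by
  by_cases h : u = 1
  · subst h; simp [ZZ]
  · rw [ZZ_ne h]
    exact mul_ne_zero (sub_ne_zero.2 h) (riemannZeta_ne_zero_of_one_le_re hu)

lemma ZZ_logderiv {u : ℂ} (hu : 1 < u.re) :
    logDeriv ZZ u = 1 / (u-1) + deriv riemannZeta u / riemannZeta u := by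
  have h1 : u ≠ 1 := by rintro rfl; simp at hu
  have h3 := riemannZeta_ne_zero_of_one_le_re hu.le
  have hd : HasDerivAt (fun u => (u-1) * riemannZeta u) _ u :=
    ((hasDerivAt_id u).sub_const 1).mul (differentiableAt_riemannZeta h1).hasDerivAt
  rw [logDeriv_apply, (ZZ_ev h1).deriv_eq, (ZZ_ev h1).eq_of_nhds, hd.deriv]
  have := sub_ne_zero.2 h1
  simp only [id]; field_simp

theorem arith {H : ℝ} (hH : 0 < H) : ∃ (S : Finset ℂ) (μ : ℂ → ℂ) (h : ℂ → ℂ),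
    (∀ ρ ∈ S, ρ.re < 1) ∧
    (∀ u : ℂ, 1/2 < u.re → u.re < 8 → |u.im| < H → DifferentiableAt ℂ h u) ∧
    ∀ u : ℂ, 1 < u.re → u.re < 8 → |u.im| < H →
      ∑' p : Nat.Primes, (Real.log p : ℂ) * ((p:ℕ):ℂ) ^ (-u) =
        1 / (u - 1) - ∑ ρ ∈ S, μ ρ / (u - ρ) - h u := by
  set U : Set ℂ := Set.Icc (1/2:ℝ) 8 ×ℂ Set.Icc (-H) H with hU
  have hUc : IsCompact U := isCompact_Icc.reProdIm isCompact_Icc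
  have hZ : AnalyticOnNhd ℂ ZZ U := fun u _ => ZZ_diff.analyticAt u
  have hm : MeromorphicOn ZZ U := fun u hu => (hZ u hu).meromorphicAt
  have hnz : ∀ u, ZZ u ≠ 0 → meromorphicOrderAt ZZ u = 0 := fun u hu =>
    (ZZ_diff.analyticAt u).meromorphicNFAt.meromorphicOrderAt_eq_zero_iff.2 hu
  have hord : ∀ u, meromorphicOrderAt ZZ u ≠ ⊤ := by
    intro u
    refine MeromorphicOn.meromorphicOrderAt_ne_top_of_isPreconnected (U := Set.univ) (x := 2)
      (fun u _ => (ZZ_diff.analyticAt u).meromorphicAt) isPreconnected_univ trivial trivial ?_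
    rw [hnz 2 (ZZ_nz (by norm_num))]; simp
  have hfin := (MeromorphicOn.divisor ZZ U).finiteSupport hUc
  obtain ⟨g, hg, hgn, hfac⟩ := hm.extract_zeros_poles (fun u => hord u) hfin
  set D := MeromorphicOn.divisor ZZ U with hDdef
  have hS1 : ∀ ρ ∈ hfin.toFinset, ρ.re < 1 := by
    intro ρ hρ
    by_contra hcon
    push Not at hcon
    rw [Set.Finite.mem_toFinset, Function.mem_support] at hρ
    apply hρ
    by_cases hρU : ρ ∈ U
    · rw [MeromorphicOn.divisor_apply hm hρU, hnz ρ (ZZ_nz hcon)]; rfl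
    · exact D.apply_eq_zero_of_notMem hρU
  have hprod : (∏ᶠ u, (· - u) ^ D u : ℂ → ℂ) = ∏ ρ ∈ hfin.toFinset, (· - ρ) ^ D ρ := by
    refine finprod_eq_prod_of_mulSupport_subset _ fun ρ hρ => ?_
    simp only [Set.Finite.coe_toFinset, Function.mem_support]
    intro h0; apply hρ; simp [h0]
  rw [hprod] at hfac
  have hmemU : ∀ u : ℂ, 1/2 < u.re → u.re < 8 → |u.im| < H → u ∈ interior U := by
    intro u h1 h2 h3
    rw [abs_lt] at h3
    rw [hU, Complex.interior_reProdIm, interior_Icc, interior_Icc]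
    exact ⟨⟨h1, h2⟩, ⟨h3.1, h3.2⟩⟩
  refine ⟨hfin.toFinset, fun ρ => D ρ, fun u => logDeriv g u + EE u, hS1, ?_, ?_⟩
  · intro u h1 h2 h3
    have hu := interior_subset (hmemU u h1 h2 h3)
    exact ((hg u hu).deriv.differentiableAt.div (hg u hu).differentiableAt (hgn ⟨u, hu⟩)).add
      (EE_diff h1)
  · intro u h1 h2 h3
    have hui := hmemU u (by linarith) h2 h3
    have hu := interior_subset hui
    have hne : ∀ ρ ∈ hfin.toFinset, u - ρ ≠ 0 := by
      intro ρ hρ h0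
      have := hS1 ρ hρ
      rw [← sub_eq_zero.1 h0] at this; linarith
    have hd : ∀ ρ ∈ hfin.toFinset, DifferentiableAt ℂ ((· - ρ) ^ D ρ : ℂ → ℂ) u := by
      intro ρ hρ
      exact (differentiableAt_id.sub_const ρ).zpow (Or.inl (hne ρ hρ))
    have hd2 : DifferentiableAt ℂ (∏ ρ ∈ hfin.toFinset, (· - ρ) ^ D ρ : ℂ → ℂ) u :=
      DifferentiableAt.finsetProd hd
    have hev : ZZ =ᶠ[nhds u] (∏ ρ ∈ hfin.toFinset, (· - ρ) ^ D ρ : ℂ → ℂ) • g := by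
      refine (ContinuousAt.eventuallyEq_nhds_iff_eventuallyEq_nhdsNE
        (ZZ_diff.continuous.continuousAt) ?_).1 ?_
      · exact (hd2.smul (hg u hu).differentiableAt).continuousAt
      · have h5 : nhdsWithin u {u}ᶜ ≤ codiscreteWithin U := by
          have h6 : nhdsWithin u {u}ᶜ = nhdsWithin u (U \ {u}) := by
            rw [Set.sdiff_eq, Set.inter_comm, nhdsWithin_inter_of_mem']
            exact nhdsWithin_le_nhds (mem_interior_iff_mem_nhds.1 hui)
          rw [h6]
          exact le_iSup₂_of_le (f := fun x (_ : x ∈ U) => nhdsWithin x (U \ {x})) u hu le_rfl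
        exact hfac.filter_mono h5
    have hl : logDeriv ZZ u = ∑ ρ ∈ hfin.toFinset, (D ρ : ℂ) / (u - ρ) + logDeriv g u := by
      rw [logDeriv_apply, hev.deriv_eq, hev.eq_of_nhds, ← logDeriv_apply, smul_eq_mul]
      refine (logDeriv_mul u ?_ (hgn ⟨u, hu⟩) hd2 (hg u hu).differentiableAt).trans ?_
      rotate_left
      · congr 1
        rw [Finset.prod_fn, logDeriv_prod _ hd]
        · refine Finset.sum_congr rfl fun ρ hρ => ?_
          have := logDeriv_fun_zpow (f := fun z : ℂ => z - ρ) (x := u) (by fun_prop) (D ρ)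
          refine Eq.trans this ?_
          simp [logDeriv_apply, div_eq_mul_inv]
        · intro ρ hρ
          exact zpow_ne_zero _ (hne ρ hρ)
      · rw [Finset.prod_apply]
        exact Finset.prod_ne_zero_iff.2 fun ρ hρ => zpow_ne_zero _ (hne ρ hρ)
    rw [logp_sum h1]
    have := ZZ_logderiv h1
    rw [hl] at this
    linear_combination this


/-- identity theorem on convex open sets -/
lemma ident_convex {U : Set ℂ} (hU : IsOpen U) (hc : Convex ℝ U) {f g : ℂ → ℂ}
    (hf : ∀ z ∈ U, DifferentiableAt ℂ f z) (hg : ∀ z ∈ U, DifferentiableAt ℂ g z) {z0 : ℂ}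
    (h0 : z0 ∈ U) (hev : f =ᶠ[nhds z0] g) {z : ℂ} (hz : z ∈ U) : f z = g z := by
  have A : ∀ {f : ℂ → ℂ}, (∀ z ∈ U, DifferentiableAt ℂ f z) → AnalyticOnNhd ℂ f U := fun hf =>
    DifferentiableOn.analyticOnNhd (fun z hz => (hf z hz).differentiableWithinAt) hU
  exact (A hf).eqOn_of_preconnected_of_eventuallyEq (A hg) hc.isPreconnected h0 hev hz

lemma open_box (x y u v : ℝ) : IsOpen {z : ℂ | x < z.re ∧ z.re < y ∧ u < z.im ∧ z.im < v} :=
  (isOpen_lt continuous_const continuous_re).inter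
    ((isOpen_lt continuous_re continuous_const).inter
      ((isOpen_lt continuous_const continuous_im).inter (isOpen_lt continuous_im continuous_const)))

lemma convex_box (x y u v : ℝ) : Convex ℝ {z : ℂ | x < z.re ∧ z.re < y ∧ u < z.im ∧ z.im < v} :=
  (convex_halfSpace_re_gt x).inter ((convex_halfSpace_re_lt y).inter
    ((convex_halfSpace_im_gt u).inter (convex_halfSpace_im_lt v)))

lemma boot {a b H : ℝ} (ha : 0 < a) (hab : a < b) (hb : b < 1) (hH : 0 < H)
    {m B : ℂ → ℂ} {S : Finset ℂ} {μ : ℂ → ℂ} (hS : ∀ ρ ∈ S, ρ.re < 1)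
    (hm : ∀ z : ℂ, ¬ (a ≤ z.re ∧ z.re ≤ b ∧ |z.im| ≤ H) → DifferentiableAt ℂ m z)
    (hm0 : Tendsto m (cocompact ℂ) (nhds 0))
    (hB : ∀ z : ℂ, 0 < z.re → z.re < 6 → |z.im| < H + 1 → DifferentiableAt ℂ B z)
    (heq : ∀ z : ℂ, 1 < z.re → z.re < 6 → |z.im| < H + 1 →
      m z = B z + ∑ ρ ∈ S, μ ρ * m (z + 1 - ρ))
    {z : ℂ} (hz : ¬ (a ≤ z.re ∧ z.re ≤ b ∧ |z.im| ≤ H)) : m z = 0 := by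
  obtain ⟨δ, hδS, hδ⟩ : ∃ δ : ℝ, (∀ ρ ∈ S, δ ≤ 1 - ρ.re) ∧ 0 < δ := by
    have h1 : ∀ᶠ δ : ℝ in nhdsWithin 0 (Set.Ioi 0), ∀ ρ ∈ S, δ ≤ 1 - ρ.re := by
      rw [Finset.eventually_all]
      intro ρ hρ
      refine nhdsWithin_le_nhds (eventually_le_nhds ?_)
      have := hS ρ hρ; linarith
    exact (h1.and self_mem_nhdsWithin).exists
  let P : ℝ → Prop := fun σ => ∃ g : ℂ → ℂ, (∀ z : ℂ, σ < z.re → DifferentiableAt ℂ g z) ∧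
    ∀ z : ℂ, σ < z.re → (b < z.re ∨ H < |z.im|) → g z = m z
  have main : ∀ n : ℕ, P (max (b - n * δ) (a/2)) := by
    intro n
    induction n with
    | zero =>
      have h1 : max (b - ((0:ℕ):ℝ) * δ) (a/2) = b := by
        simp only [Nat.cast_zero, zero_mul, sub_zero]; exact max_eq_left (by linarith)
      rw [h1]
      exact ⟨m, fun z hz => hm z (fun h => by linarith [h.2.1]), fun z _ _ => rfl⟩
    | succ n ih =>
      obtain ⟨g, hg, hgm⟩ := ih
      set σ := max (b - n * δ) (a/2) with hσ
      set σ' := max (b - ((n+1:ℕ):ℝ) * δ) (a/2) with hσ'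
      have hs1 : σ - δ ≤ σ' := by
        rw [hσ, sub_le_iff_le_add]
        refine max_le ?_ ?_
        · have := le_max_left (b - ((n+1:ℕ):ℝ) * δ) (a/2)
          push_cast at this; push_cast at hσ'; rw [hσ']; linarith
        · have := le_max_right (b - ((n+1:ℕ):ℝ) * δ) (a/2)
          linarith
      have hs2 : 0 < σ' := lt_of_lt_of_le (by linarith) (le_max_right _ _)
      have hs3 : σ' ≤ b := max_le (by push_cast; nlinarith) (by linarith)
      have hs4 : σ ≤ b := max_le (by nlinarith [(Nat.cast_nonneg n : (0:ℝ) ≤ n)]) (by linarith)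
      set G : ℂ → ℂ := fun z => B z + ∑ ρ ∈ S, μ ρ * g (z + 1 - ρ) with hG
      have hGd : ∀ z : ℂ, σ' < z.re → z.re < 6 → |z.im| < H + 1 → DifferentiableAt ℂ G z := by
        intro z h1 h2 h3
        refine (hB z (by linarith) h2 h3).add (DifferentiableAt.fun_sum fun ρ hρ => ?_)
        refine DifferentiableAt.const_mul ?_ _
        refine DifferentiableAt.comp z (hg _ ?_) (by fun_prop)
        have := hδS ρ hρ
        simp; linarith
      have hGm1 : ∀ z : ℂ, 1 < z.re → z.re < 6 → |z.im| < H + 1 → G z = m z := by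
        intro z h1 h2 h3
        rw [heq z h1 h2 h3]
        simp only [hG]
        congr 1
        refine Finset.sum_congr rfl fun ρ hρ => ?_
        have := hS ρ hρ
        have h4 : b < (z + 1 - ρ).re := by simp; linarith
        rw [hgm _ (by linarith) (Or.inl h4)]
      have hGm : ∀ z : ℂ, σ' < z.re → z.re < 6 → |z.im| < H + 1 → (b < z.re ∨ H < |z.im|) →
          G z = m z := by
        intro z h1 h2 h3 h4
        have h3' := abs_lt.1 h3
        have key : ∀ x u v : ℝ, σ' ≤ x → x ≤ b → -(H+1) ≤ u → v ≤ H + 1 → u < v →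
            (b ≤ x ∨ H ≤ u ∨ v ≤ -H) → x < z.re → u < z.im → z.im < v → G z = m z := by
          intro x u v hx hx' hu hv huv hcase hxz huz hvz
          have hmem : ((2:ℝ) + ((u+v)/2:ℝ) * I : ℂ) ∈
              {z : ℂ | x < z.re ∧ z.re < 6 ∧ u < z.im ∧ z.im < v} := by
            simp; refine ⟨?_, ?_, ?_, ?_⟩ <;> linarith
          refine ident_convex (open_box x 6 u v) (convex_box x 6 u v)
            (z0 := (2:ℝ) + ((u+v)/2:ℝ) * I) ?_ ?_ hmem ?_ ⟨hxz, h2, huz, hvz⟩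
          · intro w hw
            exact hGd w (by linarith [hw.1]) hw.2.1
              (abs_lt.2 ⟨by linarith [hw.2.2.1], by linarith [hw.2.2.2]⟩)
          · intro w hw
            refine hm w fun h => ?_
            have := abs_le.1 h.2.2
            rcases hcase with h' | h' | h'
            · linarith [hw.1, h.2.1]
            · linarith [hw.2.2.1]
            · linarith [hw.2.2.2]
          · filter_upwards [(open_box 1 6 u v).mem_nhds
              (x := (2:ℝ) + ((u+v)/2:ℝ) * I) (by
                have := hmem; simp at this ⊢; exact this.2)] with w hw
            exact hGm1 w hw.1 hw.2.1
              (abs_lt.2 ⟨by linarith [hw.2.2.1], by linarith [hw.2.2.2]⟩)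
        rcases h4 with h4 | h4
        · exact key b (-(H+1)) (H+1) hs3 le_rfl le_rfl le_rfl (by linarith) (Or.inl le_rfl) h4
            h3'.1 h3'.2
        · rcases lt_abs.1 h4 with h4 | h4
          · exact key σ' H (H+1) le_rfl hs3 (by linarith) le_rfl (by linarith)
              (Or.inr (Or.inl le_rfl)) h1 h4 h3'.2
          · exact key σ' (-(H+1)) (-H) le_rfl hs3 le_rfl (by linarith) (by linarith)
              (Or.inr (Or.inr le_rfl)) h1 h3'.1 (by linarith)
      classical
      set g' : ℂ → ℂ := fun z => if z.re < 2 ∧ |z.im| < H + 1 then G z else m z with hg'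
      have hgm' : ∀ z : ℂ, σ' < z.re → (b < z.re ∨ H < |z.im|) → g' z = m z := by
        intro z h1 h2
        simp only [hg']
        split_ifs with h
        · exact hGm z h1 (by linarith [h.1]) h.2 h2
        · rfl
      refine ⟨g', fun z hz => ?_, hgm'⟩
      by_cases hcase : b < z.re ∨ H < |z.im|
      · refine (hm z fun h => ?_).congr_of_eventuallyEq ?_
        · rcases hcase with h' | h' <;> linarith [h.2.1, h.2.2]
        · have ho : IsOpen {z : ℂ | σ' < z.re ∧ (b < z.re ∨ H < |z.im|)} :=
            (isOpen_lt continuous_const continuous_re).inter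
              ((isOpen_lt continuous_const continuous_re).union
                (isOpen_lt continuous_const continuous_im.abs))
          filter_upwards [ho.mem_nhds ⟨hz, hcase⟩] with w hw using hgm' w hw.1 hw.2
      · push Not at hcase
        refine (hGd z hz (by linarith) (by linarith)).congr_of_eventuallyEq ?_
        have ho : IsOpen {z : ℂ | z.re < 2 ∧ |z.im| < H + 1} :=
          (isOpen_lt continuous_re continuous_const).inter
            (isOpen_lt continuous_im.abs continuous_const)
        filter_upwards [ho.mem_nhds (x := z) ⟨by linarith, by linarith⟩] with w hw
        simp only [hg']; rw [if_pos hw]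
  obtain ⟨n, hn⟩ := exists_nat_ge (b / δ)
  obtain ⟨g, hg, hgm⟩ := main n
  rw [div_le_iff₀ hδ] at hn
  rw [max_eq_right (by linarith)] at hg hgm
  have hstrip : ∀ z : ℂ, a/2 < z.re → z.re < a → m z = g z := by
    intro z h1 h2
    have hmem : ((3*a/4:ℝ) + (H+1:ℝ) * I : ℂ) ∈ {z : ℂ | a/2 < z.re ∧ z.re < a} := by
      simp; constructor <;> linarith
    have hmem2 : ((3*a/4:ℝ) + (H+1:ℝ) * I : ℂ) ∈
        {z : ℂ | a/2 < z.re ∧ z.re < a ∧ H < z.im ∧ z.im < H + 2} := by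
      simp; refine ⟨?_, ?_⟩ <;> linarith
    refine ident_convex (U := {z : ℂ | a/2 < z.re ∧ z.re < a})
      ((isOpen_lt continuous_const continuous_re).inter (isOpen_lt continuous_re continuous_const))
      ((convex_halfSpace_re_gt _).inter (convex_halfSpace_re_lt a)) ?_ ?_ hmem ?_ ⟨h1, h2⟩
    · exact fun w hw => hm w fun h => by linarith [hw.2, h.1]
    · exact fun w hw => hg w hw.1
    · filter_upwards [(open_box (a/2) a H (H+2)).mem_nhds hmem2] with w hw
      exact (hgm w hw.1 (Or.inr (lt_of_lt_of_le hw.2.2.1 (le_abs_self _)))).symm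
  classical
  set e : ℂ → ℂ := fun z => if z.re < a then m z else g z with he
  have hem : ∀ z : ℂ, ¬ (a ≤ z.re ∧ z.re ≤ b ∧ |z.im| ≤ H) → e z = m z := by
    intro z hz
    simp only [he]
    split_ifs with h
    · rfl
    · push Not at h hz
      refine hgm z (by linarith) ?_
      by_cases h2 : z.re ≤ b
      · exact Or.inr (hz h h2)
      · exact Or.inl (not_le.1 h2)
  have hed : Differentiable ℂ e := by
    intro z
    by_cases h : z.re < a
    · refine (hm z fun h' => by linarith [h'.1]).congr_of_eventuallyEq ?_
      filter_upwards [(isOpen_lt continuous_re continuous_const).mem_nhds h] with w hw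
      simp only [he]; rw [if_pos hw]
    · refine (hg z (by linarith)).congr_of_eventuallyEq ?_
      filter_upwards [(isOpen_lt continuous_const continuous_re).mem_nhds
        (show a/2 < z.re by linarith)] with w hw
      simp only [he]
      split_ifs with h2
      · exact hstrip w hw h2
      · rfl
  have het : Tendsto e (cocompact ℂ) (nhds 0) := by
    refine hm0.congr' ?_
    have hc : IsCompact (Set.Icc a b ×ℂ Set.Icc (-H) H) := isCompact_Icc.reProdIm isCompact_Icc
    filter_upwards [hc.compl_mem_cocompact] with w hw
    refine (hem w fun h => hw ?_).symm
    exact ⟨⟨h.1, h.2.1⟩, abs_le.1 h.2.2⟩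
  rw [← hem z hz]
  exact hed.apply_eq_of_tendsto_cocompact z het


open Classical in
noncomputable def LL {R : Set ℂ} [CompactSpace R] (l : C(R, ℂ) →L[ℂ] ℂ) (f : ℂ → ℂ) : ℂ :=
  if h : ContinuousOn f R then l ⟨R.domRestrict f, h.domRestrict⟩ else 0

section
variable {R : Set ℂ} [CompactSpace R] {l : C(R, ℂ) →L[ℂ] ℂ} {f g : ℂ → ℂ}

lemma LL_of (h : ContinuousOn f R) : LL l f = l ⟨R.domRestrict f, h.domRestrict⟩ := dif_pos h

lemma LL_eq (h : ContinuousOn f R) (g : C(R, ℂ)) (e : ∀ z : R, g z = f z) : LL l f = l g := by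
  rw [LL_of h]; congr 1; ext z; exact (e z).symm

lemma LL_congr (e : ∀ z ∈ R, f z = g z) : LL l f = LL l g := by
  by_cases h : ContinuousOn g R
  · rw [LL_eq (h.congr e) _ (fun z => ?_), ← LL_of h]; exact (e z z.2).symm
  · rw [LL, LL, dif_neg h, dif_neg (fun h' => h (h'.congr fun z hz => (e z hz).symm))]

lemma LL_add (hf : ContinuousOn f R) (hg : ContinuousOn g R) :
    LL l (fun z => f z + g z) = LL l f + LL l g := by
  rw [LL_of hf, LL_of hg, ← map_add]; exact LL_eq (hf.add hg) _ fun z => rfl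

lemma LL_smul (c : ℂ) (hf : ContinuousOn f R) : LL l (fun z => c * f z) = c * LL l f := by
  rw [LL_of hf, ← smul_eq_mul, ← map_smul]
  exact LL_eq (continuousOn_const.mul hf) _ fun z => rfl

lemma LL_sub (hf : ContinuousOn f R) (hg : ContinuousOn g R) :
    LL l (fun z => f z - g z) = LL l f - LL l g := by
  rw [LL_of hf, LL_of hg, ← map_sub]; exact LL_eq (hf.sub hg) _ fun z => rfl

lemma LL_sum {ι : Type*} (S : Finset ι) {F : ι → ℂ → ℂ} (h : ∀ i ∈ S, ContinuousOn (F i) R) :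
    LL l (fun z => ∑ i ∈ S, F i z) = ∑ i ∈ S, LL l (F i) := by
  classical
  induction S using Finset.induction_on with
  | empty =>
    simp only [Finset.sum_empty]
    have := LL_smul (l := l) 0 (f := fun _ => (0:ℂ)) continuousOn_const
    simpa using this
  | insert a s ha ih =>
    have h1 := h a (Finset.mem_insert_self _ _)
    have h2 : ∀ i ∈ s, ContinuousOn (F i) R := fun i hi => h i (Finset.mem_insert_of_mem hi)
    simp only [Finset.sum_insert ha]
    rw [LL_add h1 (continuousOn_finsetSum _ h2), ih h2]

lemma LL_norm {C : ℝ} (hC : 0 ≤ C) (h : ∀ z ∈ R, ‖f z‖ ≤ C) : ‖LL l f‖ ≤ ‖l‖ * C := by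
  by_cases hf : ContinuousOn f R
  · rw [LL_of hf]
    refine (l.le_opNorm _).trans ?_
    gcongr
    exact (ContinuousMap.norm_le _ hC).2 fun z => h z z.2
  · rw [LL, dif_neg hf, norm_zero]; positivity

lemma LL_tsum {ι : Type*} {F : ι → ℂ → ℂ} {u : ι → ℝ} (hF : ∀ i, ContinuousOn (F i) R)
    (hu : Summable u) (hb : ∀ i, ∀ z ∈ R, ‖F i z‖ ≤ u i) :
    LL l (fun z => ∑' i, F i z) = ∑' i, LL l (F i) := by
  have hu0 : ∀ i, ∀ z ∈ R, 0 ≤ u i := fun i z hz => (norm_nonneg _).trans (hb i z hz)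
  have hs : Summable fun i => (⟨R.domRestrict (F i), (hF i).domRestrict⟩ : C(R, ℂ)) := by
    refine Summable.of_norm_bounded hu.abs fun i => (ContinuousMap.norm_le _ (abs_nonneg _)).2 ?_
    intro z
    exact (hb i z z.2).trans (le_abs_self _)
  have hc : ContinuousOn (fun z => ∑' i, F i z) R := continuousOn_tsum hF hu hb
  rw [LL_eq hc (∑' i, ⟨R.domRestrict (F i), (hF i).domRestrict⟩), l.map_tsum hs]
  · exact tsum_congr fun i => (LL_of (hF i)).symm
  · intro z
    exact (ContinuousMap.tsum_apply hs z).symm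

lemma LL_diff {φ : ℂ → ℂ} {V : Set ℂ} (hV : IsOpen V) (hφ : DifferentiableOn ℂ φ V) {z : ℂ}
    (hz : ∀ s ∈ R, s + z ∈ V) : DifferentiableAt ℂ (fun z => LL l (fun s => φ (s + z))) z := by
  have hRc : IsCompact R := isCompact_iff_compactSpace.2 inferInstance
  have hK : IsCompact ((fun s => s + z) '' R) := hRc.image (by fun_prop)
  obtain ⟨δ, hδ, hδV⟩ := hK.exists_cthickening_subset_open hV
    (by rintro _ ⟨s, hs, rfl⟩; exact hz s hs)
  have hd : ContinuousOn (deriv φ) (Metric.cthickening δ ((fun s => s + z) '' R)) :=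
    (hφ.deriv hV).continuousOn.mono hδV
  have huc := hK.cthickening.uniformContinuousOn_of_continuous hd
  have hin : ∀ s ∈ R, ∀ t : ℂ, ‖t‖ ≤ δ → s + z + t ∈ Metric.cthickening δ ((fun s => s + z) '' R) := by
    intro s hs t ht
    refine Metric.mem_cthickening_of_dist_le _ (s + z) _ _ ⟨s, hs, rfl⟩ ?_
    simpa [dist_eq_norm] using ht
  have hcont : ∀ t : ℂ, ‖t‖ ≤ δ → ContinuousOn (fun s => φ (s + (z + t))) R := by
    intro t ht
    refine hφ.continuousOn.comp (by fun_prop) fun s hs => hδV ?_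
    rw [← add_assoc]; exact hin s hs t ht
  have hcont' : ContinuousOn (fun s => deriv φ (s + z)) R :=
    hd.comp (by fun_prop) fun s hs => by simpa using hin s hs 0 (by simpa using hδ.le)
  refine HasDerivAt.differentiableAt (f' := LL l (fun s => deriv φ (s + z))) ?_
  rw [hasDerivAt_iff_isLittleO_nhds_zero, Asymptotics.isLittleO_iff]
  intro c hc
  obtain ⟨η, hη, hη2⟩ := Metric.uniformContinuousOn_iff.1 huc (c / (‖l‖ + 1)) (by positivity)
  filter_upwards [Metric.ball_mem_nhds (0:ℂ) (lt_min hη hδ)] with t ht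
  rw [mem_ball_zero_iff, lt_min_iff] at ht
  have h0 := hcont 0 (by simpa using hδ.le)
  simp only [add_zero] at h0
  have e1 : LL l (fun s => φ (s + (z + t))) - LL l (fun s => φ (s + z)) -
      t • LL l (fun s => deriv φ (s + z)) =
      LL l (fun s => φ (s + (z + t)) - φ (s + z) - t * deriv φ (s + z)) := by
    rw [LL_sub ((hcont t ht.2.le).fun_sub h0) (continuousOn_const.fun_mul hcont'),
      LL_sub (hcont t ht.2.le) h0, LL_smul t hcont', smul_eq_mul]
  rw [e1]
  have hb : ∀ s ∈ R, ‖φ (s + (z + t)) - φ (s + z) - t * deriv φ (s + z)‖ ≤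
      c / (‖l‖ + 1) * ‖t‖ := by
    intro s hs
    have h1 : ∀ x ∈ Metric.ball (0:ℂ) (min η δ), HasDerivWithinAt
        (fun x => φ (s + z + x) - x * deriv φ (s + z))
        (deriv φ (s + z + x) - deriv φ (s + z)) (Metric.ball (0:ℂ) (min η δ)) x := by
      intro x hx
      rw [mem_ball_zero_iff, lt_min_iff] at hx
      have h3 := (hφ.differentiableAt (hV.mem_nhds (hδV (hin s hs x hx.2.le)))).hasDerivAt
      have h4 := (h3.comp_const_add (s + z) x).sub
        ((hasDerivAt_id x).mul_const (deriv φ (s + z)))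
      rw [one_mul] at h4
      exact h4.hasDerivWithinAt
    have h2 := (convex_ball (0:ℂ) (min η δ)).norm_image_sub_le_of_norm_hasDerivWithin_le
      (C := c / (‖l‖ + 1)) (x := 0) (y := t) h1 ?_ (by simp [hη, hδ]) (by simpa using ht)
    · simp only [add_zero, zero_mul, sub_zero] at h2
      refine le_trans (le_of_eq ?_) h2
      congr 1; rw [add_assoc]; ring
    · intro x hx
      rw [mem_ball_zero_iff, lt_min_iff] at hx
      have := hη2 (s + z + x) (hin s hs x hx.2.le) (s + z)
        (by simpa using hin s hs 0 (by simpa using hδ.le)) (by simpa [dist_eq_norm] using hx.1)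
      rw [dist_eq_norm] at this
      exact this.le
  refine (LL_norm (by positivity) hb).trans ?_
  rw [div_mul_eq_mul_div, ← mul_div_assoc, div_le_iff₀ (by positivity)]
  nlinarith [norm_nonneg l, norm_nonneg t, mul_nonneg hc.le (norm_nonneg t)]

lemma LL_tendsto {q : ℂ → ℂ} (hq : ContinuousOn q R) :
    Tendsto (fun z => LL l (fun s => q s * (1 / (s + z - 1)))) (cocompact ℂ) (nhds 0) := by
  have hRc : IsCompact R := isCompact_iff_compactSpace.2 inferInstance
  obtain ⟨C, hC⟩ := hRc.exists_bound_of_continuousOn (f := fun s => s - 1) (by fun_prop)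
  obtain ⟨D, hD⟩ := hRc.exists_bound_of_continuousOn hq
  have ht : Tendsto (fun z : ℂ => ‖l‖ * (|D| * (‖z‖ - C)⁻¹)) (cocompact ℂ) (nhds 0) := by
    have h1 := (tendsto_inv_atTop_zero.comp
      (tendsto_atTop_add_const_right _ (-C) (tendsto_norm_cocompact_atTop (E := ℂ))))
    have h2 := (h1.const_mul |D|).const_mul ‖l‖
    simpa [sub_eq_add_neg, Function.comp_def] using h2
  refine squeeze_zero_norm' ?_ ht
  filter_upwards [(tendsto_norm_cocompact_atTop (E := ℂ)).eventually_gt_atTop C] with z hz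
  refine LL_norm (mul_nonneg (abs_nonneg _) (inv_nonneg.2 (by linarith))) fun s hs => ?_
  rw [norm_mul, norm_div, norm_one, one_div]
  have h1 : ‖z‖ - C ≤ ‖s + z - 1‖ := by
    have := norm_sub_norm_le z (-(s-1))
    rw [norm_neg] at this
    have h3 := hC s hs
    calc ‖z‖ - C ≤ ‖z - -(s-1)‖ := by linarith
      _ = _ := by congr 1; ring
  have h4 : 0 < ‖z‖ - C := by linarith
  gcongr
  exact (hD s hs).trans (le_abs_self _)

end

theorem core {σ0 σ1 H : ℝ} (h0 : 1/2 < σ0) (h01 : σ0 < σ1) (h1 : σ1 < 1) (hH : 0 < H)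
    {R : Set ℂ} [CompactSpace R] (hR : R = Set.Icc σ0 σ1 ×ℂ Set.Icc (-H) H)
    (l : C(R, ℂ) →L[ℂ] ℂ)
    (hs : Summable fun p : Nat.Primes => Real.log p * ‖LL l (fun s => ((p:ℕ):ℂ) ^ (-s))‖) (k : ℕ) :
    LL l (fun s => s ^ k) = 0 := by
  have hmem : ∀ s ∈ R, σ0 ≤ s.re ∧ s.re ≤ σ1 ∧ |s.im| ≤ H := by
    intro s hs
    rw [hR] at hs
    exact ⟨hs.1.1, hs.1.2, abs_le.2 hs.2⟩
  set m : ℂ → ℂ := fun z => LL l (fun s => 1 / (s + z - 1)) with hmdef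
  have hne : ∀ z : ℂ, ¬ (1 - σ1 ≤ z.re ∧ z.re ≤ 1 - σ0 ∧ |z.im| ≤ H) → ∀ s ∈ R, s + z ≠ 1 := by
    intro z hz s hs h
    apply hz
    have := hmem s hs
    have hz' : z = 1 - s := by linear_combination h
    rw [hz']
    simp only [sub_re, one_re, sub_im, one_im, zero_sub, abs_neg]
    exact ⟨by linarith, by linarith, this.2.2⟩
  have hcp : ∀ p : Nat.Primes, Continuous fun s : ℂ => ((p:ℕ):ℂ) ^ (-s) := fun p =>
    continuous_iff_continuousAt.2 fun z => (hasDeriv_pu p z).continuousAt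
  have hm : ∀ z : ℂ, ¬ (1 - σ1 ≤ z.re ∧ z.re ≤ 1 - σ0 ∧ |z.im| ≤ H) → DifferentiableAt ℂ m z := by
    intro z hz
    refine LL_diff (φ := fun w => 1 / (w - 1)) (V := {1}ᶜ) isOpen_compl_singleton ?_ (hne z hz)
    intro w hw
    have hw' : w - 1 ≠ 0 := sub_ne_zero.2 hw
    fun_prop (disch := assumption)
  obtain ⟨S, μ, h, hS, hhd, hheq⟩ := arith (H := 2 * H + 2) (by linarith)
  set A : ℂ → ℂ := fun z => ∑' p : Nat.Primes,
    (Real.log p * LL l (fun s => ((p:ℕ):ℂ) ^ (-s))) * ((p:ℕ):ℂ) ^ (-z) with hA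
  have hAd : ∀ z : ℂ, 0 < z.re → DifferentiableAt ℂ A z := by
    intro z hz
    have ho : IsOpen {z : ℂ | 0 < z.re} := isOpen_lt continuous_const continuous_re
    refine (differentiableOn_tsum_of_summable_norm hs (fun p w hw => ?_) ho
      (fun p w hw => ?_)).differentiableAt (ho.mem_nhds hz)
    · exact ((hasDeriv_pu p w).differentiableAt.const_mul _).differentiableWithinAt
    · rw [norm_mul, norm_mul, norm_pu, Complex.norm_real,
        Real.norm_of_nonneg (Real.log_natCast_nonneg _)]
      refine mul_le_of_le_one_right (by positivity) ?_
      refine Real.rpow_le_one_of_one_le_of_nonpos (by exact_mod_cast p.2.one_le) ?_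
      have : 0 < w.re := hw
      linarith
  set q : ℂ → ℂ := fun z => LL l (fun s => h (s + z)) with hq
  have hVo := open_box (1/2) 8 (-(2*H+2)) (2*H+2)
  have hhd' : DifferentiableOn ℂ h
      {z : ℂ | 1/2 < z.re ∧ z.re < 8 ∧ -(2*H+2) < z.im ∧ z.im < 2*H+2} := fun w hw =>
    (hhd w hw.1 hw.2.1 (abs_lt.2 hw.2.2)).differentiableWithinAt
  have hVin : ∀ z : ℂ, 0 < z.re → z.re < 6 → |z.im| < H + 1 → ∀ s ∈ R, s + z ∈
      {z : ℂ | 1/2 < z.re ∧ z.re < 8 ∧ -(2*H+2) < z.im ∧ z.im < 2*H+2} := by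
    intro z h2 h3 h4 s hs
    have h5 := hmem s hs
    have h6 := abs_le.1 h5.2.2
    have h7 := abs_lt.1 h4
    simp only [Set.mem_ofPred_eq, add_re, add_im]
    refine ⟨?_, ?_, ?_, ?_⟩ <;> linarith
  have hzero : ∀ z : ℂ, ¬ (1 - σ1 ≤ z.re ∧ z.re ≤ 1 - σ0 ∧ |z.im| ≤ H) → m z = 0 := by
    intro z hz
    refine boot (B := fun z => A z + q z) (S := S) (μ := μ) (by linarith) (by linarith)
      (by linarith) hH hS hm ?_ ?_ ?_ hz
    · have := LL_tendsto (l := l) (q := fun _ => 1) continuousOn_const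
      simpa only [one_mul] using this
    · intro z h2 h3 h4
      exact (hAd z h2).add (LL_diff hVo hhd' (hVin z h2 h3 h4))
    · intro z h2 h3 h4
      have e1 : LL l (fun s => ∑' p : Nat.Primes, (Real.log p : ℂ) * ((p:ℕ):ℂ) ^ (-(s + z)))
          = A z := by
        rw [LL_tsum (u := fun p : Nat.Primes => Real.log p * (p:ℝ) ^ (-z.re))]
        · refine tsum_congr fun p => ?_
          have hp : ((p:ℕ):ℂ) ≠ 0 := by exact_mod_cast p.2.ne_zero
          rw [mul_right_comm, ← LL_smul _ (hcp p).continuousOn]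
          refine LL_congr fun s _ => ?_
          rw [neg_add, cpow_add _ _ hp]; ring
        · intro p
          exact (continuous_const.mul ((hcp p).comp (continuous_add_const z))).continuousOn
        · exact sum_logp h2
        · intro p s hs
          rw [norm_mul, norm_pu, Complex.norm_real,
            Real.norm_of_nonneg (Real.log_natCast_nonneg _)]
          have h6 := Real.log_natCast_nonneg p
          refine mul_le_mul_of_nonneg_left (Real.rpow_le_rpow_of_exponent_le
            (by exact_mod_cast p.2.one_le) ?_) h6
          have := hmem s hs
          rw [add_re]; linarith
      have hcc : ∀ w : ℂ, w.re ≤ 1 → ContinuousOn (fun s => 1 / (s + z - w)) R := by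
        intro w hw
        refine ContinuousOn.div continuousOn_const (by fun_prop) fun s hs h0 => ?_
        have h7 := congrArg Complex.re h0
        have := hmem s hs
        simp at h7; linarith
      have hch : ContinuousOn (fun s => h (s + z)) R :=
        hhd'.continuousOn.comp (by fun_prop) (hVin z (by linarith) h3 h4)
      have hcs : ContinuousOn (fun s => ∑ ρ ∈ S, μ ρ * (1 / (s + z - ρ))) R :=
        continuousOn_finsetSum _ fun ρ hρ => continuousOn_const.mul (hcc ρ (hS ρ hρ).le)
      have e2 : LL l (fun s => ∑' p : Nat.Primes, (Real.log p : ℂ) * ((p:ℕ):ℂ) ^ (-(s + z)))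
          = m z - ∑ ρ ∈ S, μ ρ * m (z + 1 - ρ) - q z := by
        have e3 : LL l (fun s => ∑' p : Nat.Primes, (Real.log p : ℂ) * ((p:ℕ):ℂ) ^ (-(s + z)))
            = LL l (fun s => 1 / (s + z - 1) - ∑ ρ ∈ S, μ ρ * (1 / (s + z - ρ)) - h (s + z)) := by
          refine LL_congr fun s hs => ?_
          have h5 := hVin z (by linarith) h3 h4 s hs
          rw [hheq (s + z) (by have := hmem s hs; simp; linarith) h5.2.1 (abs_lt.2 h5.2.2)]
          simp [div_eq_mul_inv]
        rw [e3, LL_sub ((hcc 1 (by simp)).fun_sub hcs) hch, LL_sub (hcc 1 (by simp)) hcs, LL_sum]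
        · congr 2
          refine Finset.sum_congr rfl fun ρ hρ => ?_
          rw [LL_smul _ (hcc ρ (hS ρ hρ).le)]
          congr 1
          refine LL_congr fun s _ => ?_
          congr 1; ring
        · exact fun ρ hρ => continuousOn_const.mul (hcc ρ (hS ρ hρ).le)
      rw [e1] at e2
      simp only [e2]; ring
  have hc1 : ∀ z : ℂ, ¬ (1 - σ1 ≤ z.re ∧ z.re ≤ 1 - σ0 ∧ |z.im| ≤ H) → ∀ k : ℕ,
      ContinuousOn (fun s => s ^ k * (1 / (s + z - 1))) R := by
    intro z hz k
    refine ContinuousOn.mul (by fun_prop) (continuousOn_const.div (by fun_prop) fun s hs => ?_)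
    exact sub_ne_zero.2 (hne z hz s hs)
  have hstep : ∀ z : ℂ, ¬ (1 - σ1 ≤ z.re ∧ z.re ≤ 1 - σ0 ∧ |z.im| ≤ H) → ∀ k : ℕ,
      LL l (fun s => s ^ (k+1) * (1 / (s + z - 1))) =
        LL l (fun s => s ^ k) - (z - 1) * LL l (fun s => s ^ k * (1 / (s + z - 1))) := by
    intro z hz k
    rw [← LL_smul _ (hc1 z hz k), ← LL_sub (f := fun s => s ^ k) (by fun_prop) (continuousOn_const.fun_mul (hc1 z hz k))]
    refine LL_congr fun s hs => ?_
    have := sub_ne_zero.2 (hne z hz s hs)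
    field_simp; ring
  have hev : ∀ᶠ z in cocompact ℂ, ¬ (1 - σ1 ≤ z.re ∧ z.re ≤ 1 - σ0 ∧ |z.im| ≤ H) := by
    have hc : IsCompact (Set.Icc (1 - σ1) (1 - σ0) ×ℂ Set.Icc (-H) H) :=
      isCompact_Icc.reProdIm isCompact_Icc
    filter_upwards [hc.compl_mem_cocompact] with w hw h
    exact hw ⟨⟨h.1, h.2.1⟩, abs_le.1 h.2.2⟩
  have hzk : ∀ k : ℕ, (∀ z : ℂ, ¬ (1 - σ1 ≤ z.re ∧ z.re ≤ 1 - σ0 ∧ |z.im| ≤ H) →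
      LL l (fun s => s ^ k * (1 / (s + z - 1))) = 0) → LL l (fun s => s ^ k) = 0 := by
    intro k hk
    have ht := LL_tendsto (l := l) (q := fun s => s ^ (k+1)) (by fun_prop)
    refine tendsto_nhds_unique (tendsto_const_nhds.congr' ?_) ht
    filter_upwards [hev] with z hz
    rw [hstep z hz k, hk z hz]; ring
  have hall : ∀ k : ℕ, ∀ z : ℂ, ¬ (1 - σ1 ≤ z.re ∧ z.re ≤ 1 - σ0 ∧ |z.im| ≤ H) →
      LL l (fun s => s ^ k * (1 / (s + z - 1))) = 0 := by
    intro k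
    induction k with
    | zero => intro z hz; have := hzero z hz; simpa [hmdef] using this
    | succ k ih =>
      intro z hz
      rw [hstep z hz k, ih z hz, hzk k ih]; ring
  exact hzk k (hall k)


def PI (y M : ℕ) : Finset ℕ := (Finset.Ioc y M).filter Nat.Prime

lemma mem_PI {y M p : ℕ} : p ∈ PI y M ↔ y < p ∧ p ≤ M ∧ p.Prime := by
  simp [PI, and_assoc]

lemma PI_cont {p : ℕ} (hp : p.Prime) : Continuous fun s : ℂ => (p:ℂ) ^ (-s) :=
  continuous_iff_continuousAt.2 fun z => (hasDeriv_pu ⟨p, hp⟩ z).continuousAt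

lemma PI_sum {y M M' : ℕ} (h : M ≤ M') {b : ℕ → ℂ} (hb : ∀ p > M, b p = 0) (c : ℕ → ℂ) :
    ∑ p ∈ PI y M', b p * c p = ∑ p ∈ PI y M, b p * c p := by
  symm
  refine Finset.sum_subset (fun p hp => ?_) fun p hp hp' => ?_
  · rw [mem_PI] at hp ⊢; exact ⟨hp.1, hp.2.1.trans h, hp.2.2⟩
  · rw [mem_PI] at hp hp'
    rw [hb p (by by_contra hc; push Not at hc; exact hp' ⟨hp.1, hc, hp.2.2⟩), zero_mul]

theorem density {σ0 σ1 H : ℝ} (h0 : 1/2 < σ0) (h01 : σ0 < σ1) (h1 : σ1 < 1) (hH : 0 < H)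
    {R : Set ℂ} [CompactSpace R] (hR : R = Set.Icc σ0 σ1 ×ℂ Set.Icc (-H) H)
    {G : ℂ → ℂ} (hG : InP R G) (y : ℕ) {ε : ℝ} (hε : 0 < ε) :
    ∃ (M : ℕ) (b : ℕ → ℂ), (∀ p, ‖b p‖ ≤ 1) ∧
      ∀ s ∈ R, ‖G s - ∑ p ∈ PI y M, b p * (Real.log p * (p:ℂ) ^ (-s))‖ < ε := by
  set C : Set C(R, ℂ) := {g | ∃ (M : ℕ) (b : ℕ → ℂ), (∀ p, ‖b p‖ ≤ 1) ∧ (∀ p > M, b p = 0) ∧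
    ∀ s : R, g s = ∑ p ∈ PI y M, b p * (Real.log p * (p:ℂ) ^ (-(s:ℂ)))} with hC
  obtain ⟨g, hg, hgG⟩ := hG
  by_cases hcl : g ∈ closure C
  · obtain ⟨c, ⟨M, b, hb, _, hc⟩, hd⟩ := Metric.mem_closure_iff.1 hcl ε hε
    refine ⟨M, b, hb, fun s hs => ?_⟩
    have h2 := ContinuousMap.dist_apply_le_dist (f := g) (g := c) ⟨s, hs⟩
    rw [hc, hgG, dist_eq_norm] at h2
    exact h2.trans_lt hd
  exfalso
  have hconv : Convex ℝ C := by
    rintro f ⟨M, b, hb, hbz, hf⟩ f' ⟨M', b', hb', hbz', hf'⟩ t t' ht ht' htt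
    refine ⟨max M M', fun p => t * b p + t' * b' p, fun p => ?_, fun p hp => ?_, fun s => ?_⟩
    · calc ‖(t:ℂ) * b p + t' * b' p‖ ≤ ‖(t:ℂ) * b p‖ + ‖(t':ℂ) * b' p‖ := norm_add_le _ _
        _ = t * ‖b p‖ + t' * ‖b' p‖ := by
            rw [norm_mul, norm_mul, Complex.norm_real, Complex.norm_real, Real.norm_of_nonneg ht,
              Real.norm_of_nonneg ht']
        _ ≤ t * 1 + t' * 1 := by gcongr <;> simp [hb, hb']
        _ = 1 := by linarith
    · have hp' : max M M' < p := hp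
      rw [max_lt_iff] at hp'
      simp only [hbz p hp'.1, hbz' p hp'.2]; simp
    · simp only [ContinuousMap.add_apply, ContinuousMap.smul_apply, hf, hf', real_smul]
      rw [← PI_sum (le_max_left M M') hbz, ← PI_sum (le_max_right M M') hbz', Finset.mul_sum,
        Finset.mul_sum, ← Finset.sum_add_distrib]
      exact Finset.sum_congr rfl fun p _ => by ring
  obtain ⟨l, u, hlu, hul⟩ := RCLike.geometric_hahn_banach_closed_point (𝕜 := ℂ)
    hconv.closure isClosed_closure hcl
  have h0C : (0 : C(R, ℂ)) ∈ C := ⟨0, 0, by simp, by simp, fun s => by simp [PI]⟩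
  have hu0 : 0 < u := by simpa using hlu 0 (subset_closure h0C)
  set c : ℕ → ℝ := fun p => Real.log p * ‖LL l (fun s => (p:ℂ) ^ (-s))‖ with hc
  have hc0 : ∀ p, 0 ≤ c p := fun p => mul_nonneg (Real.log_natCast_nonneg _) (norm_nonneg _)
  have hbd : ∀ M, ∑ p ∈ PI y M, c p ≤ u := by
    intro M
    set b : ℕ → ℂ := fun p => if p ≤ M then
      (starRingEnd ℂ) (LL l (fun s => (p:ℂ) ^ (-s))) / ‖LL l (fun s => (p:ℂ) ^ (-s))‖ else 0 with hb
    have hcf : ∀ p ∈ PI y M, ContinuousOn (fun s : ℂ => b p * (Real.log p * (p:ℂ) ^ (-s))) R :=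
      fun p hp => (continuous_const.mul (continuous_const.mul
        (PI_cont (mem_PI.1 hp).2.2))).continuousOn
    have hcs : ContinuousOn (fun s : ℂ => ∑ p ∈ PI y M, b p * (Real.log p * (p:ℂ) ^ (-s))) R :=
      continuousOn_finsetSum _ hcf
    have hmem : (⟨R.domRestrict (fun s : ℂ => ∑ p ∈ PI y M, b p * (Real.log p * (p:ℂ) ^ (-s))),
        hcs.domRestrict⟩ : C(R, ℂ)) ∈ C := by
      refine ⟨M, b, fun p => ?_, fun p hp => ?_, fun s => rfl⟩
      · simp only [hb]
        split_ifs
        · rw [norm_div, RCLike.norm_conj, Complex.norm_real, norm_norm]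
          exact div_self_le_one _
        · simp
      · simp only [hb]; rw [if_neg (not_le.2 hp)]
    have := hlu _ (subset_closure hmem)
    · rw [← LL_of hcs, LL_sum _ hcf] at this
      refine le_trans (le_of_eq ?_) this.le
      rw [map_sum]
      refine Finset.sum_congr rfl fun p hp => ?_
      have hp' := mem_PI.1 hp
      have e1 : LL l (fun s : ℂ => b p * (Real.log p * (p:ℂ) ^ (-s))) =
          b p * (Real.log p * LL l (fun s => (p:ℂ) ^ (-s))) := by
        have hq : ContinuousOn (fun s : ℂ => (Real.log p : ℂ) * (p:ℂ) ^ (-s)) R :=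
          (continuous_const.mul (PI_cont hp'.2.2)).continuousOn
        rw [LL_smul _ hq, LL_smul _ (PI_cont hp'.2.2).continuousOn]
      rw [e1]
      simp only [hb, if_pos hp'.2.1, hc]
      set w := LL l (fun s => (p:ℂ) ^ (-s))
      have e2 : (starRingEnd ℂ) w / (‖w‖:ℂ) * (Real.log p * w) = ((Real.log p * ‖w‖ : ℝ) : ℂ) := by
        by_cases hw : w = 0
        · simp [hw]
        · have : (‖w‖ : ℂ) ≠ 0 := by exact_mod_cast norm_ne_zero_iff.2 hw
          have h3 := Complex.conj_mul' w
          rw [Complex.ofReal_mul, div_mul_eq_mul_div, div_eq_iff this]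
          linear_combination (Real.log p : ℂ) * h3
      rw [e2]; exact (Complex.ofReal_re _).symm
  have hsum : Summable fun p : Nat.Primes => c p := by
    refine summable_of_sum_le (c := ∑ p ∈ PI 0 y, c p + u) (fun p => hc0 p) fun T => ?_
    set emb : Nat.Primes ↪ ℕ := ⟨fun p => (p:ℕ), Nat.Primes.coe_nat_injective⟩ with hemb
    have e1 : ∑ p ∈ T, c p = ∑ p ∈ T.map emb, c p := by
      rw [Finset.sum_map]; rfl
    set M := (T.map emb).sup (fun p : ℕ => p) with hM
    have hsub : T.map emb ⊆ PI 0 y ∪ PI y M := by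
      intro p hp
      have hpM : p ≤ M := Finset.le_sup (f := fun p : ℕ => p) hp
      obtain ⟨q, hq, rfl⟩ := Finset.mem_map.1 hp
      rw [Finset.mem_union, mem_PI, mem_PI]
      have hq' : (q:ℕ).Prime := q.2
      by_cases h : (q:ℕ) ≤ y
      · exact Or.inl ⟨hq'.pos, h, hq'⟩
      · exact Or.inr ⟨not_le.1 h, hpM, hq'⟩
    rw [e1]
    refine (Finset.sum_le_sum_of_subset_of_nonneg hsub fun p _ _ => hc0 p).trans ?_
    have hdis : Disjoint (PI 0 y) (PI y M) := by
      rw [Finset.disjoint_left]; intro p hp hp'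
      rw [mem_PI] at hp hp'; omega
    rw [Finset.sum_union hdis]
    have := hbd M
    linarith
  have hker : ∀ f ∈ (polynomialFunctions R).topologicalClosure, l f = 0 := by
    have hcl : IsClosed {f : C(R, ℂ) | l f = 0} := isClosed_eq l.continuous continuous_const
    intro f hf
    rw [← SetLike.mem_coe, Subalgebra.topologicalClosure_coe] at hf
    refine closure_minimal ?_ hcl hf
    rw [polynomialFunctions_coe]
    rintro _ ⟨p, rfl⟩
    have e1 : l (Polynomial.toContinuousMapOn p R) = LL l (fun s => p.eval s) :=
      (LL_eq (by fun_prop) _ fun z => by simp).symm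
    change l (Polynomial.toContinuousMapOn p R) = 0
    rw [e1]
    simp only [Polynomial.eval_eq_sum_range]
    rw [LL_sum _ fun i _ => by fun_prop]
    refine Finset.sum_eq_zero fun i _ => ?_
    rw [LL_smul _ (by fun_prop), core h0 h01 h1 hH hR l hsum i, mul_zero]
  rw [hker g hg] at hul
  simp at hul
  linarith


def HM (f : ℝ → ℂ) (c : ℂ) : Prop :=
  Continuous f ∧ Tendsto (fun T : ℝ => (∫ τ in (-T)..T, f τ) / (2 * T)) atTop (nhds c)

lemma HM.congr {f g : ℝ → ℂ} {c : ℂ} (h : HM f c) (e : ∀ τ, g τ = f τ) : HM g c := by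
  rwa [funext e]

lemma HM.sum {ι : Type*} (s : Finset ι) {f : ι → ℝ → ℂ} {c : ι → ℂ} (h : ∀ i ∈ s, HM (f i) (c i)) :
    HM (fun τ => ∑ i ∈ s, f i τ) (∑ i ∈ s, c i) := by
  refine ⟨continuous_finsetSum _ fun i hi => (h i hi).1, ?_⟩
  refine (tendsto_finsetSum _ fun i hi => (h i hi).2).congr fun T => ?_
  rw [intervalIntegral.integral_finsetSum fun i hi => (h i hi).1.intervalIntegrable _ _,
    Finset.sum_div]

lemma HM.smul {f : ℝ → ℂ} {c : ℂ} (h : HM f c) (a : ℂ) : HM (fun τ => a * f τ) (a * c) := by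
  refine ⟨continuous_const.mul h.1, (h.2.const_mul a).congr fun T => ?_⟩
  rw [intervalIntegral.integral_const_mul, mul_div_assoc]

lemma HM_exp (l : ℝ) : HM (fun τ => exp (I * (τ * l))) (if l = 0 then 1 else 0) := by
  refine ⟨by fun_prop, ?_⟩
  split_ifs with h
  · refine tendsto_const_nhds.congr' ?_
    filter_upwards [eventually_gt_atTop 0] with T hT
    have : (T:ℂ) ≠ 0 := by exact_mod_cast hT.ne'
    simp only [h, ofReal_zero, mul_zero, Complex.exp_zero, intervalIntegral.integral_const,
      real_smul]
    push_cast
    field_simp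
    ring
  · have hl : (I * l : ℂ) ≠ 0 := mul_ne_zero I_ne_zero (by exact_mod_cast h)
    have e : ∀ T : ℝ, ∫ τ in (-T)..T, exp (I * (τ * l)) =
        (exp (I * l * T) - exp (I * l * ((-T : ℝ):ℂ))) / (I * l) := fun T => by
      rw [← integral_exp_mul_complex hl]
      congr 1; ext τ; ring_nf
    refine squeeze_zero_norm' (a := fun T => (1 / |l|) / T) ?_
      (tendsto_const_nhds.div_atTop tendsto_id)
    filter_upwards [eventually_gt_atTop 0] with T hT
    have hn : ∀ t : ℝ, ‖exp (I * l * t)‖ = 1 := fun t => by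
      rw [show I * (l:ℂ) * t = ((l * t : ℝ) : ℂ) * I by push_cast; ring, norm_exp_ofReal_mul_I]
    rw [e, norm_div, norm_div, norm_mul, norm_mul, norm_I, Complex.norm_real, Complex.norm_real,
      Real.norm_of_nonneg hT.le, one_mul, Real.norm_eq_abs]
    have h2 : ‖exp (I * l * T) - exp (I * l * ((-T : ℝ):ℂ))‖ ≤ 2 :=
      (norm_sub_le _ _).trans (by rw [hn, hn]; norm_num)
    rw [Complex.norm_ofNat]
    have : 0 < |l| := abs_pos.2 h
    calc _ ≤ 2 / |l| / (2 * T) := by gcongr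
      _ = _ := by field_simp

noncomputable def uu (p : ℕ) (τ : ℝ) : ℂ := exp (-(I * (τ * Real.log p)))

lemma norm_uu (p : ℕ) (τ : ℝ) : ‖uu p τ‖ = 1 := by
  rw [uu, show -(I * (τ * Real.log p) : ℂ) = ((-(τ * Real.log p) : ℝ) : ℂ) * I by push_cast; ring,
    norm_exp_ofReal_mul_I]

lemma uu_cpow {p : ℕ} (hp : p ≠ 0) (s : ℂ) (τ : ℝ) :
    (p:ℂ) ^ (-(s + I * τ)) = uu p τ * (p:ℂ) ^ (-s) := by
  have hp' : (p:ℂ) ≠ 0 := by exact_mod_cast hp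
  rw [cpow_def_of_ne_zero hp', cpow_def_of_ne_zero hp', uu, ← Complex.exp_add, ← Complex.natCast_log]
  congr 1; ring

lemma uu_conj (p q : ℕ) (τ : ℝ) : uu p τ * (starRingEnd ℂ) (uu q τ) =
    exp (I * (τ * ((Real.log q - Real.log p : ℝ):ℂ))) := by
  rw [uu, uu, ← Complex.exp_conj, ← Complex.exp_add]
  congr 1
  simp only [map_neg, map_mul, conj_I, conj_ofReal]
  push_cast; ring

noncomputable def ww (S : Finset ℕ) (x : ℕ → ℂ) (m : ℕ) (τ : ℝ) : ℝ := ∏ p ∈ S, (1 - ‖uu p τ - x p‖ ^ 2 / 4) ^ m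

lemma w_factor {x : ℂ} (hx : ‖x‖ = 1) (p m : ℕ) (τ : ℝ) :
    (((1 - ‖uu p τ - x‖ ^ 2 / 4) ^ m : ℝ) : ℂ) = ∑ j ∈ Finset.range (2 * m + 1),
      ((2*m).choose j : ℂ) / 4 ^ m * x ^ m * (x⁻¹) ^ j *
        exp (I * (τ * (((m:ℝ) - j) * Real.log p : ℝ))) := by
  have hx0 : x ≠ 0 := norm_ne_zero_iff.1 (by rw [hx]; norm_num)
  set u := uu p τ with hu
  have hu1 : ‖u‖ = 1 := norm_uu p τ
  have hu0 : u ≠ 0 := norm_ne_zero_iff.1 (by rw [hu1]; norm_num)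
  have e1 : ((1 - ‖u - x‖ ^ 2 / 4 : ℝ) : ℂ) = (1 + u * x⁻¹) ^ 2 * (x * u⁻¹) / 4 := by
    have h1 := Complex.mul_conj' (u - x)
    have hux : u * (starRingEnd ℂ) u = 1 := by rw [Complex.mul_conj', hu1]; simp
    have hxx : x * (starRingEnd ℂ) x = 1 := by rw [Complex.mul_conj', hx]; simp
    have hu' : (starRingEnd ℂ) u = u⁻¹ := eq_inv_of_mul_eq_one_right hux
    have hx' : (starRingEnd ℂ) x = x⁻¹ := eq_inv_of_mul_eq_one_right hxx
    rw [map_sub, hu', hx'] at h1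
    push_cast
    rw [← h1]
    field_simp
    ring
  have e2 : ∀ j : ℕ, exp (I * (τ * (((m:ℝ) - j) * Real.log p : ℝ))) = (u⁻¹) ^ m * u ^ j := by
    intro j
    rw [hu, uu, ← Complex.exp_neg, ← Complex.exp_nat_mul, ← Complex.exp_nat_mul, ← Complex.exp_add]
    congr 1; push_cast; ring
  rw [Complex.ofReal_pow, e1, div_pow, mul_pow, ← pow_mul, add_comm (1:ℂ), add_pow, Finset.sum_mul,
    Finset.sum_div]
  refine Finset.sum_congr rfl fun j _ => ?_
  rw [e2]
  simp only [one_pow, mul_one, mul_pow]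
  ring

lemma HMw (S : Finset ℕ) (hS : ∀ p ∈ S, p.Prime) {x : ℕ → ℂ} (hx : ∀ p, ‖x p‖ = 1) (m : ℕ) :
    ∀ a b : ℕ, a ≠ 0 → b ≠ 0 → (∀ p ∈ S, ¬ p ∣ a ∧ ¬ p ∣ b) →
    HM (fun τ => (ww S x m τ : ℂ) * exp (I * (τ * ((Real.log a - Real.log b : ℝ):ℂ))))
      (if a = b then (((2*m).choose m : ℂ) / 4 ^ m) ^ S.card else 0) := by
  induction S using Finset.induction_on with
  | empty =>
    intro a b ha hb _
    have := HM_exp (Real.log a - Real.log b)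
    have e : (Real.log a - Real.log b = 0) ↔ a = b := by
      rw [sub_eq_zero]
      refine ⟨fun h => ?_, fun h => by rw [h]⟩
      exact_mod_cast Real.log_injOn_pos (show (0:ℝ) < a by positivity)
        (show (0:ℝ) < b by positivity) h
    simp only [e] at this
    simpa [ww] using this
  | insert p S hpS ih =>
    intro a b ha hb hab
    have hp := hS p (Finset.mem_insert_self _ _)
    have ih := ih fun q hq => hS q (Finset.mem_insert_of_mem hq)
    have h1 : ∀ j ∈ Finset.range (2*m+1), HM (fun τ => (((2*m).choose j : ℂ) / 4 ^ m * (x p) ^ m *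
        ((x p)⁻¹) ^ j) * ((ww S x m τ : ℂ) * exp (I * (τ * ((Real.log (a * p ^ (m - j) : ℕ) -
          Real.log (b * p ^ (j - m) : ℕ) : ℝ):ℂ)))))
        ((((2*m).choose j : ℂ) / 4 ^ m * (x p) ^ m * ((x p)⁻¹) ^ j) *
          (if a * p ^ (m - j) = b * p ^ (j - m) then (((2*m).choose m : ℂ) / 4 ^ m) ^ S.card else 0))
        := by
      intro j _
      refine (ih _ _ (mul_ne_zero ha (pow_ne_zero _ hp.ne_zero))
        (mul_ne_zero hb (pow_ne_zero _ hp.ne_zero)) fun q hq => ?_).smul _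
      have hq' := hS q (Finset.mem_insert_of_mem hq)
      have hqp : ¬ q ∣ p := fun h => by
        rw [(Nat.prime_dvd_prime_iff_eq hq' hp).1 h] at hq; exact hpS hq
      have h3 := hab q (Finset.mem_insert_of_mem hq)
      exact ⟨fun h => (hq'.dvd_mul.1 h).elim h3.1 fun h => hqp (hq'.dvd_of_dvd_pow h),
        fun h => (hq'.dvd_mul.1 h).elim h3.2 fun h => hqp (hq'.dvd_of_dvd_pow h)⟩
    have h2 := HM.sum _ h1
    have e1 : ∀ j : ℕ, a * p ^ (m - j) = b * p ^ (j - m) ↔ (j = m ∧ a = b) := by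
      intro j
      have h3 := hab p (Finset.mem_insert_self _ _)
      constructor
      · intro h
        have hj : j = m := by
          rcases lt_trichotomy j m with hlt | heq | hgt
          · exfalso; apply h3.2
            rw [Nat.sub_eq_zero_of_le hlt.le, pow_zero, mul_one] at h
            rw [← h]
            exact Dvd.dvd.mul_left (dvd_pow_self _ (by omega)) _
          · exact heq
          · exfalso; apply h3.1
            rw [Nat.sub_eq_zero_of_le hgt.le, pow_zero, mul_one] at h
            rw [h]
            exact Dvd.dvd.mul_left (dvd_pow_self _ (by omega)) _
        subst hj
        simpa using h
      · rintro ⟨rfl, rfl⟩; rfl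
    have hx0 : x p ≠ 0 := norm_ne_zero_iff.1 (by rw [hx]; norm_num)
    have e2 : ∑ j ∈ Finset.range (2*m+1), ((((2*m).choose j : ℂ) / 4 ^ m * (x p) ^ m *
        ((x p)⁻¹) ^ j) * (if a * p ^ (m - j) = b * p ^ (j - m) then
          (((2*m).choose m : ℂ) / 4 ^ m) ^ S.card else 0)) =
        if a = b then (((2*m).choose m : ℂ) / 4 ^ m) ^ (insert p S).card else 0 := by
      rw [Finset.sum_eq_single m]
      · simp only [e1, true_and, Finset.card_insert_of_notMem hpS, pow_succ]
        split_ifs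
        · rw [inv_pow]
          field_simp
        · simp
      · intro j _ hj
        rw [if_neg (by rw [e1]; tauto), mul_zero]
      · intro h; simp at h; omega
    rw [e2] at h2
    refine h2.congr fun τ => ?_
    rw [ww, Finset.prod_insert hpS, Complex.ofReal_mul, w_factor (hx p), ← ww, Finset.sum_mul,
      Finset.sum_mul]
    refine Finset.sum_congr rfl fun j _ => ?_
    have e3 : exp (I * (τ * ((Real.log (a * p ^ (m - j) : ℕ) -
          Real.log (b * p ^ (j - m) : ℕ) : ℝ):ℂ))) = exp (I * (τ * (((m:ℝ) - j) * Real.log p : ℝ))) *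
          exp (I * (τ * ((Real.log a - Real.log b : ℝ):ℂ))) := by
      rw [← Complex.exp_add, ← mul_add, ← mul_add, ← Complex.ofReal_add]
      congr 4
      have hpr : (p:ℝ) ≠ 0 := by exact_mod_cast hp.ne_zero
      have har : (a:ℝ) ≠ 0 := by exact_mod_cast ha
      have hbr : (b:ℝ) ≠ 0 := by exact_mod_cast hb
      rw [Nat.cast_mul, Nat.cast_mul, Nat.cast_pow, Nat.cast_pow,
        Real.log_mul har (pow_ne_zero _ hpr), Real.log_mul hbr (pow_ne_zero _ hpr), Real.log_pow,
        Real.log_pow]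
      rcases le_total j m with h | h
      · rw [Nat.sub_eq_zero_of_le h, Nat.cast_sub h]; push_cast; ring
      · rw [Nat.sub_eq_zero_of_le h, Nat.cast_sub h]; push_cast; ring
    rw [e3]; ring

lemma ww_factor_mem {x : ℂ} (hx : ‖x‖ = 1) (p : ℕ) (τ : ℝ) :
    0 ≤ 1 - ‖uu p τ - x‖ ^ 2 / 4 ∧ 1 - ‖uu p τ - x‖ ^ 2 / 4 ≤ 1 := by
  have h := norm_sub_le (uu p τ) x
  rw [norm_uu, hx] at h
  constructor <;> nlinarith [norm_nonneg (uu p τ - x)]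

lemma ww_mem (S : Finset ℕ) {x : ℕ → ℂ} (hx : ∀ p, ‖x p‖ = 1) (m : ℕ) (τ : ℝ) :
    0 ≤ ww S x m τ ∧ ww S x m τ ≤ 1 :=
  ⟨Finset.prod_nonneg fun p _ => pow_nonneg (ww_factor_mem (hx p) p τ).1 _,
    Finset.prod_le_one (fun p _ => pow_nonneg (ww_factor_mem (hx p) p τ).1 _)
    fun p _ => pow_le_one₀ (ww_factor_mem (hx p) p τ).1 (ww_factor_mem (hx p) p τ).2⟩

lemma ww_small (S : Finset ℕ) {x : ℕ → ℂ} (hx : ∀ p, ‖x p‖ = 1) (m : ℕ) (τ : ℝ) {δ : ℝ}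
    (hδ : 0 < δ) {p : ℕ} (hp : p ∈ S) (h : δ ≤ ‖uu p τ - x p‖) :
    ww S x m τ ≤ (1 - δ ^ 2 / 4) ^ m := by
  rw [ww, ← Finset.mul_prod_erase S _ hp]
  have h1 : ∏ q ∈ S.erase p, (1 - ‖uu q τ - x q‖ ^ 2 / 4) ^ m ≤ 1 := (ww_mem (S.erase p) hx m τ).2
  have h2 := (ww_factor_mem (hx p) p τ).1
  calc _ ≤ (1 - ‖uu p τ - x p‖ ^ 2 / 4) ^ m * 1 := by gcongr
    _ ≤ _ := by rw [mul_one]; gcongr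


noncomputable def QQ (R : Set ℂ) (h : ℂ → ℂ) : ℝ := ∫ s in R, ‖h s‖ ^ 2

lemma QQ_int {R : Set ℂ} (hR : IsCompact R) {h : ℂ → ℂ} (hh : ContinuousOn h R) :
    IntegrableOn (fun s => ‖h s‖ ^ 2) R :=
  (hh.norm.pow 2).integrableOn_compact hR

lemma QQ_nonneg (R : Set ℂ) (h : ℂ → ℂ) : 0 ≤ QQ R h := integral_nonneg fun s => by positivity

lemma area {R : Set ℂ} (hR : IsCompact R) {h : ℂ → ℂ} (hh : ∀ s ∈ R, DifferentiableAt ℂ h s)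
    {z : ℂ} {δ : ℝ} (hδ : 0 < δ) (hb : Metric.closedBall z δ ⊆ R) :
    ‖h z‖ ^ 2 ≤ (Real.pi * δ ^ 2)⁻¹ * QQ R h := by
  have hd : ∀ w : ℂ, ‖w‖ ≤ δ → DifferentiableAt ℂ (fun w => h (z + w) ^ 2) w := fun w hw => by
    have h1 : DifferentiableAt ℂ h (z + w) := hh _ (hb (by simpa using hw))
    have h2 : DifferentiableAt ℂ (fun w => h (z + w)) w :=
      h1.comp w ((differentiableAt_const z).add differentiableAt_id)
    exact h2.fun_pow 2
  have hco : ContinuousOn (fun w => h (z + w) ^ 2) (Metric.closedBall 0 δ) := fun w hw =>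
    (hd w (by simpa using hw)).continuousAt.continuousWithinAt
  set g : ℂ → ℂ := fun w => if ‖w‖ < δ then h (z + w) ^ 2 else 0 with hg
  have hgi : g = (Metric.ball (0:ℂ) δ).indicator (fun w => h (z + w) ^ 2) := by
    ext w; by_cases hw : ‖w‖ < δ
    · rw [Set.indicator_of_mem (by simpa using hw)]; simp [hg, hw]
    · rw [Set.indicator_of_notMem (by simpa using hw)]; simp [hg, hw]
  have hgm : Measurable g := by
    classical
    rw [hgi, ← Set.piecewise_eq_indicator]
    exact (hco.mono Metric.ball_subset_closedBall).measurable_piecewise continuousOn_const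
      Metric.isOpen_ball.measurableSet
  have hgint : Integrable g := by
    rw [hgi, integrable_indicator_iff Metric.isOpen_ball.measurableSet]
    exact (hco.integrableOn_compact (isCompact_closedBall _ _)).mono_set
      Metric.ball_subset_closedBall
  set g' : ℂ → ℂ := fun w => if ‖w‖ < δ then w * (w⁻¹ * h (z + w) ^ 2) else 0 with hg'
  have hgg : g' = ({0}ᶜ : Set ℂ).indicator g := by
    ext w
    by_cases hw : w = 0
    · simp [hw, hg']
    · rw [Set.indicator_of_mem (by simpa using hw)]
      simp only [hg, hg']
      rw [mul_inv_cancel_left₀ hw]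
  have hae : g' =ᵐ[volume] g := by
    have : ∀ᵐ w : ℂ, w ≠ 0 := by simp [ae_iff]
    filter_upwards [this] with w hw
    rw [hgg, Set.indicator_of_mem (by simpa using hw)]
  have h1 := polar_circ (G := fun w => w⁻¹ * h (z + w) ^ 2) (δ := δ)
    (m := fun _ => 2 * Real.pi * I * h z ^ 2)
    (by change Measurable g'; rw [hgg]; exact hgm.indicator (measurableSet_singleton _).compl)
    (hgint.congr hae.symm) (ae_of_all _ fun ρ h0 h1 => by
      have h2 : DiffContOnCl ℂ (fun w => h (z + w) ^ 2) (Metric.ball 0 ρ) := by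
        refine DifferentiableOn.diffContOnCl fun w hw => ?_
        rw [closure_ball _ h0.ne'] at hw
        exact (hd w (by have : ‖w‖ ≤ ρ := by simpa using hw
                        linarith)).differentiableWithinAt
      have h3 := h2.circleIntegral_sub_inv_smul (w := 0) (by simpa using h0)
      simpa using h3)
  have h2 : ∫ w, g w = Real.pi * δ ^ 2 * h z ^ 2 := by
    rw [← integral_congr_ae hae]
    refine h1.trans ?_
    have e1 : ∀ ρ : ℝ, (if ρ < δ then (ρ:ℂ) * (-I * (2 * Real.pi * I * h z ^ 2)) else 0) =
        (Set.Iio δ).indicator (fun ρ : ℝ => (ρ:ℂ) * (2 * Real.pi * h z ^ 2)) ρ := by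
      intro ρ
      simp only [Set.indicator_apply, Set.mem_Iio]
      split_ifs
      · linear_combination (-(ρ:ℂ) * 2 * Real.pi * h z ^ 2) * I_mul_I
      · rfl
    simp_rw [e1]
    rw [setIntegral_indicator measurableSet_Iio, Set.Ioi_inter_Iio, ← integral_Ioc_eq_integral_Ioo,
      ← intervalIntegral.integral_of_le hδ.le, intervalIntegral.integral_mul_const]
    have : ∫ ρ in (0:ℝ)..δ, (ρ:ℂ) = ((δ ^ 2 / 2 : ℝ) : ℂ) := by
      rw [intervalIntegral.integral_ofReal, integral_id]; congr 1; ring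
    rw [this]; push_cast; ring
  have h3 : ‖∫ w, g w‖ ≤ QQ R h := by
    refine (norm_integral_le_integral_norm _).trans ?_
    have e2 : ∫ w, ‖g w‖ = ∫ v, (Metric.ball z δ).indicator (fun v => ‖h v‖ ^ 2) v := by
      rw [← integral_add_left_eq_self ((Metric.ball z δ).indicator (fun v => ‖h v‖ ^ 2)) z]
      congr 1; ext w
      by_cases hw : ‖w‖ < δ
      · rw [Set.indicator_of_mem (by simpa using hw)]; simp [hg, hw]
      · rw [Set.indicator_of_notMem (by simpa using hw)]; simp [hg, hw]
    rw [e2, integral_indicator Metric.isOpen_ball.measurableSet]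
    refine setIntegral_mono_set (QQ_int hR fun s hs => (hh s hs).continuousAt.continuousWithinAt)
      (ae_of_all _ fun s => by positivity) (Metric.ball_subset_closedBall.trans hb).eventuallyLE
  rw [h2, norm_mul, norm_mul, norm_pow, norm_pow, Complex.norm_real, Complex.norm_real,
    Real.norm_of_nonneg Real.pi_pos.le, Real.norm_of_nonneg hδ.le] at h3
  have : 0 < Real.pi * δ ^ 2 := by positivity
  rw [inv_mul_eq_div, le_div_iff₀ this]
  linarith

lemma area_deriv {R : Set ℂ} (hR : IsCompact R) {h : ℂ → ℂ} (hh : ∀ s ∈ R, DifferentiableAt ℂ h s)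
    {z : ℂ} {δ : ℝ} (hδ : 0 < δ) (hb : Metric.closedBall z (2 * δ) ⊆ R) :
    ‖deriv h z‖ ^ 2 ≤ (Real.pi * δ ^ 2)⁻¹ / δ ^ 2 * QQ R h := by
  set A := (Real.pi * δ ^ 2)⁻¹ * QQ R h with hA
  have hA0 : 0 ≤ A := mul_nonneg (by positivity) (QQ_nonneg _ _)
  have h1 : ‖deriv h z‖ ≤ Real.sqrt A / δ := by
    refine norm_deriv_le_of_forall_mem_sphere_norm_le hδ ?_ fun w hw => ?_
    · refine DifferentiableOn.diffContOnCl fun w hw => ?_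
      rw [closure_ball _ hδ.ne'] at hw
      exact (hh w (hb (Metric.closedBall_subset_closedBall (by linarith) hw))).differentiableWithinAt
    · refine Real.le_sqrt_of_sq_le (area hR hh hδ (fun v hv => hb ?_))
      have := dist_triangle v w z
      rw [Metric.mem_closedBall] at hv ⊢
      rw [Metric.mem_sphere] at hw
      linarith
  calc ‖deriv h z‖ ^ 2 ≤ (Real.sqrt A / δ) ^ 2 := by gcongr
    _ = A / δ ^ 2 := by rw [div_pow, Real.sq_sqrt hA0]
    _ = _ := by rw [hA]; ring

lemma QQ_par {R : Set ℂ} (hR : IsCompact R) {h g : ℂ → ℂ} (hh : ContinuousOn h R)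
    (hg : ContinuousOn g R) : QQ R (fun s => h s + g s) + QQ R (fun s => h s - g s) =
      2 * QQ R h + 2 * QQ R g := by
  have h1 := QQ_int hR (hh.add hg)
  have h2 := QQ_int hR (hh.sub hg)
  have h3 := QQ_int hR hh
  have h4 := QQ_int hR hg
  simp only [QQ]
  rw [← integral_const_mul, ← integral_const_mul, ← integral_add (h3.const_mul 2) (h4.const_mul 2),
    ← integral_add (f := fun s => ‖h s + g s‖ ^ 2) (g := fun s => ‖h s - g s‖ ^ 2) h1 h2]
  congr 1; ext s
  have := parallelogram_law_with_norm ℝ (h s) (g s)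
  simp only [Complex.sq_norm, normSq_apply, add_re, add_im, sub_re, sub_im]
  ring

lemma two_unimod {b : ℂ} (hb : ‖b‖ ≤ 1) : ∃ d : ℂ, ‖d‖ ≤ 1 ∧ ‖b + d‖ = 1 ∧ ‖b - d‖ = 1 := by
  obtain ⟨e, he, hbe⟩ : ∃ e : ℂ, ‖e‖ = 1 ∧ b = ‖b‖ * e := by
    by_cases h : b = 0
    · exact ⟨1, by simp, by simp [h]⟩
    · have h' : (‖b‖ : ℂ) ≠ 0 := by exact_mod_cast norm_ne_zero_iff.2 h
      refine ⟨b / ‖b‖, by rw [norm_div, Complex.norm_real, norm_norm, div_self (norm_ne_zero_iff.2 h)],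
        by field_simp⟩
  set r := ‖b‖ with hr
  have hr0 : 0 ≤ r := norm_nonneg _
  set t := Real.sqrt (1 - r ^ 2) with ht
  have ht2 : t ^ 2 = 1 - r ^ 2 := Real.sq_sqrt (by nlinarith)
  have ht0 : 0 ≤ t := Real.sqrt_nonneg _
  have key : ∀ t' : ℝ, t' ^ 2 = t ^ 2 → ‖((r:ℂ) + t' * I)‖ = 1 := fun t' h => by
    rw [Complex.norm_add_mul_I, h, ht2]; simp
  refine ⟨t * I * e, ?_, ?_, ?_⟩
  · rw [norm_mul, norm_mul, he, norm_I, Complex.norm_real, Real.norm_of_nonneg ht0]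
    nlinarith
  · rw [hbe, ← add_mul, norm_mul, he, mul_one, key t rfl]
  · have := key (-t) (by ring)
    rw [hbe, ← sub_mul, norm_mul, he, mul_one, ← this]
    congr 1; push_cast; ring

lemma QQ_smul (R : Set ℂ) (d : ℂ) (h : ℂ → ℂ) : QQ R (fun s => d * h s) = ‖d‖ ^ 2 * QQ R h := by
  simp only [QQ, norm_mul, mul_pow, integral_const_mul]

lemma greedy {R : Set ℂ} (hR : IsCompact R) (v : ℕ → ℂ → ℂ) {b : ℕ → ℂ} (hb : ∀ p, ‖b p‖ ≤ 1)
    (S : Finset ℕ) (hv : ∀ p ∈ S, ContinuousOn (v p) R) :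
    ∃ x : ℕ → ℂ, (∀ p, ‖x p‖ = 1) ∧ QQ R (fun s => ∑ p ∈ S, (b p - x p) * v p s) ≤
      ∑ p ∈ S, QQ R (v p) := by
  induction S using Finset.induction_on with
  | empty => exact ⟨fun _ => 1, by simp, by simp [QQ]⟩
  | insert p S hpS ih =>
    obtain ⟨x, hx, hQ⟩ := ih fun q hq => hv q (Finset.mem_insert_of_mem hq)
    obtain ⟨d, hd, hd1, hd2⟩ := two_unimod (hb p)
    set f : ℂ → ℂ := fun s => ∑ p ∈ S, (b p - x p) * v p s with hf
    have hfc : ContinuousOn f R := continuousOn_finsetSum _ fun q hq =>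
      continuousOn_const.mul (hv q (Finset.mem_insert_of_mem hq))
    have hvc := hv p (Finset.mem_insert_self _ _)
    have hdc : ContinuousOn (fun s => d * v p s) R := continuousOn_const.mul hvc
    have hpar := QQ_par hR hfc hdc
    rw [QQ_smul] at hpar
    have hd' : ‖d‖ ^ 2 * QQ R (v p) ≤ QQ R (v p) :=
      mul_le_of_le_one_left (QQ_nonneg _ _) (pow_le_one₀ (norm_nonneg _) hd)
    have key : ∀ e : ℂ, ‖b p - e‖ = 1 → QQ R (fun s => f s + e * v p s) ≤ QQ R f + QQ R (v p) →
        ∃ x : ℕ → ℂ, (∀ p, ‖x p‖ = 1) ∧ QQ R (fun s => ∑ p ∈ insert p S, (b p - x p) * v p s) ≤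
          ∑ p ∈ insert p S, QQ R (v p) := by
      intro e he hQe
      refine ⟨Function.update x p (b p - e), fun q => ?_, ?_⟩
      · by_cases hq : q = p
        · rw [hq, Function.update_self, he]
        · rw [Function.update_of_ne hq, hx]
      · rw [Finset.sum_insert hpS]
        have e1 : (fun s => ∑ q ∈ insert p S, (b q - Function.update x p (b p - e) q) * v q s) =
            fun s => f s + e * v p s := by
          ext s
          rw [Finset.sum_insert hpS, Function.update_self, add_comm]
          congr 1
          · refine Finset.sum_congr rfl fun q hq => ?_
            rw [Function.update_of_ne (fun h : q = p => hpS (h ▸ hq))]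
          · ring
        rw [e1]; linarith
    by_cases hc : QQ R (fun s => f s + d * v p s) ≤ QQ R f + QQ R (v p)
    · exact key d hd2 hc
    · refine key (-d) (by rwa [sub_neg_eq_add]) ?_
      have e2 : (fun s => f s + -d * v p s) = fun s => f s - d * v p s := by ext s; ring
      rw [e2]; push Not at hc; linarith


lemma Z_expand {R : Set ℂ} (hR : IsCompact R) (S : Finset ℕ) (v : ℕ → ℂ → ℂ)
    (hv : ∀ p ∈ S, ContinuousOn (v p) R) (τ : ℝ) :
    ((QQ R (fun s => ∑ p ∈ S, uu p τ * v p s) : ℝ) : ℂ) = ∑ p ∈ S, ∑ q ∈ S,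
      (∫ s in R, v p s * (starRingEnd ℂ) (v q s)) * (uu p τ * (starRingEnd ℂ) (uu q τ)) := by
  have hi : ∀ p ∈ S, ∀ q ∈ S, IntegrableOn (fun s => v p s * (starRingEnd ℂ) (v q s) *
      (uu p τ * (starRingEnd ℂ) (uu q τ))) R := fun p hp q hq =>
    (((hv p hp).mul (continuous_conj.comp_continuousOn (hv q hq))).mul
      continuousOn_const).integrableOn_compact hR
  rw [QQ, ← integral_complex_ofReal]
  have e : ∀ s : ℂ, ((‖∑ p ∈ S, uu p τ * v p s‖ ^ 2 : ℝ) : ℂ) = ∑ p ∈ S, ∑ q ∈ S,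
      v p s * (starRingEnd ℂ) (v q s) * (uu p τ * (starRingEnd ℂ) (uu q τ)) := fun s => by
    rw [Complex.ofReal_pow, ← Complex.mul_conj', map_sum, Finset.sum_mul_sum]
    refine Finset.sum_congr rfl fun p _ => Finset.sum_congr rfl fun q _ => ?_
    rw [map_mul]; ring
  simp_rw [e]
  rw [integral_finsetSum _ fun p hp => integrable_finsetSum _ fun q hq => hi p hp q hq]
  refine Finset.sum_congr rfl fun p hp => ?_
  rw [integral_finsetSum _ fun q hq => hi p hp q hq]
  exact Finset.sum_congr rfl fun q _ => integral_mul_const _ _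

lemma HM_Z {R : Set ℂ} (hR : IsCompact R) {S S' : Finset ℕ} (hS : ∀ p ∈ S, p.Prime)
    (hS' : ∀ p ∈ S', p.Prime) (hd : Disjoint S S') {x : ℕ → ℂ} (hx : ∀ p, ‖x p‖ = 1) (m : ℕ)
    (v : ℕ → ℂ → ℂ) (hv : ∀ p ∈ S', ContinuousOn (v p) R) :
    HM (fun τ => ((ww S x m τ * QQ R (fun s => ∑ p ∈ S', uu p τ * v p s) : ℝ) : ℂ))
      (((((2*m).choose m : ℝ) / 4 ^ m) ^ S.card * ∑ p ∈ S', QQ R (v p) : ℝ) : ℂ) := by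
  have h1 : ∀ p ∈ S', ∀ q ∈ S', HM (fun τ => (∫ s in R, v p s * (starRingEnd ℂ) (v q s)) *
      ((ww S x m τ : ℂ) * exp (I * (τ * ((Real.log q - Real.log p : ℝ):ℂ)))))
      ((∫ s in R, v p s * (starRingEnd ℂ) (v q s)) *
        (if q = p then (((2*m).choose m : ℂ) / 4 ^ m) ^ S.card else 0)) := by
    intro p hp q hq
    refine (HMw S hS hx m q p (hS' q hq).ne_zero (hS' p hp).ne_zero fun r hr => ⟨?_, ?_⟩).smul _
    · rw [Nat.prime_dvd_prime_iff_eq (hS r hr) (hS' q hq)]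
      rintro rfl; exact Finset.disjoint_left.1 hd hr hq
    · rw [Nat.prime_dvd_prime_iff_eq (hS r hr) (hS' p hp)]
      rintro rfl; exact Finset.disjoint_left.1 hd hr hp
  have h2 := HM.sum S' fun p hp => HM.sum S' fun q hq => h1 p hp q hq
  have e : ∑ p ∈ S', ∑ q ∈ S', ((∫ s in R, v p s * (starRingEnd ℂ) (v q s)) *
        (if q = p then (((2*m).choose m : ℂ) / 4 ^ m) ^ S.card else 0)) =
      (((((2*m).choose m : ℝ) / 4 ^ m) ^ S.card * ∑ p ∈ S', QQ R (v p) : ℝ) : ℂ) := by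
    push_cast
    rw [Finset.mul_sum]
    refine Finset.sum_congr rfl fun p hp => ?_
    rw [Finset.sum_eq_single p (fun q _ hq => by rw [if_neg hq, mul_zero]) (fun h => absurd hp h),
      if_pos rfl, mul_comm]
    congr 1
    rw [QQ, ← integral_complex_ofReal]
    congr 1; ext s
    rw [Complex.mul_conj']; push_cast; rfl
  rw [e] at h2
  refine h2.congr fun τ => ?_
  rw [Complex.ofReal_mul, Z_expand hR S' v hv, Finset.mul_sum]
  refine Finset.sum_congr rfl fun p _ => ?_
  rw [Finset.mul_sum]
  refine Finset.sum_congr rfl fun q _ => ?_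
  rw [uu_conj]; ring

lemma HM.real {f : ℝ → ℝ} {c : ℝ} (h : HM (fun τ => (f τ : ℂ)) c) :
    Continuous f ∧ Tendsto (fun T : ℝ => (∫ τ in (-T)..T, f τ) / (2 * T)) atTop (nhds c) := by
  have hc : Continuous f := by
    have := continuous_re.comp h.1
    exact this
  refine ⟨hc, ?_⟩
  have := (continuous_re.tendsto _).comp h.2
  refine this.congr fun T => ?_
  simp only [Function.comp]
  rw [intervalIntegral.integral_ofReal]
  norm_cast

lemma V_fubini {R : Set ℂ} (hR : IsCompact R) (hR1 : ∀ s ∈ R, s.re < 1) {f : ℂ → ℂ}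
    (hf : ∀ s : ℂ, s.re < 1 → ContinuousAt f s) {T B : ℝ} (hT : 0 ≤ T)
    (hB : ∀ s ∈ R, ∫ τ in (-T)..T, ‖f (s + I * τ)‖ ^ 2 ≤ B) :
    IntegrableOn (fun τ : ℝ => QQ R (fun s => f (s + I * τ))) (Set.Icc (-T) T) ∧
      ∫ τ in Set.Icc (-T) T, QQ R (fun s => f (s + I * τ)) ≤ volume.real R * B := by
  have hc : ContinuousOn (fun q : ℝ × ℂ => ‖f (q.2 + I * q.1)‖ ^ 2) (Set.Icc (-T) T ×ˢ R) := by
    rintro ⟨τ, s⟩ ⟨_, hs⟩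
    have h1 : ContinuousAt f (s + I * τ) := hf _ (by simpa using hR1 s hs)
    have h2 : ContinuousAt (fun q : ℝ × ℂ => q.2 + I * (q.1:ℂ)) (τ, s) := by fun_prop
    have h3 : ContinuousAt (fun q : ℝ × ℂ => f (q.2 + I * (q.1:ℂ))) (τ, s) :=
      ContinuousAt.comp (f := fun q : ℝ × ℂ => q.2 + I * (q.1:ℂ)) h1 h2
    exact (h3.norm.pow 2).continuousWithinAt
  have hi := hc.integrableOn_compact (μ := (volume : Measure ℝ).prod (volume : Measure ℂ))
    (isCompact_Icc.prod hR)
  rw [IntegrableOn, ← Measure.prod_restrict] at hi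
  refine ⟨hi.integral_prod_left, ?_⟩
  simp only [QQ]
  rw [integral_integral_swap (f := fun (τ : ℝ) (s : ℂ) => ‖f (s + I * τ)‖ ^ 2) hi]
  calc ∫ s in R, ∫ τ in Set.Icc (-T) T, ‖f (s + I * τ)‖ ^ 2 ≤ ∫ s in R, B := by
        refine setIntegral_mono_on hi.integral_prod_right ?_ hR.measurableSet fun s hs => ?_
        · exact integrableOn_const hR.measure_lt_top.ne
        · have := hB s hs
          rwa [intervalIntegral.integral_of_le (by linarith), ← integral_Icc_eq_integral_Ioc] at this
    _ = _ := by rw [setIntegral_const, smul_eq_mul]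

lemma liminf_pos {w Z V : ℝ → ℝ} {c cZ ε1 ε2 : ℝ} (hc : 0 < c) (h1 : 0 < ε1) (h2 : 0 < ε2)
    (hw0 : ∀ τ, 0 ≤ w τ) (hw1 : ∀ τ, w τ ≤ 1) (hZ0 : ∀ τ, 0 ≤ Z τ) (hV0 : ∀ τ, 0 ≤ V τ)
    (hw : HM (fun τ => (w τ : ℂ)) c) (hwZ : HM (fun τ => ((w τ * Z τ : ℝ) : ℂ)) cZ)
    (hcZ : cZ ≤ c / 8 * ε1)
    (hV : ∀ᶠ T : ℝ in atTop, IntegrableOn V (Set.Icc (-T) T) ∧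
      ∫ τ in Set.Icc (-T) T, V τ ≤ c / 8 * ε2 * (2 * T))
    {Good : ℝ → Prop} (hG : ∀ τ, c / 8 < w τ → Z τ < ε1 → V τ < ε2 → Good τ) :
    0 < Filter.liminf (fun T : ℝ =>
      (volume {τ ∈ Set.Icc (-T) T | Good τ}).toReal / (2 * T)) atTop := by
  obtain ⟨hwc, hwt⟩ := hw.real
  obtain ⟨hzc, hzt⟩ := hwZ.real
  have hev : ∀ᶠ T : ℝ in atTop, c / 4 ≤ (volume {τ ∈ Set.Icc (-T) T | Good τ}).toReal / (2 * T) := by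
    filter_upwards [hV, hwt.eventually (lt_mem_nhds (show c * (7/8) < c by linarith)),
      hzt.eventually (gt_mem_nhds (show cZ < c / 4 * ε1 by nlinarith [mul_pos hc h1])),
      eventually_gt_atTop 0] with T ⟨hVi, hVb⟩ hwT hzT hT
    have hT2 : 0 < 2 * T := by linarith
    rw [lt_div_iff₀ hT2] at hwT
    rw [div_lt_iff₀ hT2] at hzT
    rw [le_div_iff₀ hT2]
    set μ := (volume : Measure ℝ).restrict (Set.Icc (-T) T) with hμ
    rw [intervalIntegral.integral_of_le (by linarith), ← integral_Icc_eq_integral_Ioc, ← hμ] at hwT hzT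
    set G : Set ℝ := {τ | Good τ} with hGdef
    have hGm : volume {τ ∈ Set.Icc (-T) T | Good τ} = μ (toMeasurable μ G) := by
      rw [measure_toMeasurable, hμ, Measure.restrict_apply' measurableSet_Icc]
      congr 1; ext τ; simp [hGdef, and_comm]
    have hwi : Integrable w μ := hwc.continuousOn.integrableOn_compact isCompact_Icc
    have hzi : Integrable (fun τ => w τ * Z τ) μ := hzc.continuousOn.integrableOn_compact isCompact_Icc
    have hVi : Integrable V μ := hVi
    have hΦ : Integrable (fun τ => w τ - (w τ * Z τ) / ε1 - c / 8 - V τ / ε2) μ :=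
      ((hwi.sub (hzi.div_const ε1)).sub (integrable_const _)).sub (hVi.div_const ε2)
    have hint : ∫ τ, (w τ - (w τ * Z τ) / ε1 - c / 8 - V τ / ε2) ∂μ =
        ∫ τ, w τ ∂μ - (∫ τ, w τ * Z τ ∂μ) / ε1 - c / 8 * (2 * T) - (∫ τ, V τ ∂μ) / ε2 := by
      have i1 : Integrable (fun τ => (w τ * Z τ) / ε1) μ := hzi.div_const ε1
      have i2 : Integrable (fun τ => V τ / ε2) μ := hVi.div_const ε2
      have i3 : Integrable (fun τ => w τ - (w τ * Z τ) / ε1) μ := hwi.sub i1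
      have i4 : Integrable (fun τ => w τ - (w τ * Z τ) / ε1 - c / 8) μ := i3.sub (integrable_const _)
      rw [integral_sub i4 i2, integral_sub i3 (integrable_const _), integral_sub hwi i1,
        integral_const, integral_div, integral_div]
      congr 2
      rw [hμ, measureReal_restrict_apply_univ, Real.volume_real_Icc_of_le (by linarith), smul_eq_mul]
      ring
    have hle : ∫ τ, (w τ - (w τ * Z τ) / ε1 - c / 8 - V τ / ε2) ∂μ ≤
        ∫ τ, (toMeasurable μ G).indicator (fun _ => (1:ℝ)) τ ∂μ := by
      refine integral_mono hΦ ((integrable_const _).indicator (measurableSet_toMeasurable _ _))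
        fun τ => ?_
      have hz' : 0 ≤ w τ * Z τ / ε1 := div_nonneg (mul_nonneg (hw0 τ) (hZ0 τ)) h1.le
      have hv' : 0 ≤ V τ / ε2 := div_nonneg (hV0 τ) h2.le
      by_cases hg : Good τ
      · rw [Set.indicator_of_mem (subset_toMeasurable μ G hg)]
        have := hw1 τ
        simp only; linarith
      · refine le_trans ?_ (Set.indicator_nonneg (fun _ _ => zero_le_one) τ)
        simp only
        by_cases a1 : c / 8 < w τ
        · by_cases a2 : Z τ < ε1
          · have a3 : 1 ≤ V τ / ε2 := by
              rw [le_div_iff₀ h2, one_mul]; by_contra h; exact hg (hG τ a1 a2 (not_le.1 h))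
            have := hw1 τ
            linarith
          · have : w τ ≤ w τ * Z τ / ε1 := by
              rw [le_div_iff₀ h1]; exact mul_le_mul_of_nonneg_left (not_lt.1 a2) (hw0 τ)
            linarith
        · linarith
    rw [integral_indicator_const _ (measurableSet_toMeasurable _ _), smul_eq_mul, mul_one,
      Measure.real, ← hGm, hint] at hle
    have b1 : (∫ τ, w τ * Z τ ∂μ) / ε1 ≤ c / 4 * (2 * T) := by
      rw [div_le_iff₀ h1]; nlinarith
    have b2 : (∫ τ, V τ ∂μ) / ε2 ≤ c / 8 * (2 * T) := by
      rw [div_le_iff₀ h2]; nlinarith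
    nlinarith [mul_pos hc hT]
  have hbd : ∀ᶠ T : ℝ in atTop, (volume {τ ∈ Set.Icc (-T) T | Good τ}).toReal / (2 * T) ≤ 1 := by
    filter_upwards [eventually_gt_atTop 0] with T hT
    rw [div_le_one (by linarith)]
    have : (volume {τ ∈ Set.Icc (-T) T | Good τ}).toReal ≤ (volume (Set.Icc (-T) T)).toReal :=
      ENNReal.toReal_mono (by simp) (measure_mono fun τ h => h.1)
    rw [Real.volume_Icc, ENNReal.toReal_ofReal (by linarith)] at this
    linarith
  refine lt_of_lt_of_le (show 0 < c / 4 by linarith) (le_liminf_of_le ?_ hev)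
  exact IsBoundedUnder.isCoboundedUnder_ge (isBoundedUnder_of_eventually_le hbd)


lemma geom {K : Set ℂ} (hK : IsCompact K) (hs : K ⊆ {s : ℂ | 1 / 2 < s.re ∧ s.re < 1}) :
    ∃ σ0 σ1 H r : ℝ, 1 / 2 < σ0 ∧ σ0 < σ1 ∧ σ1 < 1 ∧ 0 < H ∧ 0 < r ∧
      ∀ z ∈ K, Metric.closedBall z (2 * r) ⊆ Set.Icc σ0 σ1 ×ℂ Set.Icc (-H) H := by
  have hU : IsOpen {s : ℂ | 1 / 2 < s.re ∧ s.re < 1} :=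
    (isOpen_lt continuous_const continuous_re).inter (isOpen_lt continuous_re continuous_const)
  obtain ⟨δ, hδ, hsub⟩ := hK.exists_cthickening_subset_open hU hs
  have hc : IsCompact (Metric.cthickening δ K) := hK.cthickening
  obtain ⟨a, ha, ha'⟩ := hc.exists_forall_le' continuous_re.continuousOn (a := 1/2)
    fun b hb => (hsub hb).1
  obtain ⟨a2, hb, hb'⟩ := hc.exists_forall_le' (f := fun z : ℂ => -z.re)
    continuous_re.neg.continuousOn (a := -1) fun b hb => by have := (hsub hb).2; linarith
  obtain ⟨H, hH⟩ := hc.isBounded.exists_norm_le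
  refine ⟨min a (3/5), max (-a2) (4/5), max H 1, δ / 2, lt_min ha (by norm_num),
    lt_of_le_of_lt (min_le_right _ _) (lt_of_lt_of_le (by norm_num) (le_max_right _ _)),
    max_lt (by linarith) (by norm_num), lt_of_lt_of_le one_pos (le_max_right _ _), by linarith,
    fun z hz w hw => ?_⟩
  rw [mul_div_cancel₀ _ two_ne_zero] at hw
  have hw' : w ∈ Metric.cthickening δ K := Metric.closedBall_subset_cthickening hz δ hw
  have h1 := ha' w hw'
  have h2 := hb' w hw'
  have h3 := abs_le.1 ((abs_im_le_norm w).trans (hH w hw'))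
  rw [mem_reProdIm]
  exact ⟨⟨(min_le_left _ _).trans h1, le_trans (by linarith) (le_max_left _ _)⟩,
    ⟨by linarith [le_max_left H 1], h3.2.trans (le_max_left _ _)⟩⟩

lemma tailsum {σ : ℝ} (hσ : 1/2 < σ) (k : ℕ) {κ : ℝ} (hκ : 0 < κ) :
    ∃ y0 : ℕ, ∀ y ≥ y0, ∀ N, ∑ p ∈ PI y N, Real.log p ^ k * (p:ℝ) ^ (-(2 * σ)) < κ := by
  set δ := (2 * σ - 1) / (2 * (k + 1)) with hδ
  have hδ0 : 0 < δ := div_pos (by linarith) (by positivity)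
  have hkd : δ * k < 2 * σ - 1 := by
    have : δ * (2 * (k + 1)) = 2 * σ - 1 := div_mul_cancel₀ _ (by positivity)
    have hk : (0:ℝ) ≤ k := Nat.cast_nonneg k
    nlinarith
  have hsum : Summable fun n : ℕ => Real.log n ^ k * (n:ℝ) ^ (-(2 * σ)) := by
    refine Summable.of_nonneg_of_le (fun n => mul_nonneg (pow_nonneg (Real.log_natCast_nonneg _) _)
      (by positivity)) (fun n => ?_)
      ((Real.summable_nat_rpow (p := δ * k - 2 * σ).2 (by linarith)).mul_left ((1 / δ) ^ k))
    rcases Nat.eq_zero_or_pos n with rfl | hn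
    · rw [Nat.cast_zero, Real.zero_rpow (by linarith), Real.zero_rpow (by linarith)]; simp
    have hn' : (0:ℝ) < n := by exact_mod_cast hn
    calc Real.log n ^ k * (n:ℝ) ^ (-(2 * σ)) ≤ ((n:ℝ) ^ δ / δ) ^ k * (n:ℝ) ^ (-(2 * σ)) := by
          gcongr
          exact Real.log_le_rpow_div hn'.le hδ0
      _ = _ := by
          rw [div_pow, ← Real.rpow_mul_natCast hn'.le, sub_eq_add_neg, Real.rpow_add hn', one_div,
            inv_pow]
          ring
  obtain ⟨s, hs⟩ := summable_iff_vanishing_norm.1 hsum κ hκ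
  refine ⟨s.sup (fun p => p), fun y hy N => lt_of_le_of_lt (le_abs_self _) (hs _ ?_)⟩
  rw [Finset.disjoint_left]
  intro p hp hps
  have := Finset.le_sup (f := fun p : ℕ => p) hps
  have h2 := (mem_PI.1 hp).1
  omega

noncomputable def vv (p : ℕ) (s : ℂ) : ℂ := Real.log p * (p:ℂ) ^ (-s)

lemma vv_diff {p : ℕ} (hp : p.Prime) (s : ℂ) : DifferentiableAt ℂ (vv p) s :=
  (hasDeriv_pu ⟨p, hp⟩ s).differentiableAt.const_mul _

lemma norm_pp {p : ℕ} (hp : p.Prime) {s : ℂ} {σ : ℝ} (hs : σ ≤ s.re) :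
    ‖(p:ℂ) ^ (-s)‖ ^ 2 ≤ (p:ℝ) ^ (-(2 * σ)) := by
  have h1 : (1:ℝ) ≤ p := by exact_mod_cast hp.one_lt.le
  have e : ‖(p:ℂ) ^ (-s)‖ = (p:ℝ) ^ (-s.re) := norm_pu ⟨p, hp⟩ s
  rw [e, ← Real.rpow_mul_natCast (by linarith)]
  exact Real.rpow_le_rpow_of_exponent_le h1 (by push_cast; linarith)

lemma norm_p34 {p : ℕ} (hp : p.Prime) {s : ℂ} (hs : 1/2 ≤ s.re) : ‖(p:ℂ) ^ (-s)‖ ≤ 3/4 := by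
  have h1 := norm_pp hp hs
  have h2 : (p:ℝ) ^ (-(2 * (1/2:ℝ))) ≤ 1 / 2 := by
    rw [show -(2 * (1/2:ℝ)) = -1 by norm_num, Real.rpow_neg_one, one_div]
    have : (2:ℝ) ≤ p := by exact_mod_cast hp.two_le
    gcongr
  nlinarith [norm_nonneg ((p:ℂ) ^ (-s))]

lemma QQ_vv {R : Set ℂ} (hR : IsCompact R) {σ : ℝ} (hs : ∀ s ∈ R, σ ≤ s.re) {p : ℕ} (hp : p.Prime) :
    QQ R (vv p) ≤ volume.real R * (Real.log p ^ 2 * (p:ℝ) ^ (-(2 * σ))) := by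
  rw [QQ, ← smul_eq_mul, ← setIntegral_const]
  refine setIntegral_mono_on (QQ_int hR fun s _ => (vv_diff hp s).continuousAt.continuousWithinAt)
    (integrableOn_const hR.measure_lt_top.ne) hR.measurableSet fun s h => ?_
  rw [vv, norm_mul, mul_pow, Complex.norm_real, Real.norm_eq_abs, sq_abs]
  gcongr
  exact norm_pp hp (hs s h)

lemma t_quad {u : ℂ} (hu : ‖u‖ ≤ 3/4) : ‖u / (1 - u) - u‖ ≤ 4 * ‖u‖ ^ 2 := by
  have h1 : 1/4 ≤ ‖1 - u‖ := by
    have := norm_sub_norm_le (1:ℂ) u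
    rw [norm_one] at this; linarith
  have h0 : 1 - u ≠ 0 := norm_ne_zero_iff.1 (by linarith)
  rw [show u / (1 - u) - u = u ^ 2 / (1 - u) by field_simp; ring, norm_div, norm_pow,
    div_le_iff₀ (by linarith)]
  nlinarith [sq_nonneg ‖u‖]

lemma t_lip {u u' : ℂ} (hu : ‖u‖ ≤ 3/4) (hu' : ‖u'‖ ≤ 3/4) :
    ‖u / (1 - u) - u' / (1 - u')‖ ≤ 16 * ‖u - u'‖ := by
  have key : ∀ u : ℂ, ‖u‖ ≤ 3/4 → 1/4 ≤ ‖1 - u‖ := fun u hu => by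
    have := norm_sub_norm_le (1:ℂ) u
    rw [norm_one] at this; linarith
  have h1 := key u hu
  have h2 := key u' hu'
  have h0 : 1 - u ≠ 0 := norm_ne_zero_iff.1 (by linarith)
  have h0' : 1 - u' ≠ 0 := norm_ne_zero_iff.1 (by linarith)
  rw [show u / (1 - u) - u' / (1 - u') = (u - u') / ((1 - u) * (1 - u')) by field_simp; ring,
    norm_div, norm_mul, div_le_iff₀ (by positivity)]
  have : 1/16 ≤ ‖1 - u‖ * ‖1 - u'‖ := by nlinarith
  nlinarith [norm_nonneg (u - u')]

lemma logder (N : ℕ) {s : ℂ} (hs : 1/2 ≤ s.re) (hs1 : s ≠ 1) (h0 : fP (primorial N) s ≠ 0) :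
    deriv riemannZeta s / riemannZeta s = deriv (fP (primorial N)) s / fP (primorial N) s -
      ∑ p ∈ PI 0 N, Real.log p * ((p:ℂ) ^ (-s) / (1 - (p:ℂ) ^ (-s))) := by
  have hpf : (primorial N).primeFactors = PI 0 N := by
    rw [primeFactors_primorial]; ext p
    rw [Nat.mem_primesLE, mem_PI]
    exact ⟨fun h => ⟨h.2.pos, h⟩, fun h => h.2⟩
  have hfe : fP (primorial N) = fun s => (∏ p ∈ PI 0 N, (1 - (p:ℂ)^(-s))) * riemannZeta s := by
    ext s; rw [fP, hpf]
  have h0' := h0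
  rw [hfe] at h0'
  obtain ⟨hp0, hz0⟩ := mul_ne_zero_iff.1 h0'
  have hd : ∀ p ∈ PI 0 N, HasDerivAt (fun s : ℂ => 1 - (p:ℂ)^(-s)) (Real.log p * (p:ℂ)^(-s)) s :=
    fun p hp => ((hasDeriv_pu ⟨p, (mem_PI.1 hp).2.2⟩ s).const_sub 1).congr_deriv (by simp)
  have hne : ∀ p ∈ PI 0 N, 1 - (p:ℂ)^(-s) ≠ 0 := fun p hp => Finset.prod_ne_zero_iff.1 hp0 p hp
  have h1 : logDeriv (fP (primorial N)) s =
      ∑ p ∈ PI 0 N, logDeriv (fun s : ℂ => 1 - (p:ℂ)^(-s)) s + logDeriv riemannZeta s := by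
    rw [hfe, logDeriv_mul (f := fun s : ℂ => ∏ p ∈ PI 0 N, (1 - (p:ℂ)^(-s))) s hp0 hz0
      (DifferentiableAt.fun_finsetProd fun p hp => (hd p hp).differentiableAt)
      (differentiableAt_riemannZeta hs1), logDeriv_prod hne fun p hp => (hd p hp).differentiableAt]
  rw [logDeriv_apply, logDeriv_apply] at h1
  rw [h1]
  have : ∑ p ∈ PI 0 N, logDeriv (fun s : ℂ => 1 - (p:ℂ)^(-s)) s =
      ∑ p ∈ PI 0 N, Real.log p * ((p:ℂ) ^ (-s) / (1 - (p:ℂ) ^ (-s))) :=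
    Finset.sum_congr rfl fun p hp => by rw [logDeriv_apply, (hd p hp).deriv, mul_div_assoc]
  rw [this]; ring

lemma InP_t {R : Set ℂ} [CompactSpace R] (hR : IsCompact R) (hs : ∀ s ∈ R, 1/2 ≤ s.re) {p : ℕ}
    (hp : p.Prime) : InP R (fun s => (p:ℂ) ^ (-s) / (1 - (p:ℂ) ^ (-s))) := by
  obtain ⟨B, hB⟩ := hR.isBounded.exists_norm_le
  set A := max B 1 with hA
  have hA0 : 0 < A := lt_of_lt_of_le one_pos (le_max_right _ _)
  have hA0' : (A:ℂ) ≠ 0 := by exact_mod_cast hA0.ne'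
  have h1 : InP R (fun s => (1 / (2 * A) : ℂ) * s) := (InP.const _).mul InP.id
  have h2 : InP R (fun s => (p:ℂ) ^ (-((2 * A : ℂ) * ((1 / (2 * A) : ℂ) * s)))) := by
    refine InP.comp (φ := fun z => (p:ℂ) ^ (-((2 * A : ℂ) * z))) h1 (ρ := 1/2) (by norm_num)
      (fun z hz => ?_) fun z _ => ?_
    · rw [norm_mul, norm_div, norm_mul, Complex.norm_real, Real.norm_of_nonneg hA0.le, norm_one,
        Complex.norm_ofNat, div_mul_eq_mul_div, div_le_iff₀ (by positivity)]
      have := (hB z hz).trans (le_max_left B 1)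
      linarith
    · have h3 : DifferentiableAt ℂ (fun z : ℂ => (2 * A : ℂ) * z) z := by fun_prop
      exact (DifferentiableAt.comp (f := fun z : ℂ => (2 * A : ℂ) * z) z
        (hasDeriv_pu ⟨p, hp⟩ _).differentiableAt h3).differentiableWithinAt
  have h3 : InP R (fun s => (p:ℂ) ^ (-s)) := h2.congr fun z _ => by
    congr 2; field_simp
  refine InP.comp (φ := fun z => z / (1 - z)) h3 (ρ := 3/4) (by norm_num)
    (fun z hz => norm_p34 hp (hs z hz)) fun z hz => ?_
  have : 1 - z ≠ 0 := by
    intro h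
    rw [← sub_eq_zero.1 h] at hz; simp at hz
  exact (differentiableAt_id.div (by fun_prop) this).differentiableWithinAt

lemma choose_m (d : ℕ) {δ : ℝ} (hδ : 0 < δ) (hδ1 : δ ≤ 1) : ∃ m : ℕ, 0 < m ∧
    (1 - δ ^ 2 / 4) ^ m ≤ (((2*m).choose m : ℝ) / 4 ^ m) ^ d / 8 := by
  have hr : |1 - δ ^ 2 / 4| < 1 := by rw [abs_lt]; constructor <;> nlinarith
  have ht := tendsto_pow_const_mul_const_pow_of_abs_lt_one d hr
  have hpos : (0:ℝ) < (1/2) ^ d / 8 := by positivity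
  obtain ⟨m, hm, hm0⟩ := ((ht.eventually (gt_mem_nhds hpos)).and (eventually_gt_atTop 0)).exists
  refine ⟨m, hm0, ?_⟩
  have hmr : (0:ℝ) < m := by exact_mod_cast hm0
  have hc : 1 / (2 * (m:ℝ)) ≤ ((2*m).choose m : ℝ) / 4 ^ m := by
    rw [div_le_div_iff₀ (by positivity) (by positivity), one_mul, mul_comm]
    have := Nat.four_pow_le_two_mul_self_mul_centralBinom m hm0
    rw [Nat.centralBinom_eq_two_mul_choose] at this
    exact_mod_cast this
  calc (1 - δ ^ 2 / 4) ^ m = ((m:ℝ) ^ d * (1 - δ ^ 2 / 4) ^ m) / (m:ℝ) ^ d := by field_simp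
    _ ≤ ((1/2) ^ d / 8) / (m:ℝ) ^ d := by gcongr
    _ = (1 / (2 * (m:ℝ))) ^ d / 8 := by
        rw [← div_div 1 2 (m:ℝ), div_pow (1/2:ℝ)]; ring
    _ ≤ _ := by gcongr

lemma PI_split {a b c : ℕ} (h1 : a ≤ b) (h2 : b ≤ c) (f : ℕ → ℂ) :
    ∑ p ∈ PI a c, f p = ∑ p ∈ PI a b, f p + ∑ p ∈ PI b c, f p := by
  rw [← Finset.sum_union]
  · congr 1; ext p; simp only [Finset.mem_union, mem_PI]
    constructor
    · rintro ⟨h, h', h''⟩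
      rcases le_or_gt p b with h3 | h3
      · exact Or.inl ⟨h, h3, h''⟩
      · exact Or.inr ⟨h3, h', h''⟩
    · rintro (⟨h, h', h''⟩ | ⟨h, h', h''⟩)
      · exact ⟨h, h'.trans h2, h''⟩
      · exact ⟨lt_of_le_of_lt h1 h, h', h''⟩
  · rw [Finset.disjoint_left]; intro p hp hp'
    rw [mem_PI] at hp hp'; omega


lemma final_pt {y M N : ℕ} (hyM : y ≤ M) (hMN : M ≤ N) {σ e δ τ : ℝ} (hσ : 1/2 < σ) {z D Q Fz Pz : ℂ}
    (hz : σ ≤ z.re) {x b : ℕ → ℂ} (hx : ∀ p, ‖x p‖ = 1) (hx1 : ∀ p, p ≤ y → x p = 1)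
    (hQ : ‖Q‖ ≤ e)
    (hD : D = Q - ∑ p ∈ PI 0 N, Real.log p *
      ((p:ℂ) ^ (-(z + I * τ)) / (1 - (p:ℂ) ^ (-(z + I * τ)))))
    (hxu : ∀ p ∈ PI 0 M, ‖uu p τ - x p‖ ≤ δ) (hδ : 16 * δ * ∑ p ∈ PI 0 M, Real.log p ≤ e)
    (hts : ∑ p ∈ PI y M, Real.log p * (p:ℝ) ^ (-(2 * σ)) ≤ e / 4)
    (hts' : ∑ p ∈ PI M N, Real.log p * (p:ℝ) ^ (-(2 * σ)) ≤ e / 4)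
    (hZ : ‖∑ p ∈ PI M N, uu p τ * vv p z‖ ≤ e)
    (hX : ‖∑ p ∈ PI y M, (b p - x p) * vv p z‖ ≤ e)
    (hG : ‖(-Pz - ∑ p ∈ PI 0 y, Real.log p * ((p:ℂ) ^ (-z) / (1 - (p:ℂ) ^ (-z))))
      - ∑ p ∈ PI y M, b p * (Real.log p * (p:ℂ) ^ (-z))‖ ≤ e)
    (hF : ‖Fz - Pz‖ ≤ e) : ‖D - Fz‖ ≤ 8 * e := by
  set a : ℕ → ℂ := fun p => (p:ℂ) ^ (-z) with ha
  have ha34 : ∀ p : ℕ, p.Prime → ‖a p‖ ≤ 3/4 := fun p hp => norm_p34 hp (by linarith)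
  have hlog : ∀ p : ℕ, 0 ≤ Real.log p := fun p => Real.log_natCast_nonneg p
  -- quadratic terms
  have quad : ∀ (A B : ℕ) (c : ℕ → ℂ), (∀ p, ‖c p‖ = 1) →
      ∑ p ∈ PI A B, Real.log p * (p:ℝ) ^ (-(2 * σ)) ≤ e / 4 →
      ‖∑ p ∈ PI A B, Real.log p * (c p * a p / (1 - c p * a p) - c p * a p)‖ ≤ e := by
    intro A B c hc h
    refine (norm_sum_le _ _).trans ?_
    calc _ ≤ ∑ p ∈ PI A B, 4 * (Real.log p * (p:ℝ) ^ (-(2 * σ))) := by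
          refine Finset.sum_le_sum fun p hp => ?_
          have hp' := (mem_PI.1 hp).2.2
          have hn : ‖c p * a p‖ = ‖a p‖ := by rw [norm_mul, hc, one_mul]
          have h1 := t_quad (u := c p * a p) (by rw [hn]; exact ha34 p hp')
          have h2 : ‖a p‖ ^ 2 ≤ (p:ℝ) ^ (-(2 * σ)) := norm_pp hp' hz
          rw [hn] at h1
          rw [norm_mul, Complex.norm_real, Real.norm_of_nonneg (hlog p)]
          nlinarith [hlog p]
      _ ≤ e := by rw [← Finset.mul_sum]; linarith
  have q1 := quad M N (fun p => uu p τ) (fun p => norm_uu p τ) hts'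
  have q2 := quad y M x hx hts
  -- Lipschitz term
  have q3 : ‖∑ p ∈ PI 0 M, Real.log p * (uu p τ * a p / (1 - uu p τ * a p) -
      x p * a p / (1 - x p * a p))‖ ≤ e := by
    refine (norm_sum_le _ _).trans (le_trans ?_ hδ)
    rw [Finset.mul_sum]
    refine Finset.sum_le_sum fun p hp => ?_
    have hp' := (mem_PI.1 hp).2.2
    have h1 := t_lip (u := uu p τ * a p) (u' := x p * a p)
      (by rw [norm_mul, norm_uu, one_mul]; exact ha34 p hp')
      (by rw [norm_mul, hx, one_mul]; exact ha34 p hp')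
    rw [← sub_mul, norm_mul (uu p τ - x p)] at h1
    have h2 := hxu p hp
    have h3 := ha34 p hp'
    have h4 : ‖uu p τ - x p‖ * ‖a p‖ ≤ δ * 1 :=
      mul_le_mul h2 (by linarith) (norm_nonneg _) ((norm_nonneg _).trans h2)
    rw [norm_mul, Complex.norm_real, Real.norm_of_nonneg (hlog p)]
    nlinarith [hlog p]
  have hD' : D = Q - ∑ p ∈ PI 0 N, Real.log p * (uu p τ * a p / (1 - uu p τ * a p)) := by
    rw [hD]; congr 1
    refine Finset.sum_congr rfl fun p hp => ?_
    rw [uu_cpow (mem_PI.1 hp).2.2.ne_zero]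
  have hid : D - Fz = Q - ∑ p ∈ PI 0 M, Real.log p * (uu p τ * a p / (1 - uu p τ * a p) -
      x p * a p / (1 - x p * a p))
      - ∑ p ∈ PI M N, Real.log p * (uu p τ * a p / (1 - uu p τ * a p) - uu p τ * a p)
      - ∑ p ∈ PI M N, uu p τ * vv p z
      - ∑ p ∈ PI y M, Real.log p * (x p * a p / (1 - x p * a p) - x p * a p)
      + ∑ p ∈ PI y M, (b p - x p) * vv p z
      + ((-Pz - ∑ p ∈ PI 0 y, Real.log p * (a p / (1 - a p)))
      - ∑ p ∈ PI y M, b p * (Real.log p * a p)) - (Fz - Pz) := by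
    have e1 : ∑ p ∈ PI 0 y, Real.log p * (a p / (1 - a p)) =
        ∑ p ∈ PI 0 y, Real.log p * (x p * a p / (1 - x p * a p)) :=
      Finset.sum_congr rfl fun p hp => by rw [hx1 p (mem_PI.1 hp).2.1, one_mul]
    have e2 : ∑ p ∈ PI M N, uu p τ * vv p z = ∑ p ∈ PI M N, Real.log p * (uu p τ * a p) :=
      Finset.sum_congr rfl fun p _ => by rw [vv]; ring
    have e3 : ∑ p ∈ PI y M, (b p - x p) * vv p z =
        ∑ p ∈ PI y M, b p * (Real.log p * a p) - ∑ p ∈ PI y M, Real.log p * (x p * a p) := by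
      rw [← Finset.sum_sub_distrib]
      exact Finset.sum_congr rfl fun p _ => by rw [vv]; ring
    rw [hD', e1, e2, e3, PI_split (Nat.zero_le M) hMN]
    simp only [mul_sub, Finset.sum_sub_distrib]
    rw [PI_split (Nat.zero_le y) hyM (fun p => Real.log p * (x p * a p / (1 - x p * a p)))]
    ring
  rw [hid]
  refine (norm_sub_le _ _).trans ?_
  have t1 := norm_add_le (Q - ∑ p ∈ PI 0 M, Real.log p * (uu p τ * a p / (1 - uu p τ * a p) -
      x p * a p / (1 - x p * a p))
      - ∑ p ∈ PI M N, Real.log p * (uu p τ * a p / (1 - uu p τ * a p) - uu p τ * a p)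
      - ∑ p ∈ PI M N, uu p τ * vv p z
      - ∑ p ∈ PI y M, Real.log p * (x p * a p / (1 - x p * a p) - x p * a p)
      + ∑ p ∈ PI y M, (b p - x p) * vv p z)
      ((-Pz - ∑ p ∈ PI 0 y, Real.log p * (a p / (1 - a p)))
      - ∑ p ∈ PI y M, b p * (Real.log p * a p))
  have t2 : ∀ A B C D' E G' : ℂ, ‖A - B - C - D' - E + G'‖ ≤ ‖A‖ + ‖B‖ + ‖C‖ + ‖D'‖ + ‖E‖ + ‖G'‖ := by
    intro A B C D' E G'
    have := norm_add_le (A - B - C - D' - E) G'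
    have := norm_sub_le (A - B - C - D') E
    have := norm_sub_le (A - B - C) D'
    have := norm_sub_le (A - B) C
    have := norm_sub_le A B
    linarith
  have t3 := t2 Q (∑ p ∈ PI 0 M, Real.log p * (uu p τ * a p / (1 - uu p τ * a p) -
      x p * a p / (1 - x p * a p)))
      (∑ p ∈ PI M N, Real.log p * (uu p τ * a p / (1 - uu p τ * a p) - uu p τ * a p))
      (∑ p ∈ PI M N, uu p τ * vv p z)
      (∑ p ∈ PI y M, Real.log p * (x p * a p / (1 - x p * a p) - x p * a p))
      (∑ p ∈ PI y M, (b p - x p) * vv p z)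
  linarith

/-- From small square mean of `f - 1` to small `f'/f`. -/
lemma quot_small {R : Set ℂ} (hR : IsCompact R) {f : ℂ → ℂ} (hf : ∀ s ∈ R, DifferentiableAt ℂ f s)
    {z : ℂ} {r e : ℝ} (hr : 0 < r) (he : 0 < e) (hb : Metric.closedBall z (2 * r) ⊆ R)
    (h1 : (Real.pi * r ^ 2)⁻¹ * QQ R (fun s => f s - 1) < 1 / 4)
    (h2 : (Real.pi * r ^ 2)⁻¹ / r ^ 2 * QQ R (fun s => f s - 1) < (e / 2) ^ 2) :
    f z ≠ 0 ∧ ‖deriv f z / f z‖ ≤ e := by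
  have hh : ∀ s ∈ R, DifferentiableAt ℂ (fun s => f s - 1) s := fun s hs => (hf s hs).sub_const 1
  have a1 := area hR hh hr ((Metric.closedBall_subset_closedBall (by linarith)).trans hb)
  have a2 := area_deriv hR hh hr hb
  rw [deriv_sub_const] at a2
  have b1 : ‖f z - 1‖ < 1/2 := by
    refine lt_of_pow_lt_pow_left₀ 2 (by norm_num) ?_
    norm_num; linarith
  have b2 : ‖deriv f z‖ < e / 2 := lt_of_pow_lt_pow_left₀ 2 (by linarith) (a2.trans_lt h2)
  have b3 : 1/2 ≤ ‖f z‖ := by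
    have := norm_sub_norm_le (1:ℂ) (f z)
    rw [norm_one, norm_sub_rev] at this
    linarith
  refine ⟨norm_ne_zero_iff.1 (by linarith), ?_⟩
  rw [norm_div, div_le_iff₀ (by linarith)]
  nlinarith


/-- **Laurinčikas's universality theorem for `ζ'/ζ`.** Let `K` be a compact subset of the strip
`1/2 < Re s < 1` with connected complement, and let `F` be continuous on `K` and analytic on
its interior. Then for every `ε > 0` the set of shifts `τ ∈ [-T, T]` for which
`(ζ'/ζ)(s + iτ)` approximates `F` within `ε` uniformly on `K` has positive lower density. -/
theorem laurincikas_universality (K : Set ℂ) (hK : IsCompact K)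
    (hK_sub : K ⊆ {s : ℂ | 1 / 2 < s.re ∧ s.re < 1})
    (hK_conn : IsConnected Kᶜ)
    (F : ℂ → ℂ) (hF_cont : ContinuousOn F K)
    (hF_anal : AnalyticOn ℂ F (interior K)) :
    ∀ ε > (0 : ℝ),
      0 < Filter.liminf (fun T : ℝ =>
        (volume {τ ∈ Set.Icc (-T) T |
          ∀ s ∈ K, ‖deriv riemannZeta (s + I * τ) / riemannZeta (s + I * τ) - F s‖ < ε}).toReal
          / (2 * T)) Filter.atTop := by
  intro ε hε
  obtain ⟨e, rfl⟩ : ∃ e, ε = 10 * e := ⟨ε / 10, by ring⟩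
  have he : 0 < e := by linarith
  obtain ⟨P, hP⟩ := mergelyan hK hK_conn hF_cont hF_anal.differentiableOn he
  obtain ⟨σ0, σ1, H, r, h0, h01, h1, hH, hr, hball⟩ := geom hK hK_sub
  obtain ⟨R, hRdef⟩ : ∃ R, R = Set.Icc σ0 σ1 ×ℂ Set.Icc (-H) H := ⟨_, rfl⟩
  rw [← hRdef] at hball
  have hR : IsCompact R := hRdef ▸ isCompact_Icc.reProdIm isCompact_Icc
  haveI : CompactSpace R := isCompact_iff_compactSpace.1 hR
  have hRm : ∀ s ∈ R, (σ0 ≤ s.re ∧ s.re ≤ σ1) ∧ |s.im| ≤ H := fun s hs => by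
    rw [hRdef, mem_reProdIm] at hs
    exact ⟨hs.1, abs_le.2 hs.2⟩
  have hKR : ∀ z ∈ K, z ∈ R := fun z hz => hball z hz (Metric.mem_closedBall_self (by linarith))
  set C := (Real.pi * r ^ 2)⁻¹ with hC
  have hC0 : 0 < C := by have := Real.pi_pos; positivity
  set C' := C / r ^ 2 with hC'
  have hC'0 : 0 < C' := by positivity
  set ε1 := e ^ 2 / C with hε1
  have hε10 : 0 < ε1 := by positivity
  set ε2 := min (1 / 4 / C) ((e / 2) ^ 2 / C') with hε2
  have hε20 : 0 < ε2 := lt_min (by positivity) (by positivity)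
  set A := volume.real R with hA
  have hA0 : 0 ≤ A := measureReal_nonneg
  obtain ⟨y1, hy1⟩ := tailsum h0 1 (κ := e / 4) (by positivity)
  obtain ⟨y2, hy2⟩ := tailsum h0 2 (κ := ε1 / (8 * (A + 1))) (by positivity)
  set y := max y1 y2 with hy
  have hQsum : ∀ a ≥ y, ∀ b, ∑ p ∈ PI a b, QQ R (vv p) ≤ ε1 / 8 := by
    intro a ha b
    have h := hy2 a ((le_max_right _ _).trans ha) b
    calc _ ≤ ∑ p ∈ PI a b, A * (Real.log p ^ 2 * (p:ℝ) ^ (-(2 * σ0))) :=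
          Finset.sum_le_sum fun p hp => QQ_vv hR (fun s hs => (hRm s hs).1.1) (mem_PI.1 hp).2.2
      _ = A * ∑ p ∈ PI a b, (Real.log p ^ 2 * (p:ℝ) ^ (-(2 * σ0))) := by rw [Finset.mul_sum]
      _ ≤ A * (ε1 / (8 * (A + 1))) := by gcongr
      _ ≤ (A + 1) * (ε1 / (8 * (A + 1))) := by gcongr; linarith
      _ = ε1 / 8 := by field_simp
  have hvc : ∀ p, p.Prime → ContinuousOn (vv p) R := fun p hp s _ =>
    (vv_diff hp s).continuousAt.continuousWithinAt
  have hGin : InP R (fun s => -P.eval s - ∑ p ∈ PI 0 y,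
      Real.log p * ((p:ℂ) ^ (-s) / (1 - (p:ℂ) ^ (-s)))) := by
    have a1 : InP R (fun s => (-P).eval s) := InP.poly _
    have a2 : InP R (fun s => ∑ p ∈ PI 0 y, (-(Real.log p:ℂ)) * ((p:ℂ) ^ (-s) / (1 - (p:ℂ) ^ (-s)))) :=
      InP.sum _ fun p hp => (InP.const _).mul
        (InP_t hR (fun s hs => by linarith [(hRm s hs).1.1]) (mem_PI.1 hp).2.2)
    refine (a1.add a2).congr fun s _ => ?_
    simp [Finset.sum_neg_distrib, sub_eq_add_neg]
  obtain ⟨M0, b, hb1, hb⟩ := density h0 h01 h1 hH hRdef hGin y he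
  obtain ⟨M, hyM, hPI⟩ : ∃ M, y ≤ M ∧ PI y M0 = PI y M := by
    refine ⟨max M0 y, le_max_right _ _, ?_⟩
    ext p; simp only [mem_PI]
    constructor
    · rintro ⟨a, b, c⟩; exact ⟨a, by omega, c⟩
    · rintro ⟨a, b, c⟩; exact ⟨a, by omega, c⟩
  rw [hPI] at hb
  obtain ⟨x0, hx0, hx0Q⟩ := greedy hR vv hb1 (PI y M) fun p hp => hvc p (mem_PI.1 hp).2.2
  obtain ⟨x, hxdef⟩ : ∃ x : ℕ → ℂ, x = fun p => if p ≤ y then 1 else x0 p := ⟨_, rfl⟩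
  have hx : ∀ p, ‖x p‖ = 1 := fun p => by rw [hxdef]; dsimp only; split_ifs <;> simp [hx0]
  have hx1 : ∀ p, p ≤ y → x p = 1 := fun p hp => by rw [hxdef]; dsimp only; rw [if_pos hp]
  have hx2 : ∀ p ∈ PI y M, x p = x0 p := fun p hp => by
    rw [hxdef]; dsimp only; rw [if_neg (by have := (mem_PI.1 hp).1; omega)]
  set L := ∑ p ∈ PI 0 M, Real.log p with hL
  have hL0 : 0 ≤ L := Finset.sum_nonneg fun p _ => Real.log_natCast_nonneg p
  set δ := min 1 (e / (16 * (L + 1))) with hδ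
  have hδ0 : 0 < δ := lt_min one_pos (by positivity)
  have hδL : 16 * δ * L ≤ e := by
    have : δ ≤ e / (16 * (L + 1)) := min_le_right _ _
    rw [le_div_iff₀ (by positivity)] at this
    nlinarith
  obtain ⟨m, hm, hmc⟩ := choose_m (PI 0 M).card hδ0 (min_le_left _ _)
  set c : ℝ := (((2*m).choose m : ℝ) / 4 ^ m) ^ (PI 0 M).card with hc
  have hc0 : 0 < c := by
    have : 0 < (2*m).choose m := Nat.choose_pos (by omega)
    positivity
  set η := c * ε2 / (4 * (A + 1)) with hη
  have hη0 : 0 < η := by positivity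
  obtain ⟨N0, hN0⟩ := mean_square (H := H) h0 h1 hη0
  set N := max N0 M with hN
  have hMN : M ≤ N := le_max_right _ _
  obtain ⟨T0, hT0⟩ := hN0 N (le_max_left _ _)
  have hprime : ∀ a b, ∀ p ∈ PI a b, p.Prime := fun a b p hp => (mem_PI.1 hp).2.2
  refine liminf_pos (w := fun τ => ww (PI 0 M) x m τ)
    (Z := fun τ => QQ R (fun s => ∑ p ∈ PI M N, uu p τ * vv p s))
    (V := fun τ => QQ R (fun s => fP (primorial N) (s + I * τ) - 1)) (c := c) (ε1 := ε1) (ε2 := ε2)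
    (cZ := c * ∑ p ∈ PI M N, QQ R (vv p))
    hc0 hε10 hε20 (fun τ => (ww_mem _ hx m τ).1) (fun τ => (ww_mem _ hx m τ).2)
    (fun τ => QQ_nonneg _ _) (fun τ => QQ_nonneg _ _) ?_ ?_ ?_ ?_ ?_
  · have := HMw (PI 0 M) (hprime 0 M) hx m 1 1 one_ne_zero one_ne_zero fun p hp => by
      have := (hprime 0 M p hp).one_lt
      simp; omega
    rw [if_pos rfl] at this
    have h2 := this.congr (g := fun τ => (ww (PI 0 M) x m τ : ℂ)) (fun τ => by simp)
    rw [hc]; push_cast; exact h2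
  · refine HM_Z hR (hprime 0 M) (hprime M N) ?_ hx m vv fun p hp => hvc p (hprime _ _ p hp)
    rw [Finset.disjoint_left]
    intro p hp hp'
    have h1 := mem_PI.1 hp
    have h2 := mem_PI.1 hp'
    omega
  · have := hQsum M hyM N
    nlinarith
  · filter_upwards [eventually_ge_atTop T0, eventually_ge_atTop 0] with T hT hT'
    have h := V_fubini hR (fun s hs => (hRm s hs).1.2.trans_lt h1) (f := fun s => fP (primorial N) s - 1)
      (fun s hs => ((fP_diff (by rintro rfl; simp at hs)).sub_const 1).continuousAt) hT' (B := η * T)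
      (fun s hs => hT0 T hT s (hRm s hs).1.1 (hRm s hs).1.2 (hRm s hs).2)
    refine ⟨h.1, h.2.trans ?_⟩
    have hmul : η * (4 * (A + 1)) = c * ε2 := div_mul_cancel₀ _ (by positivity)
    have : A * η ≤ c * ε2 / 4 := by nlinarith
    calc _ = A * η * T := by ring
      _ ≤ c * ε2 / 4 * T := by gcongr
      _ = _ := by ring
  · intro τ hw hZ hV z hz
    have hzR := hKR z hz
    have hzre := (hRm z hzR).1
    have hsub : ∀ s ∈ R, s + I * (τ:ℂ) ≠ 1 := fun s hs h => by
      have h2 := congrArg Complex.re h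
      simp at h2
      linarith [(hRm s hs).1.2]
    have hfd : ∀ s ∈ R, DifferentiableAt ℂ (fun s => fP (primorial N) (s + I * τ)) s := fun s hs =>
      (fP_diff (hsub s hs)).comp s (differentiableAt_id.add_const _)
    have hV1 : C * QQ R (fun s => fP (primorial N) (s + I * τ) - 1) < 1 / 4 := by
      have := hV.trans_le (min_le_left _ _)
      rw [lt_div_iff₀ hC0] at this
      linarith
    have hV2 : C' * QQ R (fun s => fP (primorial N) (s + I * τ) - 1) < (e / 2) ^ 2 := by
      have := hV.trans_le (min_le_right _ _)
      rw [lt_div_iff₀ hC'0] at this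
      linarith
    obtain ⟨hne, hq⟩ := quot_small hR hfd hr he (hball z hz) hV1 hV2
    have hder : deriv (fun s => fP (primorial N) (s + I * τ)) z = deriv (fP (primorial N)) (z + I * τ) :=
      deriv_comp_add_const _ _ _
    rw [hder] at hq
    have harea : ∀ g : ℂ → ℂ, (∀ s ∈ R, DifferentiableAt ℂ g s) → QQ R g ≤ ε1 → ‖g z‖ ≤ e := by
      intro g hg hgQ
      have a1 := area hR hg hr ((Metric.closedBall_subset_closedBall (by linarith)).trans (hball z hz))
      refine (pow_le_pow_iff_left₀ (norm_nonneg _) he.le two_ne_zero).1 ?_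
      calc _ ≤ C * QQ R g := a1
        _ ≤ C * ε1 := by gcongr
        _ = e ^ 2 := by rw [hε1]; field_simp
    have hxu : ∀ p ∈ PI 0 M, ‖uu p τ - x p‖ ≤ δ := by
      intro p hp
      by_contra hcon
      push Not at hcon
      have := ww_small (PI 0 M) hx m τ hδ0 hp hcon.le
      linarith
    refine lt_of_le_of_lt (final_pt hyM hMN h0 hzre.1 hx hx1 hq
      (logder N (s := z + I * τ) (by simp; linarith) (hsub z hzR) hne) hxu hδL
      (by simpa using (hy1 y (le_max_left _ _) M).le)
      (by simpa using (hy1 M ((le_max_left _ _).trans hyM) N).le)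
      (harea _ (fun s _ => ?_) hZ.le) (b := b) ?_ (hb z hzR).le (hP z hz).le) (by linarith)
    · exact DifferentiableAt.fun_sum fun p hp => (vv_diff (hprime _ _ p hp) s).const_mul _
    · have := harea (fun s => ∑ p ∈ PI y M, (b p - x0 p) * vv p s)
        (fun s _ => DifferentiableAt.fun_sum fun p hp => (vv_diff (hprime _ _ p hp) s).const_mul _)
        (hx0Q.trans ((hQsum y le_rfl M).trans (by linarith)))
      rwa [Finset.sum_congr rfl fun p hp => by rw [hx2 p hp]]
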